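/- Let L be a finitely generated S-module. Then for almost all α and for all i ≥ 0, Ann H^i_𝔫(L_α) = (Ann H^i_𝔪(L))_α, i.e. the annihilator of the i-th local cohomology of the specialization equals the specialization of the annihilator of the i-th local cohomology. -/

import Mathlib

set_option maxHeartbeats 1000000
set_option synthInstance.maxHeartbeats 1000000

noncomputable section

namespace Spl

open MvPolynomial

/-- "Q(α) holds for almost all α ∈ K^m", i.e. away from a proper algebraic
subvariety of `K^m`. -/
def AlmostAll (K : Type) [Field K] (m : ℕ) (Q : (Fin m → K) → Prop) : Prop :=
  ∃ c : MvPolynomial (Fin m) K, c ≠ 0 ∧ ∀ α : Fin m → K, MvPolynomial.eval α c ≠ 0 → Q α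

variable (k K : Type) [Field k] [Field K] [Algebra k K]

/-- the field k(u) of rational functions in u = (u_1, ..., u_m) -/
abbrev kU (m : ℕ) := FractionRing (MvPolynomial (Fin m) k)

/-- the polynomial ring R = k(u)[X_1, ..., X_n] -/
abbrev Rg (m n : ℕ) := MvPolynomial (Fin n) (kU k m)

/-- the subfield k(α) ⊆ K generated by α = (α_1, ..., α_m) over k -/
abbrev kA {m : ℕ} (α : Fin m → K) := IntermediateField.adjoin k (Set.range α)

/-- the polynomial ring R_α = k(α)[X_1, ..., X_n] -/
abbrev Ra {m : ℕ} (n : ℕ) (α : Fin m → K) := MvPolynomial (Fin n) (kA k K α)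

/-- evaluation u ↦ α, from k[u] to k(α) -/
def evalα {m : ℕ} (α : Fin m → K) : MvPolynomial (Fin m) k →+* kA k K α :=
  (MvPolynomial.aeval fun i =>
    (⟨α i, IntermediateField.subset_adjoin k (Set.range α) ⟨i, rfl⟩⟩ : kA k K α)).toRingHom

/-- the inclusion k[u][X] → R = k(u)[X] -/
def toR (m n : ℕ) : MvPolynomial (Fin n) (MvPolynomial (Fin m) k) →+* Rg k m n :=
  MvPolynomial.map (algebraMap (MvPolynomial (Fin m) k) (kU k m))

/-- substitution u ↦ α, from k[u][X] to R_α = k(α)[X] -/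
def toRa {m : ℕ} (n : ℕ) (α : Fin m → K) :
    MvPolynomial (Fin n) (MvPolynomial (Fin m) k) →+* Ra k K n α :=
  MvPolynomial.map (evalα k K α)

/-- Krull's specialization I_α = { f(α,X) | f(u,X) ∈ I ∩ k[u,X] } of an ideal I ⊆ R
(as an ideal of R_α, i.e. the ideal spanned by the specialized elements). -/
def idealSpec {m : ℕ} (n : ℕ) (α : Fin m → K) (I : Ideal (Rg k m n)) :
    Ideal (Ra k K n α) :=
  Ideal.span (toRa k K n α '' { f | toR k m n f ∈ I })

/-- `ElemSpec k K n α f fα` : fα is the specialization of f ∈ R at α, i.e. writing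
f = p(u,X)/q(u) with q(α) ≠ 0 one has fα = p(α,X)/q(α). -/
def ElemSpec {m : ℕ} (n : ℕ) (α : Fin m → K) (f : Rg k m n) (fα : Ra k K n α) : Prop :=
  ∃ (p : MvPolynomial (Fin n) (MvPolynomial (Fin m) k)) (q : MvPolynomial (Fin m) k),
    evalα k K α q ≠ 0 ∧
    MvPolynomial.C (algebraMap (MvPolynomial (Fin m) k) (kU k m) q) * f = toR k m n p ∧
    MvPolynomial.C (evalα k K α q) * fα = toRa k K n α p

variable {k K}

/-- `LocElemSpec P ℘ a aα` : aα ∈ S_α = (R_α)_℘ is the specialization of a ∈ S = R_P,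
i.e. writing a = f/g with f, g ∈ R, g ∉ P, one has g_α ∉ ℘ and aα = f_α/g_α. -/
def LocElemSpec {m n : ℕ} {α : Fin m → K} (P : Ideal (Rg k m n)) [P.IsPrime]
    (℘ : Ideal (Ra k K n α)) [℘.IsPrime]
    {S : Type} [CommRing S] [Algebra (Rg k m n) S] [IsLocalization.AtPrime S P]
    {Sα : Type} [CommRing Sα] [Algebra (Ra k K n α) Sα] [IsLocalization.AtPrime Sα ℘]
    (a : S) (aα : Sα) : Prop :=
  ∃ (f g : Rg k m n) (fα gα : Ra k K n α) (hg : g ∈ P.primeCompl)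
    (hgα : gα ∈ ℘.primeCompl),
    ElemSpec k K n α f fα ∧ ElemSpec k K n α g gα ∧
    a = IsLocalization.mk' S f ⟨g, hg⟩ ∧
    aα = IsLocalization.mk' Sα fα ⟨gα, hgα⟩

/-- entrywise specialization of matrices, relative to an element-specialization
relation `E`. -/
def MatSpec {S T : Type} (E : S → T → Prop) {r s : ℕ}
    (A : Matrix (Fin r) (Fin s) S) (B : Matrix (Fin r) (Fin s) T) : Prop :=
  ∀ i j, E (A i j) (B i j)

/-- the cokernel of the linear map attached to a matrix A, i.e. the module
presented by A. -/
abbrev MatCoker {S : Type} [CommRing S] {r s : ℕ} (A : Matrix (Fin r) (Fin s) S) :=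
  (Fin r → S) ⧸ LinearMap.range A.mulVecLin

/-- a finite free presentation F_1 → F_0 → L → 0 of the module L, where the map
F_1 → F_0 is given by the matrix A and the map F_0 → L is π. -/
structure Present (S : Type) [CommRing S] (r s : ℕ) (L : Type) [AddCommGroup L]
    [Module S L] where
  A : Matrix (Fin r) (Fin s) S
  π : (Fin r → S) →ₗ[S] L
  surj : Function.Surjective π
  ker_eq : LinearMap.ker π = LinearMap.range A.mulVecLin

theorem comm_le {S : Type} [CommRing S] {r s r' s' : ℕ} {B : Matrix (Fin r) (Fin s) S}
    {C : Matrix (Fin r') (Fin s') S} {W : Matrix (Fin r') (Fin r) S}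
    {W1 : Matrix (Fin s') (Fin s) S} (h : W * B = C * W1) :
    LinearMap.range B.mulVecLin ≤ (LinearMap.range C.mulVecLin).comap W.mulVecLin := by
  rintro x ⟨y, rfl⟩
  exact ⟨W1.mulVecLin y, by
    simp only [Matrix.mulVecLin_apply, Matrix.mulVec_mulVec, h]⟩

/-- the map between the modules presented by B and C induced by the matrix W
(a specialization of a lift of a map between the presented modules). -/
def cokerMap {S : Type} [CommRing S] {r s r' s' : ℕ} {B : Matrix (Fin r) (Fin s) S}
    {C : Matrix (Fin r') (Fin s') S} (W : Matrix (Fin r') (Fin r) S)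
    (h : LinearMap.range B.mulVecLin ≤ (LinearMap.range C.mulVecLin).comap W.mulVecLin) :
    MatCoker B →ₗ[S] MatCoker C :=
  Submodule.mapQ _ _ W.mulVecLin h

/-- a lift of a homomorphism v : L → M to given finite free presentations of L and M:
a commutative diagram whose vertical maps are given by the matrices V1, V0. -/
structure MapLift {S : Type} [CommRing S] {rL sL rM sM : ℕ} {L M : Type}
    [AddCommGroup L] [Module S L] [AddCommGroup M] [Module S M]
    (pL : Present S rL sL L) (pM : Present S rM sM M) (v : L →ₗ[S] M) where
  V0 : Matrix (Fin rM) (Fin rL) S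
  V1 : Matrix (Fin sM) (Fin sL) S
  comm0 : pM.π ∘ₗ V0.mulVecLin = v ∘ₗ pL.π
  comm1 : V0 * pL.A = pM.A * V1

/-- Krull dimension of a module, dim L = dim S/Ann L. -/
def moduleDim (S : Type) [CommRing S] (L : Type) [AddCommGroup L] [Module S L] :
    WithBot ℕ∞ :=
  ringKrullDim (S ⧸ Module.annihilator S L)

/-- height of an ideal: the infimum of dim S_p over the primes p ⊇ I. -/
def idealHeight {S : Type} [CommRing S] (I : Ideal S) : WithBot ℕ∞ :=
  sInf { d | ∃ (p : Ideal S) (hp : p.IsPrime), I ≤ p ∧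
    d = ringKrullDim (Localization (@Ideal.primeCompl _ _ p hp)) }

/-- length of a module: the longest chain of submodules. -/
def moduleLength (S : Type) [CommRing S] (L : Type) [AddCommGroup L] [Module S L] :
    WithBot ℕ∞ :=
  Order.krullDim (Submodule S L)

/-- grade(𝔞, L) ≥ t : there is an L-regular sequence of length t in 𝔞. -/
def GradeGE {S : Type} [CommRing S] (𝔞 : Ideal S) (L : Type) [AddCommGroup L]
    [Module S L] (t : ℕ) : Prop :=
  ∃ rs : List S, rs.length = t ∧ (∀ x ∈ rs, x ∈ 𝔞) ∧ RingTheory.Sequence.IsRegular L rs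

/-- grade(𝔞, L) : the length of a maximal L-regular sequence in 𝔞. -/
def grade {S : Type} [CommRing S] (𝔞 : Ideal S) (L : Type) [AddCommGroup L]
    [Module S L] : ℕ∞ :=
  sSup { t : ℕ∞ | ∃ t' : ℕ, t = (t' : ℕ∞) ∧ GradeGE 𝔞 L t' }

/-- depth of a module over a local ring: grade(𝔪, L). -/
def depth (S : Type) [CommRing S] [IsLocalRing S] (L : Type) [AddCommGroup L]
    [Module S L] : ℕ∞ :=
  grade (IsLocalRing.maximalIdeal S) L

/-- proj dim L ≤ d : L admits a finite free resolution of length ≤ d, encoded as a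
(possibly infinite) free resolution ⋯ → F_1 → F_0 → L → 0 with F_j = 0 for j > d. -/
def ProjDimLE (S : Type) [CommRing S] (L : Type) [AddCommGroup L] [Module S L]
    (d : ℕ) : Prop :=
  ∃ (r : ℕ → ℕ) (A : ∀ j : ℕ, Matrix (Fin (r j)) (Fin (r (j + 1))) S)
    (π : (Fin (r 0) → S) →ₗ[S] L),
    Function.Surjective π ∧ LinearMap.ker π = LinearMap.range (A 0).mulVecLin ∧
    (∀ j : ℕ, LinearMap.ker (A j).mulVecLin = LinearMap.range (A (j + 1)).mulVecLin) ∧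
    ∀ j : ℕ, d < j → r j = 0

/-- projective dimension of a module, as an extended natural number. -/
def projDim (S : Type) [CommRing S] (L : Type) [AddCommGroup L] [Module S L] : ℕ∞ :=
  sInf { d : ℕ∞ | ∃ d' : ℕ, d = (d' : ℕ∞) ∧ ProjDimLE S L d' }

/-- the i-th local cohomology module H^i_𝔞(L) as a module. -/
abbrev localCoh {S : Type} [CommRing S] (𝔞 : Ideal S) (i : ℕ) (L : Type)
    [AddCommGroup L] [Module S L] : ModuleCat S :=
  (localCohomology 𝔞 i).obj (ModuleCat.of S L)

/-- the colon submodule (0 :_L 𝔞) = { x ∈ L | 𝔞 x = 0 }. -/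
def colonSubmodule {S : Type} [CommRing S] (𝔞 : Ideal S) (L : Type) [AddCommGroup L]
    [Module S L] : Submodule S L where
  carrier := { x | ∀ c ∈ 𝔞, c • x = 0 }
  add_mem' := by
    intro a b ha hb c hc
    rw [smul_add, ha c hc, hb c hc, add_zero]
  zero_mem' := by
    intro c _
    rw [smul_zero]
  smul_mem' := by
    intro s x hx c hc
    rw [smul_comm, hx c hc, smul_zero]

/-- a (partial) system of parameters: the d = dim L elements a_1, ..., a_d lie in the
maximal ideal and L/(a_1, ..., a_d)L has dimension ≤ 0. -/
def IsSOP (S : Type) [CommRing S] [IsLocalRing S] (L : Type) [AddCommGroup L]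
    [Module S L] {d : ℕ} (a : Fin d → S) : Prop :=
  (∀ i, a i ∈ IsLocalRing.maximalIdeal S) ∧
  moduleDim S L = (d : ℕ∞) ∧
  moduleDim S (L ⧸ (Ideal.span (Set.range a) • (⊤ : Submodule S L))) ≤ 0

/-- a standard system of parameters: (a_1, ..., a_d) H^i_𝔪(L/(a_1, ..., a_j)L) = 0
for all i + j < d. -/
def IsStandardSOP (S : Type) [CommRing S] [IsLocalRing S] (L : Type) [AddCommGroup L]
    [Module S L] {d : ℕ} (a : Fin d → S) : Prop :=
  IsSOP S L a ∧
  ∀ i j : ℕ, i + j < d →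
    Ideal.span (Set.range a) ≤ Module.annihilator S
      (localCoh (IsLocalRing.maximalIdeal S) i
        (L ⧸ (Ideal.span (a '' { x : Fin d | (x : ℕ) < j }) • (⊤ : Submodule S L))))

/-- a standard ideal for L: an 𝔪-primary ideal 𝔞 such that every system of
parameters of L contained in 𝔞 is standard. -/
def IsStandardIdeal (S : Type) [CommRing S] [IsLocalRing S] (L : Type) [AddCommGroup L]
    [Module S L] (𝔞 : Ideal S) : Prop :=
  𝔞.radical = IsLocalRing.maximalIdeal S ∧
  ∀ (d : ℕ) (a : Fin d → S), (∀ i, a i ∈ 𝔞) → IsSOP S L a → IsStandardSOP S L a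

section ExtComparison

open CategoryTheory CategoryTheory.Limits Opposite

universe u

variable {S : Type u} [CommRing S]

/-- The functor `Hom(-, Y)` into the opposite category. -/
abbrev homFunctor (Y : ModuleCat.{u} S) : ModuleCat.{u} S ⥤ (ModuleCat.{u} S)ᵒᵖ :=
  ((linearYoneda S (ModuleCat.{u} S)).obj Y).rightOp

/-- The complex obtained by applying `Hom(-, Y)` to a projective resolution, viewed in the
opposite category. -/
abbrev homComplex {X : ModuleCat.{u} S} (Q : ProjectiveResolution X) (Y : ModuleCat.{u} S) :
    ChainComplex (ModuleCat.{u} S)ᵒᵖ ℕ :=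
  ((homFunctor Y).mapHomologicalComplex _).obj Q.complex

/-- The `Ext` modules of `Mathlib.CategoryTheory.Abelian.Ext`. -/
abbrev DExt (X Y : ModuleCat.{u} S) (n : ℕ) : ModuleCat.{u} S :=
  unop (((homFunctor Y).leftDerived n).obj X)

/-- The homology of the complex of cochains computes `DExt`. -/
def homologyIso {X : ModuleCat.{u} S} (Q : ProjectiveResolution X) (Y : ModuleCat.{u} S) (n : ℕ) :
    (homComplex Q Y).homology n ≅ ((homFunctor Y).leftDerived n).obj X :=
  (Q.isoLeftDerivedObj (homFunctor Y) n).symm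

/-- The embedding of a derived `Ext` module into the cochains modulo coboundaries. -/
def dExtι {X : ModuleCat.{u} S} (Q : ProjectiveResolution X) (Y : ModuleCat.{u} S) (n : ℕ) :
    DExt X Y n ⟶ ((homComplex Q Y).cycles n).unop :=
  ((homComplex Q Y).homologyπ n ≫
    (homologyIso Q Y n).hom).unop

/-- The projection from cochains onto cochains modulo coboundaries. -/
def cochainπ {X : ModuleCat.{u} S} (Q : ProjectiveResolution X) (Y : ModuleCat.{u} S) (n : ℕ) :
    ModuleCat.of S (Q.complex.X n ⟶ Y) ⟶ ((homComplex Q Y).cycles n).unop :=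
  ((homComplex Q Y).iCycles n).unop

/-- The cochain `f` represents the class `x`. -/
def Represents {X : ModuleCat.{u} S} (Q : ProjectiveResolution X) {Y : ModuleCat.{u} S} {n : ℕ}
    (x : DExt X Y n) (f : Q.complex.X n ⟶ Y) : Prop :=
  (dExtι Q Y n).hom x = (cochainπ Q Y n).hom f

lemma cochainπ_surjective {X : ModuleCat.{u} S} (Q : ProjectiveResolution X)
    (Y : ModuleCat.{u} S) (n : ℕ) : Function.Surjective (cochainπ Q Y n).hom := by
  have : Epi (cochainπ Q Y n) := unop_epi_of_mono _
  exact (ModuleCat.epi_iff_surjective _).1 this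

lemma dExtι_injective {X : ModuleCat.{u} S} (Q : ProjectiveResolution X)
    (Y : ModuleCat.{u} S) (n : ℕ) : Function.Injective (dExtι Q Y n).hom := by
  have : Mono (dExtι Q Y n) := by
    have : Epi ((homComplex Q Y).homologyπ n ≫ (homologyIso Q Y n).hom) := epi_comp _ _
    exact unop_mono_of_epi _
  exact (ModuleCat.mono_iff_injective _).1 this

lemma cochainπ_eq_zero_iff {X : ModuleCat.{u} S} (Q : ProjectiveResolution X)
    (Y : ModuleCat.{u} S) {n p : ℕ} (hp : p + 1 = n) (f : Q.complex.X n ⟶ Y) :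
    (cochainπ Q Y n).hom f = 0 ↔ ∃ g : Q.complex.X p ⟶ Y, Q.complex.d n p ≫ g = f := by
  constructor
  · intro h
    have ex : (ShortComplex.mk _ _ ((homComplex Q Y).iCycles_d n p)).Exact :=
      ShortComplex.exact_of_f_is_kernel _ ((homComplex Q Y).cyclesIsKernel n p (by subst hp; simp))
    exact (ShortComplex.moduleCat_exact_iff _).1 ex.unop f h
  · rintro ⟨g, rfl⟩
    have := (homComplex Q Y).iCycles_d n p
    have h2 := congrArg Quiver.Hom.unop this
    exact congrArg
      (fun (t : ((homComplex Q Y).X p).unop ⟶ ((homComplex Q Y).cycles n).unop) => t.hom g) h2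

lemma cochainπ_injective_zero {X : ModuleCat.{u} S} (Q : ProjectiveResolution X)
    (Y : ModuleCat.{u} S) : Function.Injective (cochainπ Q Y 0).hom := by
  have : IsIso ((homComplex Q Y).iCycles 0) :=
    (homComplex Q Y).isIso_iCycles 0 _ rfl ((homComplex Q Y).shape _ _ (by simp))
  have : Mono (cochainπ Q Y 0) := unop_mono_of_epi _
  exact (ModuleCat.mono_iff_injective _).1 this

lemma Represents.cocycle {X : ModuleCat.{u} S} {Q : ProjectiveResolution X} {Y : ModuleCat.{u} S}
    {n : ℕ} {x : DExt X Y n} {f : Q.complex.X n ⟶ Y} (h : Represents Q x f) :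
    Q.complex.d (n + 1) n ≫ f = 0 := by
  have e1 := congrArg Quiver.Hom.unop ((homComplex Q Y).toCycles_i (n + 1) n)
  have e2 : (homComplex Q Y).toCycles (n + 1) n ≫ (homComplex Q Y).homologyπ n = 0 :=
    (homComplex Q Y).toCycles_comp_homologyπ _ _
  have e3 : dExtι Q Y n ≫ ((homComplex Q Y).toCycles (n + 1) n).unop = 0 := by
    unfold dExtι
    rw [← unop_comp, reassoc_of% e2]
    simp
  have e4 : (cochainπ Q Y n ≫ ((homComplex Q Y).toCycles (n + 1) n).unop).hom f = 0 := by
    rw [ModuleCat.hom_comp, LinearMap.comp_apply, ← h, ← LinearMap.comp_apply,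
      ← ModuleCat.hom_comp, e3]
    rfl
  have e5 := congrArg (fun (t : ((homComplex Q Y).X n).unop ⟶ ((homComplex Q Y).X (n+1)).unop) =>
    t.hom f) e1
  exact e5.symm.trans e4

lemma exists_represents_of_cocycle {X : ModuleCat.{u} S} {Q : ProjectiveResolution X}
    {Y : ModuleCat.{u} S} {n : ℕ} {f : Q.complex.X n ⟶ Y}
    (hf : Q.complex.d (n + 1) n ≫ f = 0) : ∃ x : DExt X Y n, Represents Q x f := by
  have ex : (ShortComplex.mk _ _ ((homComplex Q Y).toCycles_comp_homologyπ (n + 1) n)).Exact :=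
    ShortComplex.exact_of_g_is_cokernel _
      ((homComplex Q Y).homologyIsCokernel (n + 1) n (by simp))
  have e1 := congrArg Quiver.Hom.unop ((homComplex Q Y).toCycles_i (n + 1) n)
  have e5 := congrArg (fun (t : ((homComplex Q Y).X n).unop ⟶ ((homComplex Q Y).X (n+1)).unop) =>
    t.hom f) e1
  obtain ⟨z, hz⟩ := (ShortComplex.moduleCat_exact_iff _).1 ex.unop ((cochainπ Q Y n).hom f)
    (e5.trans hf)
  refine ⟨(homologyIso Q Y n).inv.unop.hom z, ?_⟩
  have e6 : (homologyIso Q Y n).inv.unop ≫ dExtι Q Y n = ((homComplex Q Y).homologyπ n).unop := by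
    unfold dExtι
    rw [← unop_comp, Category.assoc]
    simp
  have e7 := congrArg (fun t => ModuleCat.Hom.hom t z) e6
  exact e7.trans hz

lemma Represents.exists {X : ModuleCat.{u} S} (Q : ProjectiveResolution X) {Y : ModuleCat.{u} S}
    {n : ℕ} (x : DExt X Y n) : ∃ f : Q.complex.X n ⟶ Y, Represents Q x f := by
  obtain ⟨f, hf⟩ := cochainπ_surjective Q Y n ((dExtι Q Y n).hom x)
  exact ⟨f, hf.symm⟩

lemma Represents.smul {X : ModuleCat.{u} S} {Q : ProjectiveResolution X} {Y : ModuleCat.{u} S}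
    {n : ℕ} {x : DExt X Y n} {f : Q.complex.X n ⟶ Y} (h : Represents Q x f) (c : S) :
    Represents Q (c • x) (c • f) := by
  unfold Represents at *
  rw [map_smul, h]
  exact ((cochainπ Q Y n).hom.map_smul c f).symm

lemma Represents.map {X X' : ModuleCat.{u} S} {Q : ProjectiveResolution X}
    {Q' : ProjectiveResolution X'} {Y : ModuleCat.{u} S} {n : ℕ} {x : DExt X Y n}
    {f : Q.complex.X n ⟶ Y} (h : Represents Q x f) (g : X' ⟶ X)
    (φ : ProjectiveResolution.Hom Q' Q g) :
    Represents Q' ((((homFunctor Y).leftDerived n).map g).unop.hom x)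
      (φ.hom.f n ≫ f) := by
  have comm : φ.hom.f 0 ≫ Q.π.f 0 = Q'.π.f 0 ≫ g := by
    rw [φ.hom_f_zero_comp_π_f_zero]
    rfl
  have nat : (homologyIso Q' Y n).hom ≫ ((homFunctor Y).leftDerived n).map g =
      HomologicalComplex.homologyMap (((homFunctor Y).mapHomologicalComplex _).map φ.hom) n ≫
        (homologyIso Q Y n).hom :=
    ProjectiveResolution.isoLeftDerivedObj_inv_naturality g Q' Q φ.hom comm (homFunctor Y) n
  have e1 : (((homFunctor Y).leftDerived n).map g).unop ≫ dExtι Q' Y n =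
      dExtι Q Y n ≫ (HomologicalComplex.cyclesMap
        (((homFunctor Y).mapHomologicalComplex _).map φ.hom) n).unop := by
    unfold dExtι
    rw [← unop_comp, ← unop_comp]
    congr 1
    rw [Category.assoc, nat]
    exact HomologicalComplex.homologyπ_naturality_assoc
      (((homFunctor Y).mapHomologicalComplex _).map φ.hom) n _
  have e2 := congrArg Quiver.Hom.unop (HomologicalComplex.cyclesMap_i
        (((homFunctor Y).mapHomologicalComplex _).map φ.hom) n)
  have e3 := congrArg (fun t => ModuleCat.Hom.hom t x) e1
  have e4 := congrArg (fun (t : ((homComplex Q Y).X n).unop ⟶ ((homComplex Q' Y).cycles n).unop) =>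
    t.hom f) e2
  refine e3.trans ?_
  refine Eq.trans ?_ e4
  exact congrArg (fun t => (HomologicalComplex.cyclesMap
        (((homFunctor Y).mapHomologicalComplex _).map φ.hom) n).unop.hom t) h

end ExtComparison

section ExtComparison

open CategoryTheory CategoryTheory.Limits Opposite Abelian

universe u

variable {S : Type u} [CommRing S]

lemma extMk_eq_zero_iff_zero {X Y : ModuleCat.{u} S} (Q : ProjectiveResolution X)
    (f : Q.complex.X 0 ⟶ Y) (hf : Q.complex.d 1 0 ≫ f = 0) :
    Q.extMk f 1 rfl hf = 0 ↔ f = 0 := by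
  constructor
  · intro h
    rw [← Q.extEquivCohomologyClass.apply_eq_iff_eq, Q.extEquivCohomologyClass_extMk,
      Q.extEquivCohomologyClass_zero, CochainComplex.HomComplex.CohomologyClass.mk_eq_zero_iff,
      CochainComplex.HomComplex.Cocycle.toSingleMk_mem_coboundaries_iff _ _ _ _ _ 1 (by simp)] at h
    obtain ⟨g, hg⟩ := h
    have hz : IsZero (Q.cochainComplex.X 1) :=
      HomologicalComplex.isZero_extend_X _ _ _ (by
        intro i hi
        have : (ComplexShape.embeddingDownNat.f i) = - (i : ℤ) := rfl
        rw [this] at hi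
        omega)
    rw [hz.eq_of_src g 0] at hg
    rw [← cancel_epi (Q.cochainComplexXIso (-(0:ℕ)) 0 rfl).hom]
    simpa using hg.symm
  · rintro rfl
    exact Q.extMk_zero 1 rfl

lemma smul_extMk {X Y : ModuleCat.{u} S} (Q : ProjectiveResolution X) {n : ℕ}
    (f : Q.complex.X n ⟶ Y) (hf : Q.complex.d (n + 1) n ≫ f = 0) (c : S) :
    c • Q.extMk f (n + 1) rfl hf = Q.extMk (c • f) (n + 1) rfl (by simp [hf]) := by
  rw [Ext.smul_eq_comp_mk₀, Q.extMk_comp_mk₀]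
  congr 1

lemma Represents.eq_zero_iff {X Y : ModuleCat.{u} S} {Q : ProjectiveResolution X} {n : ℕ}
    {x : DExt X Y n} {f : Q.complex.X n ⟶ Y} (h : Represents Q x f) :
    x = 0 ↔ Q.extMk f (n + 1) rfl h.cocycle = 0 := by
  have h0 : x = 0 ↔ (cochainπ Q Y n).hom f = 0 := by
    rw [← h, map_eq_zero_iff _ (dExtι_injective Q Y n)]
  rw [h0]
  cases n with
  | zero =>
    rw [extMk_eq_zero_iff_zero, map_eq_zero_iff _ (cochainπ_injective_zero Q Y)]
  | succ p => rw [Q.extMk_eq_zero_iff _ _ _ _ p rfl, cochainπ_eq_zero_iff Q Y rfl]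

/-- A class in the derived `Ext` module corresponds to a class in the `Ext` group. -/
def Matches {X Y : ModuleCat.{u} S} {n : ℕ} (x : DExt X Y n) (y : Ext X Y n) : Prop :=
  ∃ (f : (projectiveResolution X).complex.X n ⟶ Y) (h : Represents (projectiveResolution X) x f),
    y = (projectiveResolution X).extMk f (n + 1) rfl h.cocycle

lemma Matches.exists_right {X Y : ModuleCat.{u} S} {n : ℕ} (x : DExt X Y n) :
    ∃ y, Matches x y := by
  obtain ⟨f, hf⟩ := Represents.exists (projectiveResolution X) x
  exact ⟨_, f, hf, rfl⟩

lemma Matches.exists_left {X Y : ModuleCat.{u} S} {n : ℕ} (y : Ext X Y n) :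
    ∃ x, Matches x y := by
  obtain ⟨f, hf, rfl⟩ := (projectiveResolution X).extMk_surjective y _ rfl
  obtain ⟨x, hx⟩ := exists_represents_of_cocycle hf
  exact ⟨x, f, hx, rfl⟩

lemma Matches.eq_zero_iff {X Y : ModuleCat.{u} S} {n : ℕ} {x : DExt X Y n} {y : Ext X Y n}
    (h : Matches x y) : x = 0 ↔ y = 0 := by
  obtain ⟨f, hf, rfl⟩ := h
  exact hf.eq_zero_iff

lemma Matches.smul {X Y : ModuleCat.{u} S} {n : ℕ} {x : DExt X Y n} {y : Ext X Y n}
    (h : Matches x y) (c : S) : Matches (c • x) (c • y) := by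
  obtain ⟨f, hf, rfl⟩ := h
  exact ⟨c • f, hf.smul c, smul_extMk _ _ _ _⟩

lemma Matches.map {X X' Y : ModuleCat.{u} S} {n : ℕ} {x : DExt X Y n} {y : Ext X Y n}
    (h : Matches x y) (g : X' ⟶ X) :
    Matches ((((homFunctor Y).leftDerived n).map g).unop.hom x)
      ((Ext.mk₀ g).comp y (zero_add n)) := by
  obtain ⟨f, hf, rfl⟩ := h
  let φ : ProjectiveResolution.Hom (projectiveResolution X') (projectiveResolution X) g :=
    ⟨ProjectiveResolution.lift g _ _, by
      have := ProjectiveResolution.lift_commutes_zero g (projectiveResolution X')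
        (projectiveResolution X)
      rw [this]
      rfl⟩
  exact ⟨_, hf.map g φ, ProjectiveResolution.mk₀_comp_extMk _ _ _ _ φ⟩

end ExtComparison

section LocalCohomology

open CategoryTheory CategoryTheory.Limits Opposite Abelian

variable {S : Type} [CommRing S]

/-- The projection `S / J ^ t' → S / J ^ t` for `t ≤ t'`. -/
def powProj (J : Ideal S) {t t' : ℕ} (h : t ≤ t') :
    ModuleCat.of S (S ⧸ J ^ t') ⟶ ModuleCat.of S (S ⧸ J ^ t) :=
  ModuleCat.ofHom (Submodule.mapQ _ _ LinearMap.id (Ideal.pow_le_pow_right h))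

lemma mem_annihilator_colimit_iff {J : Type} [SmallCategory J] [IsFiltered J]
    (F : J ⥤ ModuleCat.{0} S) {κ : Cocone F} (hκ : IsColimit κ) (c : S) :
    c ∈ Module.annihilator S κ.pt ↔
      ∀ (j : J) (x : F.obj j), ∃ (j' : J) (f : j ⟶ j'), c • F.map f x = 0 := by
  rw [Module.mem_annihilator]
  constructor
  · intro H j x
    have h1 : κ.ι.app j (c • x) = κ.ι.app j 0 := by rw [map_smul, H, map_zero]
    obtain ⟨k, f, g, hfg⟩ := Concrete.isColimit_exists_of_rep_eq F hκ _ _ h1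
    exact ⟨k, f, by rw [← map_smul, hfg, map_zero]⟩
  · intro H z
    obtain ⟨j, x, rfl⟩ := Concrete.isColimit_exists_rep F hκ z
    obtain ⟨j', f, hf⟩ := H j x
    rw [← κ.w f, ModuleCat.comp_apply, ← map_smul]
    refine (congrArg _ hf).trans ?_
    exact map_zero (κ.ι.app j').hom

lemma mem_annihilator_localCoh_iff (J : Ideal S) (i : ℕ) (M : Type) [AddCommGroup M] [Module S M]
    (c : S) : c ∈ Module.annihilator S (localCoh J i M) ↔
      ∀ (t : ℕ) (x : Ext (ModuleCat.of S (S ⧸ J ^ t)) (ModuleCat.of S M) i),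
        ∃ (t' : ℕ) (h : t ≤ t'), c • (Ext.mk₀ (powProj J h)).comp x (zero_add i) = 0 := by
  let D := localCohomology.diagram (localCohomology.idealPowersDiagram J) i
  let ev := (evaluation (ModuleCat.{0} S) (ModuleCat.{0} S)).obj (ModuleCat.of S M)
  have hc : IsColimit (ev.mapCocone (colimit.cocone D)) :=
    isColimitOfPreserves ev (colimit.isColimit D)
  have key : c ∈ Module.annihilator S (localCoh J i M) ↔
      ∀ (t : ℕ) (x : DExt (ModuleCat.of S (S ⧸ J ^ t)) (ModuleCat.of S M) i),
        ∃ (t' : ℕ) (h : t ≤ t'), c • (((homFunctor (ModuleCat.of S M)).leftDerived i).map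
          (powProj J h)).unop.hom x = 0 := by
    refine (mem_annihilator_colimit_iff (D ⋙ ev) hc c).trans ⟨fun H t x => ?_, ?_⟩
    · obtain ⟨⟨⟨t'⟩⟩, f, hf⟩ := H (op (op t)) x
      exact ⟨t', leOfHom f.unop.unop, hf⟩
    · rintro H ⟨⟨t⟩⟩ x
      obtain ⟨t', h, hf⟩ := H t x
      exact ⟨op (op t'), (homOfLE h).op.op, hf⟩
  rw [key]
  constructor
  · intro H t y
    obtain ⟨x, hx⟩ := Matches.exists_left y
    obtain ⟨t', h, e⟩ := H t x
    exact ⟨t', h, ((hx.map (powProj J h)).smul c).eq_zero_iff.1 e⟩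
  · intro H t x
    obtain ⟨y, hx⟩ := Matches.exists_right x
    obtain ⟨t', h, e⟩ := H t y
    exact ⟨t', h, ((hx.map (powProj J h)).smul c).eq_zero_iff.2 e⟩

end LocalCohomology

section ExtModules

open CategoryTheory CategoryTheory.Abelian

universe u

variable {S : Type u} [CommRing S]

/-- `Ext` groups between (unbundled) modules. -/
abbrev ExtM (S : Type u) [CommRing S] (N M : Type u) [AddCommGroup N] [Module S N]
    [AddCommGroup M] [Module S M] (i : ℕ) : Type u :=
  Ext (ModuleCat.of S N) (ModuleCat.of S M) i

variable {N N' N'' M M' M'' : Type u} [AddCommGroup N] [Module S N] [AddCommGroup N'] [Module S N']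
  [AddCommGroup N''] [Module S N''] [AddCommGroup M] [Module S M] [AddCommGroup M'] [Module S M']
  [AddCommGroup M''] [Module S M''] {i j : ℕ}

/-- Precomposition with a linear map. -/
def extPull (f : N' →ₗ[S] N) : ExtM S N M i →ₗ[S] ExtM S N' M i where
  toFun x := (Ext.mk₀ (ModuleCat.ofHom f)).comp x (zero_add i)
  map_add' _ _ := Ext.comp_add _ _ _ _
  map_smul' _ _ := Ext.comp_smul _ _ _ _

/-- Postcomposition with a linear map. -/
def extPush (g : M →ₗ[S] M') : ExtM S N M i →ₗ[S] ExtM S N M' i where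
  toFun x := x.comp (Ext.mk₀ (ModuleCat.ofHom g)) (add_zero i)
  map_add' _ _ := Ext.add_comp _ _ _ _
  map_smul' _ _ := Ext.smul_comp _ _ _ _

lemma extPull_apply (f : N' →ₗ[S] N) (x : ExtM S N M i) :
    extPull f x = (Ext.mk₀ (ModuleCat.ofHom f)).comp x (zero_add i) := rfl

lemma extPush_apply (g : M →ₗ[S] M') (x : ExtM S N M i) :
    extPush g x = x.comp (Ext.mk₀ (ModuleCat.ofHom g)) (add_zero i) := rfl

@[simp] lemma extPull_id (x : ExtM S N M i) : extPull (LinearMap.id : N →ₗ[S] N) x = x :=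
  Ext.mk₀_id_comp x

@[simp] lemma extPush_id (x : ExtM S N M i) : extPush (LinearMap.id : M →ₗ[S] M) x = x :=
  Ext.comp_mk₀_id x

lemma extPull_extPull (f : N' →ₗ[S] N) (g : N'' →ₗ[S] N') (x : ExtM S N M i) :
    extPull g (extPull f x) = extPull (f ∘ₗ g) x := by
  simp only [extPull_apply]
  rw [Ext.mk₀_comp_mk₀_assoc]
  rfl

lemma extPush_extPush (f : M →ₗ[S] M') (g : M' →ₗ[S] M'') (x : ExtM S N M i) :
    extPush g (extPush f x) = extPush (g ∘ₗ f) x := by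
  simp only [extPush_apply]
  rw [Ext.comp_assoc_of_third_deg_zero, Ext.mk₀_comp_mk₀]
  rfl

lemma extPull_extPush (f : N' →ₗ[S] N) (g : M →ₗ[S] M') (x : ExtM S N M i) :
    extPull f (extPush g x) = extPush g (extPull f x) := by
  simp only [extPush_apply, extPull_apply]
  rw [Ext.comp_assoc_of_third_deg_zero]

lemma extPull_add (f g : N' →ₗ[S] N) (x : ExtM S N M i) :
    extPull (f + g) x = extPull f x + extPull g x := by
  simp only [extPull_apply, ModuleCat.ofHom_add, Ext.mk₀_add, Ext.add_comp]

lemma extPush_add (f g : M →ₗ[S] M') (x : ExtM S N M i) :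
    extPush (f + g) x = extPush f x + extPush g x := by
  simp only [extPush_apply, ModuleCat.ofHom_add, Ext.mk₀_add, Ext.comp_add]

lemma extPull_smul (c : S) (f : N' →ₗ[S] N) (x : ExtM S N M i) :
    extPull (c • f) x = c • extPull f x := by
  simp only [extPull_apply]
  rw [show ModuleCat.ofHom (c • f) = c • ModuleCat.ofHom f from rfl, Ext.mk₀_smul, Ext.smul_comp]

lemma extPush_smul (c : S) (f : M →ₗ[S] M') (x : ExtM S N M i) :
    extPush (c • f) x = c • extPush f x := by
  simp only [extPush_apply]
  rw [show ModuleCat.ofHom (c • f) = c • ModuleCat.ofHom f from rfl, Ext.mk₀_smul, Ext.comp_smul]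

@[simp] lemma extPull_zero (x : ExtM S N M i) : extPull (0 : N' →ₗ[S] N) x = 0 := by
  simpa using extPull_smul (0 : S) (0 : N' →ₗ[S] N) x

@[simp] lemma extPush_zero (x : ExtM S N M i) : extPush (0 : M →ₗ[S] M') x = 0 := by
  have h := extPush_smul (0 : S) (0 : M →ₗ[S] M') x
  simpa using h

/-- The short complex attached to a short exact sequence of modules. -/
lemma shortExact_of_exact {f : M →ₗ[S] M'} {g : M' →ₗ[S] M''} (hf : Function.Injective f)
    (hfg : Function.Exact f g) (hg : Function.Surjective g) :
    (ShortComplex.mk (ModuleCat.ofHom f) (ModuleCat.ofHom g)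
      (by ext x; exact (hfg (f x)).2 ⟨x, rfl⟩)).ShortExact :=
  ModuleCat.shortComplex_shortExact _ hfg hf hg

section

variable {f : M →ₗ[S] M'} {g : M' →ₗ[S] M''} (hf : Function.Injective f)
    (hfg : Function.Exact f g) (hg : Function.Surjective g)
include hf hfg hg

lemma extPush_exact (y : ExtM S N M' i) (hy : extPush g y = 0) :
    ∃ x : ExtM S N M i, extPush f x = y :=
  Ext.covariant_sequence_exact₂ _ (shortExact_of_exact hf hfg hg) y hy

/-- The connecting homomorphism of the long exact sequence in the second variable. -/
lemma exists_extConnecting (i : ℕ) :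
    ∃ δ : ∀ (N : Type u) [AddCommGroup N] [Module S N], ExtM S N M'' i →ₗ[S] ExtM S N M (i + 1),
      (∀ (N N' : Type u) [AddCommGroup N] [Module S N] [AddCommGroup N'] [Module S N']
        (h : N' →ₗ[S] N) (x : ExtM S N M'' i), extPull h (δ N x) = δ N' (extPull h x)) ∧
      (∀ (N : Type u) [AddCommGroup N] [Module S N] (x : ExtM S N M'' i), δ N x = 0 →
        ∃ y : ExtM S N M' i, extPush g y = x) ∧
      (∀ (N : Type u) [AddCommGroup N] [Module S N] (x : ExtM S N M (i + 1)), extPush f x = 0 →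
        ∃ y, δ N y = x) ∧
      (∀ (N : Type u) [AddCommGroup N] [Module S N] (x : ExtM S N M'' i),
        extPush f (δ N x) = 0) := by
  have hS := shortExact_of_exact hf hfg hg
  refine ⟨fun N _ _ => ⟨⟨fun x => x.comp hS.extClass rfl, fun x y => Ext.add_comp _ _ _ _⟩,
    fun c x => Ext.smul_comp _ _ rfl _⟩, ?_, ?_, ?_, ?_⟩
  · intro N N' _ _ _ _ h x
    exact (Ext.comp_assoc _ _ _ (zero_add i) rfl (by omega)).symm
  · intro N _ _ x hx
    exact Ext.covariant_sequence_exact₃ _ hS x rfl hx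
  · intro N _ _ x hx
    exact Ext.covariant_sequence_exact₁ _ hS x hx rfl
  · intro N _ _ x
    change (x.comp hS.extClass rfl).comp (Ext.mk₀ (ModuleCat.ofHom f)) (add_zero (i + 1)) = 0
    rw [Ext.comp_assoc_of_third_deg_zero]
    have := hS.extClass_comp
    rw [show hS.extClass.comp (Ext.mk₀ (ModuleCat.ofHom f)) (add_zero 1) = 0 from this]
    simp

lemma extPull_exact (y : ExtM S M' N i) (hy : extPull f y = 0) :
    ∃ x : ExtM S M'' N i, extPull g x = y :=
  Ext.contravariant_sequence_exact₂ (shortExact_of_exact hf hfg hg) _ y hy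

lemma extPull_surjective [Subsingleton (ExtM S M'' N (i + 1))] :
    Function.Surjective (extPull f : ExtM S M' N i → ExtM S M N i) := fun x =>
  Ext.contravariant_sequence_exact₁ (shortExact_of_exact hf hfg hg) _ x (add_comm 1 i)
    (Subsingleton.elim (α := ExtM S M'' N (i + 1)) _ _)

lemma extPull_injective_succ [Subsingleton (ExtM S M N i)] :
    Function.Injective (extPull g : ExtM S M'' N (i + 1) → ExtM S M' N (i + 1)) := by
  rw [injective_iff_map_eq_zero]
  intro x hx
  obtain ⟨y, rfl⟩ := Ext.contravariant_sequence_exact₃ (shortExact_of_exact hf hfg hg) _ x hx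
    (add_comm 1 i)
  rw [Subsingleton.elim (α := ExtM S M N i) y 0, Ext.comp_zero]

omit hf hfg in
lemma extPull_injective_zero :
    Function.Injective (extPull g : ExtM S M'' N 0 → ExtM S M' N 0) := by
  have : Epi (ModuleCat.ofHom g) := (ModuleCat.epi_iff_surjective _).2 hg
  exact Ext.precomp_mk₀_injective_of_epi (ModuleCat.of S N) (ModuleCat.ofHom g)

omit hfg hg in
lemma extPush_injective_zero :
    Function.Injective (extPush f : ExtM S N M 0 → ExtM S N M' 0) := by
  have : Mono (ModuleCat.ofHom f) := (ModuleCat.mono_iff_injective _).2 hf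
  exact Ext.postcomp_mk₀_injective_of_mono (ModuleCat.of S N) (ModuleCat.ofHom f)

end

lemma extPull_bijective_of_equiv (e : N ≃ₗ[S] N') :
    Function.Bijective (extPull e.toLinearMap : ExtM S N' M i → ExtM S N M i) := by
  refine Function.bijective_iff_has_inverse.2 ⟨extPull e.symm.toLinearMap, fun x => ?_, fun x => ?_⟩
  · rw [extPull_extPull]; simp
  · rw [extPull_extPull]; simp

lemma extPush_sum {ι : Type*} (s : Finset ι) (f : ι → (M →ₗ[S] M')) (x : ExtM S N M i) :
    extPush (∑ k ∈ s, f k) x = ∑ k ∈ s, extPush (f k) x := by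
  classical
  induction s using Finset.induction_on with
  | empty => simp
  | insert a s ha ih => rw [Finset.sum_insert ha, extPush_add, ih, Finset.sum_insert ha]

/-- The components of a class in `Ext(N, S ^ r)`. -/
def extComp {r : ℕ} (x : ExtM S N (Fin r → S) i) (k : Fin r) : ExtM S N S i :=
  extPush (LinearMap.proj k) x

/-- The class with given components. -/
def extOfComp {r : ℕ} (e : Fin r → ExtM S N S i) : ExtM S N (Fin r → S) i :=
  ∑ k, extPush (LinearMap.single S (fun _ => S) k) (e k)

lemma extComp_extOfComp {r : ℕ} (e : Fin r → ExtM S N S i) : extComp (extOfComp e) = e := by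
  ext1 k
  simp only [extComp, extOfComp, map_sum, extPush_extPush]
  rw [Finset.sum_eq_single k]
  · rw [LinearMap.proj_comp_single_same, extPush_id]
  · intro l _ hl
    rw [LinearMap.proj_comp_single_ne _ _ _ _ hl.symm, extPush_zero]
  · simp

lemma extOfComp_extComp {r : ℕ} (x : ExtM S N (Fin r → S) i) : extOfComp (extComp x) = x := by
  simp only [extComp, extOfComp, extPush_extPush]
  rw [← extPush_sum]
  have : (∑ k : Fin r, LinearMap.single S (fun _ => S) k ∘ₗ LinearMap.proj k) =
      (LinearMap.id : (Fin r → S) →ₗ[S] (Fin r → S)) := by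
    refine LinearMap.ext fun a => funext fun b => ?_
    simp [LinearMap.sum_apply, Pi.single_apply]
  exact (congrArg (fun f => extPush f x) this).trans (extPush_id x)

lemma extComp_injective {r : ℕ} {x y : ExtM S N (Fin r → S) i} (h : extComp x = extComp y) :
    x = y := by
  rw [← extOfComp_extComp x, h, extOfComp_extComp]

lemma extComp_push {r s : ℕ} (A : Matrix (Fin r) (Fin s) S) (x : ExtM S N (Fin s → S) i)
    (k : Fin r) : extComp (extPush A.mulVecLin x) k = ∑ l, A k l • extComp x l := by
  simp only [extComp, extPush_extPush]
  simp only [← extPush_smul]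
  rw [← extPush_sum]
  have : (LinearMap.proj k ∘ₗ A.mulVecLin : (Fin s → S) →ₗ[S] S) =
      ∑ l, A k l • (LinearMap.proj l : (Fin s → S) →ₗ[S] S) := by
    refine LinearMap.ext fun a => ?_
    simp [LinearMap.sum_apply, Matrix.mulVec, dotProduct]
  exact congrArg (fun f => extPush f x) this

lemma extComp_pull {r : ℕ} (f : N' →ₗ[S] N) (x : ExtM S N (Fin r → S) i) (k : Fin r) :
    extComp (extPull f x) k = extPull f (extComp x k) :=
  (extPull_extPush _ _ _).symm

lemma extComp_smul {r : ℕ} (c : S) (x : ExtM S N (Fin r → S) i) (k : Fin r) :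
    extComp (c • x) k = c • extComp x k := map_smul _ _ _

lemma subsingleton_ext_pi {r : ℕ} [Subsingleton (ExtM S N S i)] :
    Subsingleton (ExtM S N (Fin r → S) i) :=
  ⟨fun _ _ => extComp_injective (Subsingleton.elim _ _)⟩

end ExtModules

section ExtVanishing

open CategoryTheory CategoryTheory.Abelian RingTheory.Sequence
open scoped Pointwise

universe u

variable {S : Type u} [CommRing S]

lemma smul_ext_eq_zero {X M : Type u} [AddCommGroup X] [Module S X] [AddCommGroup M]
    [Module S M] {i : ℕ} {r : S} (h : ∀ x : X, r • x = 0) (x : ExtM S X M i) : r • x = 0 := by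
  have h0 : r • (LinearMap.id : X →ₗ[S] X) = 0 := LinearMap.ext fun y => by simpa using h y
  rw [← extPull_id x, ← extPull_smul, h0, extPull_zero]

lemma quotSMulTop_exact {M : Type u} [AddCommGroup M] [Module S M] (r : S) :
    Function.Exact (LinearMap.lsmul S M r) (Submodule.mkQ (r • (⊤ : Submodule S M))) := by
  intro y
  rw [Submodule.mkQ_apply, Submodule.Quotient.mk_eq_zero, Submodule.mem_smul_pointwise_iff_exists]
  simp

lemma ext_of_isWeaklyRegular (rs : List S) (X : Type u) [AddCommGroup X] [Module S X]
    (hX : ∀ r ∈ rs, ∀ x : X, r • x = 0) (M : Type u) [AddCommGroup M] [Module S M]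
    (h : IsWeaklyRegular M rs) :
    (∀ i < rs.length, Subsingleton (ExtM S X M i)) ∧
    (∀ f : X →ₗ[S] M ⧸ (Ideal.ofList rs • ⊤ : Submodule S M), f ≠ 0 →
      Nontrivial (ExtM S X M rs.length)) := by
  induction rs generalizing M with
  | nil =>
    refine ⟨by simp, fun f hf => ?_⟩
    have e : (M ⧸ (Ideal.ofList ([] : List S) • ⊤ : Submodule S M)) ≃ₗ[S] M :=
      Submodule.quotEquivOfEqBot _ (by simp)
    refine ⟨⟨Ext.mk₀ (ModuleCat.ofHom (e.toLinearMap ∘ₗ f)), 0, fun h0 => hf ?_⟩⟩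
    rw [Ext.mk₀_eq_zero_iff] at h0
    ext x
    have := congrArg (fun g => g.hom x) h0
    simpa using this
  | cons r rs ih =>
    rw [isWeaklyRegular_cons_iff] at h
    obtain ⟨ih1, ih2⟩ := ih (fun s hs => hX s (List.mem_cons_of_mem _ hs)) (QuotSMulTop r M) h.2
    have hr := hX r List.mem_cons_self
    have hinj : Function.Injective (LinearMap.lsmul S M r) := h.1
    have hex := quotSMulTop_exact (M := M) r
    have hsurj := Submodule.mkQ_surjective (r • (⊤ : Submodule S M))
    have hz : ∀ (i : ℕ) (x : ExtM S X M i), extPush (LinearMap.lsmul S M r) x = 0 := by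
      intro i x
      have h0 : LinearMap.lsmul S M r = r • (LinearMap.id : M →ₗ[S] M) := by ext; simp
      rw [h0, extPush_smul, extPush_id, smul_ext_eq_zero hr]
    have key : ∀ i < (r :: rs).length, Subsingleton (ExtM S X M i) := by
      intro i hi
      refine ⟨fun x y => ?_⟩
      cases i with
      | zero =>
        apply extPush_injective_zero hinj
        rw [hz, hz]
      | succ i =>
        obtain ⟨δ, -, -, h3, -⟩ := exists_extConnecting hinj hex hsurj i
        obtain ⟨x', rfl⟩ := h3 X x (hz _ x)
        obtain ⟨y', rfl⟩ := h3 X y (hz _ y)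
        have := ih1 i (by simpa using hi)
        exact congrArg (δ X) (Subsingleton.elim (α := ExtM S X (QuotSMulTop r M) i) x' y')
    refine ⟨key, fun f hf => ?_⟩
    let e := Submodule.quotOfListConsSMulTopEquivQuotSMulTopInner M r rs
    have := ih2 (e.toLinearMap ∘ₗ f) (fun h0 => hf (by
      ext x
      have := LinearMap.congr_fun h0 x
      simpa using this))
    obtain ⟨x, hx⟩ := exists_ne (0 : ExtM S X (QuotSMulTop r M) rs.length)
    obtain ⟨δ, -, h2, -, -⟩ := exists_extConnecting hinj hex hsurj rs.length
    refine ⟨⟨δ X x, 0, fun h0 => hx ?_⟩⟩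
    obtain ⟨y, rfl⟩ := h2 X x h0
    have := key rs.length (by simp)
    rw [Subsingleton.elim (α := ExtM S X M rs.length) y 0, map_zero]

variable [IsLocalRing S] [IsNoetherianRing S]

open IsLocalRing

/-- The maximal ideal is generated by a weakly regular sequence of length `d`. -/
def Good (S : Type u) [CommRing S] [IsLocalRing S] (d : ℕ) : Prop :=
  ∃ rs : List S, rs.length = d ∧ IsWeaklyRegular S rs ∧ Ideal.ofList rs = maximalIdeal S

variable {d : ℕ}

omit [IsNoetherianRing S] in
lemma Good.mem_smul {rs : List S} (h : Ideal.ofList rs = maximalIdeal S) {X : Type u}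
    [AddCommGroup X] [Module S X] (hX : ∀ r ∈ maximalIdeal S, ∀ x : X, r • x = 0) :
    ∀ r ∈ rs, ∀ x : X, r • x = 0 := fun r hr =>
  hX r (h ▸ Ideal.subset_span hr)

omit [IsNoetherianRing S] in
lemma smul_residue_eq_zero (r : S) (hr : r ∈ maximalIdeal S) (x : S ⧸ maximalIdeal S) :
    r • x = 0 := by
  obtain ⟨y, rfl⟩ := Ideal.Quotient.mk_surjective x
  rw [← Ideal.Quotient.mk_eq_mk, ← Submodule.Quotient.mk_smul, Submodule.Quotient.mk_eq_zero]
  exact Ideal.mul_mem_right _ _ hr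

omit [IsNoetherianRing S] in
lemma Good.subsingleton_ext_lt (hS : Good S d) {i : ℕ} (hi : i < d) :
    Subsingleton (ExtM S (S ⧸ maximalIdeal S) S i) := by
  obtain ⟨rs, rfl, h1, h2⟩ := hS
  exact (ext_of_isWeaklyRegular rs _ (Good.mem_smul h2 smul_residue_eq_zero) _ h1).1 i hi

lemma Good.subsingleton_ext_gt (hS : Good S d) {i : ℕ} (hi : d < i) (M : Type u)
    [AddCommGroup M] [Module S M] :
    Subsingleton (ExtM S (S ⧸ maximalIdeal S) M i) := by
  obtain ⟨rs, rfl, h1, h2⟩ := hS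
  have h3 := ModuleCat.projectiveDimension_quotient_eq_add_length_of_isWeaklyRegular
    (ModuleCat.of S S) rs h1
    (fun r hr => h2 ▸ Ideal.subset_span hr)
  have h4 : projectiveDimension (ModuleCat.of S (S ⧸ maximalIdeal S)) ≤ rs.length := by
    have e : (S ⧸ (Ideal.ofList rs • ⊤ : Submodule S S)) ≃ₗ[S] (S ⧸ maximalIdeal S) :=
      Submodule.quotEquivOfEq _ _ (by rw [h2]; simp)
    rw [← projectiveDimension_eq_of_iso e.toModuleIso]
    refine h3.le.trans ?_
    have : projectiveDimension (ModuleCat.of S S) ≤ 0 := by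
      have hp : Projective (ModuleCat.of S S) := inferInstance
      exact_mod_cast (projectiveDimension_le_iff _ 0).2
        ((projective_iff_hasProjectiveDimensionLE_zero _).1 hp)
    calc _ ≤ (0 : WithBot ℕ∞) + rs.length := by gcongr
      _ = _ := zero_add _
  have h5 : HasProjectiveDimensionLE (ModuleCat.of S (S ⧸ maximalIdeal S)) rs.length :=
    (projectiveDimension_le_iff _ _).1 h4
  exact h5.subsingleton _ _ _ hi _

omit [IsNoetherianRing S] in
lemma Good.nontrivial_ext (hS : Good S d) :
    Nontrivial (ExtM S (S ⧸ maximalIdeal S) S d) := by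
  obtain ⟨rs, rfl, h1, h2⟩ := hS
  let e : (S ⧸ maximalIdeal S) ≃ₗ[S] (S ⧸ (Ideal.ofList rs • ⊤ : Submodule S S)) :=
    Submodule.quotEquivOfEq _ _ (by rw [h2]; simp)
  refine (ext_of_isWeaklyRegular rs _ (Good.mem_smul h2 smul_residue_eq_zero) _ h1).2
    e.toLinearMap fun h0 => ?_
  have : e 1 = 0 := LinearMap.congr_fun h0 1
  simp at this

/-- The length of a regular sequence with nonzero socle modulo it agrees with the dimension. -/
lemma Good.length_eq (hS : Good S d) (rs : List S) (h : IsWeaklyRegular S rs)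
    (hm : ∀ r ∈ rs, r ∈ maximalIdeal S)
    (y : S) (hy : y ∉ Ideal.ofList rs) (hy' : ∀ r ∈ maximalIdeal S, r * y ∈ Ideal.ofList rs) :
    rs.length = d := by
  have h1 : Nontrivial (ExtM S (S ⧸ maximalIdeal S) S rs.length) := by
    let f : (S ⧸ maximalIdeal S) →ₗ[S] (S ⧸ (Ideal.ofList rs • ⊤ : Submodule S S)) :=
      Submodule.mapQ _ _ (LinearMap.lsmul S S y) (by
        intro r hr
        simpa [mul_comm] using hy' r hr)
    refine (ext_of_isWeaklyRegular rs _ (fun r hr => smul_residue_eq_zero r (hm r hr)) _ h).2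
      f fun h0 => hy ?_
    have : f (Submodule.Quotient.mk 1) = 0 := LinearMap.congr_fun h0 _
    rw [Submodule.mapQ_apply, Submodule.Quotient.mk_eq_zero] at this
    simpa using this
  rcases lt_trichotomy rs.length d with h2 | h2 | h2
  · exact absurd (hS.subsingleton_ext_lt h2) (not_subsingleton_iff_nontrivial.2 h1)
  · exact h2
  · exact absurd (hS.subsingleton_ext_gt h2 S) (not_subsingleton_iff_nontrivial.2 h1)

end ExtVanishing

section Duality

open CategoryTheory CategoryTheory.Abelian RingTheory.Sequence IsLocalRing

variable {S : Type} [CommRing S]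

lemma isFiniteLength_submodule {N : Type} [AddCommGroup N] [Module S N]
    (hN : IsFiniteLength S N) (N' : Submodule S N) : IsFiniteLength S N' := by
  rw [isFiniteLength_iff_isNoetherian_isArtinian] at hN ⊢
  obtain ⟨h1, h2⟩ := hN
  exact ⟨inferInstance, inferInstance⟩

lemma isFiniteLength_quotient {N : Type} [AddCommGroup N] [Module S N]
    (hN : IsFiniteLength S N) (N' : Submodule S N) : IsFiniteLength S (N ⧸ N') := by
  rw [isFiniteLength_iff_isNoetherian_isArtinian] at hN ⊢
  obtain ⟨h1, h2⟩ := hN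
  exact ⟨inferInstance, inferInstance⟩

variable [IsLocalRing S]

/-- Vanishing of `Ext` from the residue field propagates to modules of finite length. -/
lemma subsingleton_ext_of_isFiniteLength {M : Type} [AddCommGroup M] [Module S M] {i : ℕ}
    (h : Subsingleton (ExtM S (S ⧸ maximalIdeal S) M i)) {N : Type} [AddCommGroup N] [Module S N]
    (hN : IsFiniteLength S N) : Subsingleton (ExtM S N M i) := by
  induction hN with
  | @of_subsingleton N _ _ _ =>
    refine ⟨fun x y => ?_⟩
    have h0 : (LinearMap.id : N →ₗ[S] N) = 0 := Subsingleton.elim _ _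
    rw [← extPull_id x, ← extPull_id y, h0, extPull_zero, extPull_zero]
  | @of_simple_quotient N _ _ N' _ _ ih =>
    obtain ⟨I, hI, ⟨e⟩⟩ := isSimpleModule_iff_quot_maximal.1 ‹IsSimpleModule S (N ⧸ N')›
    obtain rfl := eq_maximalIdeal hI
    have h1 : Subsingleton (ExtM S (N ⧸ N') M i) :=
      (extPull_bijective_of_equiv (M := M) (i := i) e).2.subsingleton
    have h2 : ∀ x : ExtM S N M i, x = 0 := fun x => by
      obtain ⟨y, rfl⟩ := extPull_exact N'.injective_subtype (LinearMap.exact_subtype_mkQ N')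
        N'.mkQ_surjective x (Subsingleton.elim (α := ExtM S N' M i) _ _)
      rw [Subsingleton.elim (α := ExtM S (N ⧸ N') M i) y 0, map_zero]
    exact ⟨fun x y => (h2 x).trans (h2 y).symm⟩

lemma isFiniteLength_quotient_pow [IsNoetherianRing S] (t : ℕ) :
    IsFiniteLength S (S ⧸ maximalIdeal S ^ t) := by
  rw [isFiniteLength_iff_isNoetherian_isArtinian]
  refine ⟨inferInstance, ?_⟩
  rcases subsingleton_or_nontrivial (S ⧸ maximalIdeal S ^ t) with h | h
  · infer_instance
  have : IsLocalRing (S ⧸ maximalIdeal S ^ t) :=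
    IsLocalRing.of_surjective' (Ideal.Quotient.mk _) Ideal.Quotient.mk_surjective
  have h1 : IsArtinianRing (S ⧸ maximalIdeal S ^ t) := by
    rw [isArtinianRing_iff_isNilpotent_maximalIdeal]
    refine ⟨t, ?_⟩
    have h2 : maximalIdeal (S ⧸ maximalIdeal S ^ t) =
        (maximalIdeal S).map (Ideal.Quotient.mk (maximalIdeal S ^ t)) :=
      (IsLocalRing.eq_maximalIdeal (Ideal.IsMaximal.map_of_surjective_of_ker_le
        Ideal.Quotient.mk_surjective (by
          rw [Ideal.mk_ker]
          refine IsLocalRing.le_maximalIdeal fun h3 => ?_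
          exact not_subsingleton _ (Ideal.Quotient.subsingleton_iff.2 h3)))).symm
    rw [h2, ← Ideal.map_pow, Ideal.map_quotient_self]
    rfl
  have h2 : IsArtinian (S ⧸ maximalIdeal S ^ t) (S ⧸ maximalIdeal S ^ t) := h1
  exact isArtinian_of_surjective_algebraMap (R := S ⧸ maximalIdeal S ^ t)
    Ideal.Quotient.mk_surjective

variable {d : ℕ}

lemma Good.subsingleton_ext_ne (hS : Good S d) [IsNoetherianRing S] {N : Type} [AddCommGroup N]
    [Module S N] (hN : IsFiniteLength S N) {i : ℕ} (hi : i ≠ d) :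
    Subsingleton (ExtM S N S i) := by
  refine subsingleton_ext_of_isFiniteLength ?_ hN
  rcases lt_or_gt_of_ne hi with h | h
  · exact hS.subsingleton_ext_lt h
  · exact hS.subsingleton_ext_gt h S

lemma Good.extPull_surjective (hS : Good S d) [IsNoetherianRing S] {N N' : Type} [AddCommGroup N]
    [Module S N] [AddCommGroup N'] [Module S N'] (hN : IsFiniteLength S N) (f : N' →ₗ[S] N)
    (hf : Function.Injective f) :
    Function.Surjective (extPull f : ExtM S N S d → ExtM S N' S d) := by
  have : Subsingleton (ExtM S (N ⧸ LinearMap.range f) S (d + 1)) :=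
    hS.subsingleton_ext_ne (isFiniteLength_quotient hN _) (by omega)
  exact Spl.extPull_surjective hf (LinearMap.exact_map_mkQ_range f) (Submodule.mkQ_surjective _)

lemma Good.extPull_injective (hS : Good S d) [IsNoetherianRing S] {N N' : Type} [AddCommGroup N]
    [Module S N] [AddCommGroup N'] [Module S N'] (hN : IsFiniteLength S N) (g : N →ₗ[S] N')
    (hg : Function.Surjective g) :
    Function.Injective (extPull g : ExtM S N' S d → ExtM S N S d) := by
  have hex : Function.Exact (LinearMap.ker g).subtype g := LinearMap.exact_subtype_ker_map g
  cases d with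
  | zero => exact extPull_injective_zero hg
  | succ d =>
    have : Subsingleton (ExtM S (LinearMap.ker g) S d) :=
      hS.subsingleton_ext_ne (isFiniteLength_submodule hN _) (by omega)
    exact extPull_injective_succ (Submodule.injective_subtype _) hex hg

/-- The projection `S ⧸ 𝔪 ^ t' → S ⧸ 𝔪 ^ t`. -/
def quotPow (S : Type) [CommRing S] [IsLocalRing S] {t t' : ℕ} (h : t ≤ t') :
    (S ⧸ maximalIdeal S ^ t') →ₗ[S] (S ⧸ maximalIdeal S ^ t) :=
  Submodule.mapQ _ _ LinearMap.id (Ideal.pow_le_pow_right h)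

lemma quotPow_surjective {t t' : ℕ} (h : t ≤ t') : Function.Surjective (quotPow S h) := by
  intro x
  obtain ⟨y, rfl⟩ := Submodule.Quotient.mk_surjective _ x
  exact ⟨Submodule.Quotient.mk y, rfl⟩

/-- The dual of `S ⧸ 𝔪 ^ t`. -/
abbrev DPow (S : Type) [CommRing S] [IsLocalRing S] (d t : ℕ) : Type :=
  ExtM S (S ⧸ maximalIdeal S ^ t) S d

/-- The transition maps between the duals of the `S ⧸ 𝔪 ^ t`. -/
def dTrans (S : Type) [CommRing S] [IsLocalRing S] (d t t' : ℕ) (h : t ≤ t') :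
    DPow S d t →ₗ[S] DPow S d t' :=
  extPull (quotPow S h)

instance (d : ℕ) : DirectedSystem (DPow S d) (fun t t' h => dTrans S d t t' h) where
  map_self t x := by
    have : quotPow S (le_refl t) = LinearMap.id := by
      refine LinearMap.ext fun y => ?_
      obtain ⟨y, rfl⟩ := Submodule.Quotient.mk_surjective _ y
      rfl
    simp [dTrans, this]
  map_map t t' t'' h h' x := by
    simp only [dTrans, extPull_extPull]
    congr 1
    refine congrArg extPull (LinearMap.ext fun y => ?_)
    obtain ⟨y, rfl⟩ := Submodule.Quotient.mk_surjective _ y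
    rfl

/-- The dualizing module, the direct limit of the duals of the `S ⧸ 𝔪 ^ t`. -/
abbrev EHull (S : Type) [CommRing S] [IsLocalRing S] (d : ℕ) : Type :=
  Module.DirectLimit (DPow S d) (dTrans S d)

/-- The canonical map to the dualizing module. -/
def toE (S : Type) [CommRing S] [IsLocalRing S] (d t : ℕ) : DPow S d t →ₗ[S] EHull S d :=
  Module.DirectLimit.of S ℕ (DPow S d) (dTrans S d) t

lemma toE_trans {t t' : ℕ} (h : t ≤ t') (x : DPow S d t) :
    toE S d t' (dTrans S d t t' h x) = toE S d t x :=
  Module.DirectLimit.of_f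

lemma exists_toE (e : EHull S d) : ∃ t x, toE S d t x = e :=
  Module.DirectLimit.exists_of e

lemma exists_toE_ge (e : EHull S d) (t₀ : ℕ) : ∃ t, t₀ ≤ t ∧ ∃ x, toE S d t x = e := by
  obtain ⟨t, x, rfl⟩ := exists_toE e
  exact ⟨max t₀ t, le_max_left _ _, _, toE_trans (le_max_right t₀ t) x⟩

lemma exists_toE_fin {r : ℕ} (e : Fin r → EHull S d) :
    ∃ t, ∃ x : Fin r → DPow S d t, ∀ k, toE S d t (x k) = e k := by
  choose t x hx using fun k => exists_toE (e k)
  refine ⟨Finset.univ.sup t, fun k => dTrans S d _ _ (Finset.le_sup (Finset.mem_univ k)) (x k),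
    fun k => ?_⟩
  rw [toE_trans, hx]

lemma Good.toE_injective (hS : Good S d) [IsNoetherianRing S] (t : ℕ) :
    Function.Injective (toE S d t) := by
  rw [injective_iff_map_eq_zero]
  intro x hx
  obtain ⟨t', h, h0⟩ := Module.DirectLimit.of.zero_exact hx
  refine hS.extPull_injective (isFiniteLength_quotient_pow t') (quotPow S h)
    (quotPow_surjective h) ?_
  rw [map_zero]
  exact h0

section Theta

variable {N N' : Type} [AddCommGroup N] [Module S N] [AddCommGroup N'] [Module S N'] {t : ℕ}

/-- The map `S ⧸ 𝔪 ^ t → N` attached to an element of a module killed by `𝔪 ^ t`. -/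
def hat (hN : ∀ r ∈ maximalIdeal S ^ t, ∀ x : N, r • x = 0) :
    N →ₗ[S] (S ⧸ maximalIdeal S ^ t) →ₗ[S] N where
  toFun x := Submodule.liftQ _ (LinearMap.toSpanSingleton S N x) (fun r hr => hN r hr x)
  map_add' x y := by
    refine LinearMap.ext fun z => ?_
    obtain ⟨z, rfl⟩ := Submodule.Quotient.mk_surjective _ z
    exact smul_add z x y
  map_smul' c x := by
    refine LinearMap.ext fun z => ?_
    obtain ⟨z, rfl⟩ := Submodule.Quotient.mk_surjective _ z
    exact smul_comm z c x

lemma hat_mk (hN : ∀ r ∈ maximalIdeal S ^ t, ∀ x : N, r • x = 0) (x : N) (s : S) :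
    hat hN x (Submodule.Quotient.mk s) = s • x := rfl

lemma comp_hat (hN : ∀ r ∈ maximalIdeal S ^ t, ∀ x : N, r • x = 0)
    (hN' : ∀ r ∈ maximalIdeal S ^ t, ∀ x : N', r • x = 0) (f : N' →ₗ[S] N) (x : N') :
    f ∘ₗ hat hN' x = hat hN (f x) := by
  refine LinearMap.ext fun z => ?_
  obtain ⟨z, rfl⟩ := Submodule.Quotient.mk_surjective _ z
  exact map_smul f z x

/-- The duality map `Ext^d(N, S) → Hom(N, E)`. -/
def theta (d : ℕ) (hN : ∀ r ∈ maximalIdeal S ^ t, ∀ x : N, r • x = 0) (δ : ExtM S N S d) :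
    N →ₗ[S] EHull S d where
  toFun x := toE S d t (extPull (hat hN x) δ)
  map_add' x y := by rw [map_add, extPull_add, map_add]
  map_smul' c x := by rw [map_smul, extPull_smul, map_smul]; rfl

lemma theta_pull (hN : ∀ r ∈ maximalIdeal S ^ t, ∀ x : N, r • x = 0)
    (hN' : ∀ r ∈ maximalIdeal S ^ t, ∀ x : N', r • x = 0) (f : N' →ₗ[S] N) (δ : ExtM S N S d) :
    theta d hN' (extPull f δ) = theta d hN δ ∘ₗ f := by
  ext x
  simp only [theta, LinearMap.coe_mk, AddHom.coe_mk, LinearMap.comp_apply]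
  rw [extPull_extPull, comp_hat hN]

end Theta

lemma Good.theta_injective (hS : Good S d) [IsNoetherianRing S] {N : Type} [AddCommGroup N]
    [Module S N] (hN : IsFiniteLength S N) {t : ℕ}
    (ht : ∀ r ∈ maximalIdeal S ^ t, ∀ x : N, r • x = 0) (δ : ExtM S N S d)
    (h : theta d ht δ = 0) : δ = 0 := by
  induction hN with
  | @of_subsingleton N _ _ _ =>
    have h0 : (LinearMap.id : N →ₗ[S] N) = 0 := Subsingleton.elim _ _
    rw [← extPull_id δ, h0, extPull_zero]
  | @of_simple_quotient N _ _ N' _ hN' ih =>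
    have ht' : ∀ r ∈ maximalIdeal S ^ t, ∀ x : N', r • x = 0 := fun r hr x =>
      Subtype.ext (ht r hr x)
    have ht'' : ∀ r ∈ maximalIdeal S ^ t, ∀ x : N ⧸ N', r • x = 0 := fun r hr x => by
      obtain ⟨x, rfl⟩ := N'.mkQ_surjective x
      rw [← map_smul, ht r hr, map_zero]
    have h1 : extPull N'.subtype δ = 0 := ih ht' _ (by rw [theta_pull ht, h, LinearMap.zero_comp])
    obtain ⟨δ, rfl⟩ := extPull_exact N'.injective_subtype (LinearMap.exact_subtype_mkQ N')
        N'.mkQ_surjective δ h1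
    rw [theta_pull ht''] at h
    obtain ⟨I, hI, ⟨e⟩⟩ := isSimpleModule_iff_quot_maximal.1 ‹IsSimpleModule S (N ⧸ N')›
    obtain rfl := eq_maximalIdeal hI
    have h2 : theta d ht'' δ (e.symm 1) = 0 := by
      obtain ⟨x, hx⟩ := N'.mkQ_surjective (e.symm 1)
      rw [← hx]
      exact LinearMap.congr_fun h x
    have h3 := hS.toE_injective t (h2.trans (map_zero _).symm)
    have h4 : Function.Surjective (hat ht'' (e.symm 1)) := fun x => by
      obtain ⟨s, hs⟩ := Ideal.Quotient.mk_surjective (e x)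
      refine ⟨Submodule.Quotient.mk s, e.injective ?_⟩
      rw [hat_mk, map_smul, e.apply_symm_apply, ← hs]
      simp [Algebra.smul_def]
    rw [hS.extPull_injective (isFiniteLength_quotient_pow t) _ h4 (h3.trans (map_zero _).symm),
      map_zero]

lemma Good.theta_surjective_residue (hS : Good S d) [IsNoetherianRing S] {t : ℕ}
    (ht : ∀ r ∈ maximalIdeal S ^ t, ∀ x : S ⧸ maximalIdeal S, r • x = 0)
    (φ : (S ⧸ maximalIdeal S) →ₗ[S] EHull S d) : ∃ δ, theta d ht δ = φ := by
  obtain ⟨s, hs, δ, hδ⟩ := exists_toE_ge (φ 1) (t + 1)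
  let g : (S ⧸ maximalIdeal S ^ s) →ₗ[S] (S ⧸ maximalIdeal S) :=
    Submodule.mapQ _ _ LinearMap.id (Ideal.pow_le_self (by omega))
  have hg : Function.Surjective g := by
    intro x
    obtain ⟨y, rfl⟩ := Submodule.Quotient.mk_surjective _ x
    exact ⟨Submodule.Quotient.mk y, rfl⟩
  have hms : ∀ r ∈ maximalIdeal S ^ s, ∀ x : S ⧸ maximalIdeal S ^ s, r • x = 0 := fun r hr x => by
    obtain ⟨y, rfl⟩ := Submodule.Quotient.mk_surjective _ x
    rw [← Submodule.Quotient.mk_smul, Submodule.Quotient.mk_eq_zero]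
    exact Ideal.mul_mem_right _ _ hr
  have hN := isFiniteLength_submodule (isFiniteLength_quotient_pow (S := S) s) (LinearMap.ker g)
  have hk : ∀ r ∈ maximalIdeal S ^ s, ∀ x : LinearMap.ker g, r • x = 0 := fun r hr x =>
    Subtype.ext (hms r hr x)
  have h0 : ∀ r ∈ maximalIdeal S, r • δ = 0 := fun r hr => by
    apply hS.toE_injective s
    rw [map_smul, hδ, ← map_smul, smul_residue_eq_zero r hr, map_zero, map_zero]
  have h1 : extPull (LinearMap.ker g).subtype δ = 0 := by
    refine hS.theta_injective hN hk _ ?_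
    rw [theta_pull hms]
    ext ⟨x, hx⟩
    obtain ⟨r, rfl⟩ := Submodule.Quotient.mk_surjective _ x
    have hr : r ∈ maximalIdeal S := (Submodule.Quotient.mk_eq_zero _).1 hx
    have h2 : hat hms (Submodule.Quotient.mk r) = r • LinearMap.id := by
      refine LinearMap.ext fun z => ?_
      obtain ⟨z, rfl⟩ := Submodule.Quotient.mk_surjective _ z
      rw [hat_mk, LinearMap.smul_apply, LinearMap.id_apply, ← Submodule.Quotient.mk_smul,
        ← Submodule.Quotient.mk_smul, smul_eq_mul, smul_eq_mul, mul_comm]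
    change toE S d s (extPull (hat hms (Submodule.Quotient.mk r)) δ) = 0
    rw [h2, extPull_smul, extPull_id, h0 r hr, map_zero]
  obtain ⟨ε, rfl⟩ := extPull_exact (Submodule.injective_subtype _)
    (LinearMap.exact_subtype_ker_map g) hg δ h1
  refine ⟨ε, ?_⟩
  have h3 : theta d ht ε 1 = φ 1 := by
    rw [← hδ]
    change toE S d t (extPull (hat ht 1) ε) = _
    rw [← toE_trans (show t ≤ s by omega), dTrans, extPull_extPull]
    congr 1
    refine congrArg (fun f => extPull f ε) (LinearMap.ext fun z => ?_)
    obtain ⟨z, rfl⟩ := Submodule.Quotient.mk_surjective _ z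
    change z • (1 : S ⧸ maximalIdeal S) = Ideal.Quotient.mk _ z
    simp [Algebra.smul_def]
  refine LinearMap.ext fun z => ?_
  obtain ⟨z, rfl⟩ := Ideal.Quotient.mk_surjective z
  have h4 : Ideal.Quotient.mk (maximalIdeal S) z = z • (1 : S ⧸ maximalIdeal S) := by
    simp [Algebra.smul_def]
  rw [h4, map_smul, map_smul, h3]

lemma Good.theta_surjective (hS : Good S d) [IsNoetherianRing S] {N : Type} [AddCommGroup N]
    [Module S N] (hN : IsFiniteLength S N) {t : ℕ}
    (ht : ∀ r ∈ maximalIdeal S ^ t, ∀ x : N, r • x = 0) (φ : N →ₗ[S] EHull S d) :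
    ∃ δ, theta d ht δ = φ := by
  induction hN with
  | @of_subsingleton N _ _ _ =>
    exact ⟨0, LinearMap.ext fun x => by rw [Subsingleton.elim x 0, map_zero, map_zero]⟩
  | @of_simple_quotient N _ _ N' _ hN' ih =>
    have ht' : ∀ r ∈ maximalIdeal S ^ t, ∀ x : N', r • x = 0 := fun r hr x =>
      Subtype.ext (ht r hr x)
    have ht'' : ∀ r ∈ maximalIdeal S ^ t, ∀ x : N ⧸ N', r • x = 0 := fun r hr x => by
      obtain ⟨x, rfl⟩ := N'.mkQ_surjective x
      rw [← map_smul, ht r hr, map_zero]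
    obtain ⟨δ', hδ'⟩ := ih ht' (φ ∘ₗ N'.subtype)
    have hNN : IsFiniteLength S N := .of_simple_quotient hN'
    obtain ⟨δ, rfl⟩ := hS.extPull_surjective hNN N'.subtype N'.injective_subtype δ'
    rw [theta_pull ht] at hδ'
    have h1 : N' ≤ LinearMap.ker (φ - theta d ht δ) := fun x hx => by
      have := LinearMap.congr_fun hδ' ⟨x, hx⟩
      rw [LinearMap.mem_ker, LinearMap.sub_apply, sub_eq_zero]
      exact this.symm
    obtain ⟨I, hI, ⟨e⟩⟩ := isSimpleModule_iff_quot_maximal.1 ‹IsSimpleModule S (N ⧸ N')›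
    obtain rfl := eq_maximalIdeal hI
    have hte : ∀ r ∈ maximalIdeal S ^ t, ∀ x : S ⧸ maximalIdeal S, r • x = 0 := fun r hr x => by
      rw [← e.apply_symm_apply x, ← map_smul, ht'' r hr, map_zero]
    obtain ⟨ε, hε⟩ := hS.theta_surjective_residue hte
      ((N'.liftQ (φ - theta d ht δ) h1) ∘ₗ e.symm.toLinearMap)
    refine ⟨δ + extPull (e.toLinearMap ∘ₗ N'.mkQ) ε, ?_⟩
    have h2 : theta d ht (δ + extPull (e.toLinearMap ∘ₗ N'.mkQ) ε) =
        theta d ht δ + theta d ht (extPull (e.toLinearMap ∘ₗ N'.mkQ) ε) := by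
      ext x
      simp [theta]
    rw [h2, theta_pull hte, hε]
    ext x
    simp

/-- The dualizing module is injective. -/
lemma Good.injective_E (hS : Good S d) [IsNoetherianRing S] : Module.Baer S (EHull S d) := by
  intro I φ
  obtain ⟨r, a, ha⟩ := Submodule.fg_iff_exists_fin_generating_family.1
    (IsNoetherian.noetherian (I : Submodule S S))
  have haI : ∀ j, a j ∈ I := fun j => ha ▸ Submodule.subset_span ⟨j, rfl⟩
  obtain ⟨t, x, hx⟩ := exists_toE_fin fun j => φ ⟨a j, haI j⟩
  have hkill : ∀ r ∈ maximalIdeal S ^ t, ∀ z : I, r • φ z = 0 := by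
    intro r hr z
    have h1 : Submodule.span S (Set.range a) ≤ (LinearMap.ker (r • φ)).map I.subtype := by
      rw [Submodule.span_le]
      rintro _ ⟨j, rfl⟩
      refine ⟨⟨a j, haI j⟩, ?_, rfl⟩
      change r • φ ⟨a j, haI j⟩ = 0
      rw [← hx j, ← map_smul, smul_ext_eq_zero, map_zero]
      intro y
      obtain ⟨y, rfl⟩ := Submodule.Quotient.mk_surjective _ y
      rw [← Submodule.Quotient.mk_smul, Submodule.Quotient.mk_eq_zero]
      exact Ideal.mul_mem_right _ _ hr
    rw [ha] at h1
    obtain ⟨w, hw, hwz⟩ := h1 z.2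
    obtain rfl : w = z := Subtype.ext hwz
    exact hw
  obtain ⟨k, hk⟩ := Ideal.exists_pow_inf_eq_pow_smul (M := S) (maximalIdeal S) I
  have hle : ∀ z : I, (z : S) ∈ maximalIdeal S ^ (t + k) → φ z = 0 := by
    intro z hz
    have h1 : maximalIdeal S ^ t • (maximalIdeal S ^ k • (⊤ : Submodule S S) ⊓ I) ≤
        (LinearMap.ker φ).map I.subtype := by
      rw [Submodule.smul_le]
      intro r hr y hy
      refine ⟨r • ⟨y, hy.2⟩, ?_, rfl⟩
      change φ _ = 0
      rw [map_smul, hkill r hr]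
    have h2 := hk (t + k) (by omega)
    rw [Nat.add_sub_cancel] at h2
    rw [← h2] at h1
    obtain ⟨w, hw, hwz⟩ := h1 ⟨by simpa using hz, z.2⟩
    obtain rfl : w = z := Subtype.ext hwz
    exact hw
  have hms : ∀ r ∈ maximalIdeal S ^ (t + k), ∀ x : S ⧸ maximalIdeal S ^ (t + k), r • x = 0 :=
    fun r hr x => by
      obtain ⟨y, rfl⟩ := Submodule.Quotient.mk_surjective _ x
      rw [← Submodule.Quotient.mk_smul, Submodule.Quotient.mk_eq_zero]
      exact Ideal.mul_mem_right _ _ hr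
  let g : I →ₗ[S] (S ⧸ maximalIdeal S ^ (t + k)) :=
    (Submodule.mkQ (maximalIdeal S ^ (t + k))) ∘ₗ I.subtype
  have hg : LinearMap.ker g ≤ LinearMap.ker φ := fun z hz =>
    hle z ((Submodule.Quotient.mk_eq_zero _).1 hz)
  have hFL := isFiniteLength_quotient_pow (S := S) (t + k)
  let N := LinearMap.range g
  have hN : ∀ r ∈ maximalIdeal S ^ (t + k), ∀ x : N, r • x = 0 := fun r hr x =>
    Subtype.ext (hms r hr x)
  let ψ : N →ₗ[S] EHull S d :=
    ((LinearMap.ker g).liftQ φ hg) ∘ₗ g.quotKerEquivRange.symm.toLinearMap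
  have hψ : ∀ z : I, ψ (g.rangeRestrict z) = φ z := fun z => by
    have : g.rangeRestrict z = g.quotKerEquivRange (Submodule.Quotient.mk z) := rfl
    simp only [ψ, LinearMap.comp_apply, this, LinearEquiv.coe_coe, LinearEquiv.symm_apply_apply]
    rfl
  obtain ⟨δ', hδ'⟩ := hS.theta_surjective (isFiniteLength_submodule hFL N) hN ψ
  obtain ⟨δ, rfl⟩ := hS.extPull_surjective hFL N.subtype N.injective_subtype δ'
  rw [theta_pull hms] at hδ'
  refine ⟨theta d hms δ ∘ₗ Submodule.mkQ _, fun z hz => ?_⟩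
  rw [← hψ ⟨z, hz⟩, ← hδ']
  rfl

/-- The dualizing module is a cogenerator. -/
lemma Good.exists_ne_zero (hS : Good S d) [IsNoetherianRing S] {M : Type} [AddCommGroup M]
    [Module S M] (x : M) (hx : x ≠ 0) : ∃ φ : M →ₗ[S] EHull S d, φ x ≠ 0 := by
  have : Nontrivial (ExtM S (S ⧸ maximalIdeal S) S d) := hS.nontrivial_ext
  obtain ⟨δ, hδ⟩ := exists_ne (0 : ExtM S (S ⧸ maximalIdeal S) S d)
  have ht : ∀ r ∈ maximalIdeal S ^ 1, ∀ x : S ⧸ maximalIdeal S, r • x = 0 := fun r hr =>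
    smul_residue_eq_zero r (by simpa using hr)
  have hFL : IsFiniteLength S (S ⧸ maximalIdeal S) := by
    have := isFiniteLength_quotient_pow (S := S) 1
    rwa [pow_one] at this
  have h0 : theta d ht δ 1 ≠ 0 := fun h => hδ (hS.theta_injective hFL ht δ (by
    refine LinearMap.ext fun z => ?_
    obtain ⟨z, rfl⟩ := Ideal.Quotient.mk_surjective z
    have h4 : Ideal.Quotient.mk (maximalIdeal S) z = z • (1 : S ⧸ maximalIdeal S) := by
      simp [Algebra.smul_def]
    rw [h4, map_smul, h, smul_zero, LinearMap.zero_apply]))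
  let J := LinearMap.ker (LinearMap.toSpanSingleton S M x)
  have hJ : J ≤ maximalIdeal S := by
    refine IsLocalRing.le_maximalIdeal fun h => hx ?_
    have : (1 : S) ∈ J := h ▸ Submodule.mem_top
    simpa [J] using this
  let e := (LinearMap.toSpanSingleton S M x).quotKerEquivRange
  let φ : LinearMap.range (LinearMap.toSpanSingleton S M x) →ₗ[S] EHull S d :=
    (theta d ht δ ∘ₗ Submodule.mapQ J (maximalIdeal S) LinearMap.id hJ) ∘ₗ e.symm.toLinearMap
  obtain ⟨ψ, hψ⟩ := hS.injective_E.injective.out _ (Submodule.injective_subtype _) φ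
  refine ⟨ψ, ?_⟩
  have h1 : x = Submodule.subtype _ (e (Submodule.Quotient.mk 1)) := by
    exact (one_smul S x).symm
  rw [h1, hψ]
  simpa [φ] using h0

end Duality

section MatrixDuality

open CategoryTheory CategoryTheory.Abelian RingTheory.Sequence IsLocalRing

variable {S : Type} [CommRing S]

/-- `c` maps the kernel of `A₁` into the image of `A₂`, for the matrices acting on powers
of the module `E`. -/
def ModKills (E : Type) [AddCommGroup E] [Module S E] {p r q : ℕ}
    (A₁ : Matrix (Fin p) (Fin r) S) (A₂ : Matrix (Fin r) (Fin q) S) (c : S) : Prop :=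
  ∀ e : Fin r → E, (∀ k, ∑ l, A₁ k l • e l = 0) → ∃ f : Fin q → E, ∀ k, c • e k = ∑ l, A₂ k l • f l

/-- `c` maps the kernel of the transpose of `A₂` into the image of the transpose of `A₁`. -/
def DualKills {p r q : ℕ} (A₁ : Matrix (Fin p) (Fin r) S) (A₂ : Matrix (Fin r) (Fin q) S)
    (c : S) : Prop :=
  ∀ y : Fin r → S, A₂.transpose.mulVec y = 0 → ∃ z, c • y = A₁.transpose.mulVec z

lemma modKills_iff_dualKills {E : Type} [AddCommGroup E] [Module S E] (hE : Module.Injective S E)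
    (hE' : ∀ (M : Type) [AddCommGroup M] [Module S M] (x : M), x ≠ 0 →
      ∃ φ : M →ₗ[S] E, φ x ≠ 0) {p r q : ℕ}
    (A₁ : Matrix (Fin p) (Fin r) S) (A₂ : Matrix (Fin r) (Fin q) S) (c : S) :
    ModKills E A₁ A₂ c ↔ DualKills A₁ A₂ c := by
  have hsum : ∀ {u v : ℕ} (B : Matrix (Fin u) (Fin v) S) (φ : (Fin v → S) →ₗ[S] E)
      (z : Fin u → S), φ (B.transpose.mulVec z) =
        ∑ k, z k • ∑ l, B k l • φ (Pi.single l 1) := by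
    intro u v B φ z
    conv_lhs => rw [← LinearMap.sum_single_apply _ (B.transpose.mulVec z)]
    have h1 : ∀ l, φ (Pi.single l (B.transpose.mulVec z l)) =
        ∑ k, z k • B k l • φ (Pi.single l 1) := by
      intro l
      have h0 : ∀ x : S, (Pi.single l x : Fin v → S) = x • Pi.single l 1 := fun x => by
        ext j; simp [Pi.single_apply]
      rw [h0, map_smul]
      simp only [Matrix.mulVec, dotProduct, Matrix.transpose_apply, Finset.sum_smul, mul_smul]
      exact Finset.sum_congr rfl fun k _ => smul_comm _ _ _
    rw [map_sum, Finset.sum_congr rfl fun l _ => h1 l, Finset.sum_comm]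
    simp only [Finset.smul_sum]
  constructor
  · intro H y hy
    by_contra hc
    have hx : Submodule.mkQ (LinearMap.range A₁.transpose.mulVecLin) (c • y) ≠ 0 := by
      intro h
      obtain ⟨z, hz⟩ := (Submodule.Quotient.mk_eq_zero _).1 h
      exact hc ⟨z, hz.symm⟩
    obtain ⟨φ, hφ⟩ := hE' _ _ hx
    let ψ : (Fin r → S) →ₗ[S] E := φ ∘ₗ Submodule.mkQ _
    obtain ⟨f, hf⟩ := H (fun l => ψ (Pi.single l 1)) (fun k => by
      have := hsum A₁ ψ (Pi.single k 1)
      rw [Finset.sum_eq_single k (fun l _ hl => by simp [Pi.single_eq_of_ne hl]) (by simp),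
        Pi.single_eq_same, one_smul] at this
      rw [← this]
      have h0 : Submodule.mkQ (LinearMap.range A₁.transpose.mulVecLin)
          (A₁.transpose.mulVec (Pi.single k 1)) = 0 :=
        (Submodule.Quotient.mk_eq_zero _).2 ⟨_, rfl⟩
      simp only [ψ, LinearMap.comp_apply, h0, map_zero])
    refine hφ ?_
    change ψ (c • y) = 0
    have h1 := hsum (1 : Matrix (Fin r) (Fin r) S) ψ y
    rw [Matrix.transpose_one, Matrix.one_mulVec] at h1
    rw [map_smul, h1]
    have h2 : ∀ k, ∑ l, (1 : Matrix (Fin r) (Fin r) S) k l • ψ (Pi.single l 1) =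
        ψ (Pi.single k 1) := fun k => by
      rw [Finset.sum_eq_single k (fun l _ hl => by simp [Matrix.one_apply_ne hl.symm]) (by simp)]
      simp
    let F : (Fin q → S) →ₗ[S] E := Fintype.linearCombination S f
    have hF : ∀ l, F (Pi.single l 1) = f l := fun l => by
      simp [F, Fintype.linearCombination_apply_single]
    have h3 := hsum A₂ F y
    rw [hy, map_zero] at h3
    rw [h3, Finset.smul_sum]
    refine Finset.sum_congr rfl fun k _ => ?_
    rw [h2, smul_comm, hf k]
    simp only [hF]
  · intro H e he
    let φ : (Fin r → S) →ₗ[S] E := Fintype.linearCombination S e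
    have hφ : ∀ l, φ (Pi.single l 1) = e l := fun l => by
      simp [φ, Fintype.linearCombination_apply_single]
    have hker : LinearMap.ker A₂.transpose.mulVecLin ≤ LinearMap.ker (c • φ) := by
      intro y hy
      obtain ⟨z, hz⟩ := H y hy
      rw [LinearMap.mem_ker, LinearMap.smul_apply, ← map_smul, hz, hsum]
      simp only [hφ, he, smul_zero, Finset.sum_const_zero]
    let ψ : LinearMap.range A₂.transpose.mulVecLin →ₗ[S] E :=
      (LinearMap.ker A₂.transpose.mulVecLin).liftQ (c • φ) hker ∘ₗ
        A₂.transpose.mulVecLin.quotKerEquivRange.symm.toLinearMap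
    obtain ⟨F, hF⟩ := hE.out _ (Submodule.injective_subtype _) ψ
    refine ⟨fun l => F (Pi.single l 1), fun k => ?_⟩
    have h1 := hsum A₂ F (Pi.single k 1)
    rw [Finset.sum_eq_single k (fun l _ hl => by simp [Pi.single_eq_of_ne hl]) (by simp),
        Pi.single_eq_same, one_smul] at h1
    rw [← h1, ← hφ k]
    have h2 := hF (A₂.transpose.mulVecLin.quotKerEquivRange
      (Submodule.Quotient.mk (Pi.single k 1)))
    simp only [ψ, LinearMap.comp_apply, LinearEquiv.coe_coe, LinearEquiv.symm_apply_apply] at h2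
    exact h2.symm

variable [IsLocalRing S] [IsNoetherianRing S] {d : ℕ}

/-- `c` annihilates the `i`-th local cohomology, in terms of `Ext` groups. -/
def Kills (c : S) (i : ℕ) (M : Type) [AddCommGroup M] [Module S M] : Prop :=
  ∀ (t : ℕ) (x : ExtM S (S ⧸ maximalIdeal S ^ t) M i), ∃ (t' : ℕ) (h : t ≤ t'),
    c • extPull (quotPow S h) x = 0

lemma Good.kills_of_gt (hS : Good S d) {i : ℕ} (hi : d < i) (c : S) (M : Type) [AddCommGroup M]
    [Module S M] : Kills c i M := fun t x => by
  have := subsingleton_ext_of_isFiniteLength (hS.subsingleton_ext_gt hi M)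
    (isFiniteLength_quotient_pow t)
  exact ⟨t, le_rfl, Subsingleton.elim (α := ExtM S (S ⧸ maximalIdeal S ^ t) M i) _ _⟩

lemma Good.extPush_surjective (hS : Good S d) {N : Type} [AddCommGroup N] [Module S N]
    (hN : IsFiniteLength S N) {M M' : Type} [AddCommGroup M] [Module S M] [AddCommGroup M']
    [Module S M'] (g : M →ₗ[S] M') (hg : Function.Surjective g) :
    Function.Surjective (extPush g : ExtM S N M d → ExtM S N M' d) := by
  intro x
  obtain ⟨δ, -, h2, -, -⟩ := exists_extConnecting (Submodule.injective_subtype _)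
    (LinearMap.exact_subtype_ker_map g) hg d
  have := subsingleton_ext_of_isFiniteLength
    (hS.subsingleton_ext_gt (Nat.lt_succ_self d) (LinearMap.ker g)) hN
  exact h2 N x (Subsingleton.elim (α := ExtM S N (LinearMap.ker g) (d + 1)) _ _)

omit [IsLocalRing S] [IsNoetherianRing S] in
lemma extPush_mkQ_mulVec {N : Type} [AddCommGroup N] [Module S N] {r s : ℕ}
    (A : Matrix (Fin r) (Fin s) S) {i : ℕ} (z : ExtM S N (Fin s → S) i) :
    extPush (LinearMap.range A.mulVecLin).mkQ (extPush A.mulVecLin z) = 0 := by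
  rw [extPush_extPush]
  have : (LinearMap.range A.mulVecLin).mkQ ∘ₗ A.mulVecLin = 0 := by
    refine LinearMap.ext fun x => ?_
    exact (Submodule.Quotient.mk_eq_zero _).2 ⟨x, rfl⟩
  rw [this, extPush_zero]

lemma Good.extPush_mkQ_eq_zero (hS : Good S d) {N : Type} [AddCommGroup N] [Module S N]
    (hN : IsFiniteLength S N) {r s : ℕ} (A : Matrix (Fin r) (Fin s) S)
    (y : ExtM S N (Fin r → S) d) (hy : extPush (LinearMap.range A.mulVecLin).mkQ y = 0) :
    ∃ z : ExtM S N (Fin s → S) d, y = extPush A.mulVecLin z := by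
  obtain ⟨k, rfl⟩ := extPush_exact (Submodule.injective_subtype _)
    (LinearMap.exact_subtype_mkQ _) (Submodule.mkQ_surjective _) y hy
  obtain ⟨z, rfl⟩ := hS.extPush_surjective hN A.mulVecLin.rangeRestrict
    A.mulVecLin.surjective_rangeRestrict k
  exact ⟨z, by rw [extPush_extPush]; rfl⟩

lemma Good.modKills_iff (hS : Good S d) {p r q : ℕ}
    (A₁ : Matrix (Fin p) (Fin r) S) (A₂ : Matrix (Fin r) (Fin q) S) (c : S) :
    ModKills (EHull S d) A₁ A₂ c ↔
      ∀ (t : ℕ) (X : ExtM S (S ⧸ maximalIdeal S ^ t) (Fin r → S) d),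
        extPush A₁.mulVecLin X = 0 → ∃ (t' : ℕ) (h : t ≤ t'),
        c • extPull (quotPow S h) (extPush (LinearMap.range A₂.mulVecLin).mkQ X) = 0 := by
  constructor
  · intro H t X hX
    obtain ⟨f, hf⟩ := H (fun l => toE S d t (extComp X l)) (fun k => by
      simp only [← map_smul, ← map_sum]
      rw [← extComp_push, hX]
      simp only [extComp, map_zero])
    obtain ⟨t₁, z, hz⟩ := exists_toE_fin f
    refine ⟨max t t₁, le_max_left _ _, ?_⟩
    have h1 : c • extPull (quotPow S (le_max_left t t₁)) X = extPush A₂.mulVecLin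
        (extOfComp fun l => dTrans S d t₁ (max t t₁) (le_max_right _ _) (z l)) := by
      refine extComp_injective (funext fun k => hS.toE_injective _ ?_)
      rw [extComp_push, extComp_extOfComp, map_sum]
      simp only [map_smul, toE_trans, hz]
      rw [← hf, extComp_smul, map_smul, extComp_pull]
      congr 1
      exact toE_trans _ _
    rw [extPull_extPush, ← map_smul, h1, extPush_mkQ_mulVec]
  · intro H e he
    obtain ⟨t, x, hx⟩ := exists_toE_fin e
    obtain ⟨t', h, h0⟩ := H t (extOfComp x) (by
      refine extComp_injective (funext fun k => hS.toE_injective _ ?_)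
      rw [extComp_push, extComp_extOfComp, map_sum]
      simp only [map_smul, hx, he]
      simp only [extComp, map_zero])
    rw [extPull_extPush, ← map_smul] at h0
    obtain ⟨z, hz⟩ := hS.extPush_mkQ_eq_zero (isFiniteLength_quotient_pow t') A₂ _ h0
    refine ⟨fun l => toE S d t' (extComp z l), fun k => ?_⟩
    simp only [← map_smul, ← map_sum]
    rw [← extComp_push, ← hz, extComp_smul, map_smul, extComp_pull, extComp_extOfComp, ← hx k]
    congr 1
    exact (toE_trans h _).symm

lemma Good.kills_top_iff (hS : Good S d) {r q : ℕ} (A : Matrix (Fin r) (Fin q) S) (c : S) :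
    Kills c d (MatCoker A) ↔ DualKills (0 : Matrix (Fin 0) (Fin r) S) A c := by
  rw [← modKills_iff_dualKills hS.injective_E.injective fun _ _ _ x hx => hS.exists_ne_zero x hx,
    hS.modKills_iff]
  constructor
  · intro H t X _
    exact H t _
  · intro H t x
    obtain ⟨X, rfl⟩ := hS.extPush_surjective (isFiniteLength_quotient_pow t)
      (LinearMap.range A.mulVecLin).mkQ (Submodule.mkQ_surjective _) x
    exact H t X (extComp_injective (funext fun k => k.elim0))

section Syzygy

variable {p r q : ℕ} {A₁ : Matrix (Fin p) (Fin r) S} {A₂ : Matrix (Fin r) (Fin q) S}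

/-- The inclusion of the first syzygy module of the cokernel of `A₁`. -/
def syzMap (h : LinearMap.ker A₁.mulVecLin = LinearMap.range A₂.mulVecLin) :
    MatCoker A₂ →ₗ[S] (Fin p → S) :=
  Submodule.liftQ _ A₁.mulVecLin h.ge

omit [IsLocalRing S] [IsNoetherianRing S] in
lemma syzMap_injective (h : LinearMap.ker A₁.mulVecLin = LinearMap.range A₂.mulVecLin) :
    Function.Injective (syzMap h) := by
  rw [← LinearMap.ker_eq_bot]
  exact Submodule.ker_liftQ_eq_bot _ _ _ h.le

omit [IsLocalRing S] [IsNoetherianRing S] in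
lemma syzMap_exact (h : LinearMap.ker A₁.mulVecLin = LinearMap.range A₂.mulVecLin) :
    Function.Exact (syzMap h) (LinearMap.range A₁.mulVecLin).mkQ := by
  rw [LinearMap.exact_iff, Submodule.ker_mkQ]
  exact (Submodule.range_liftQ _ _ _).symm

lemma Good.kills_succ_iff (hS : Good S d)
    (h : LinearMap.ker A₁.mulVecLin = LinearMap.range A₂.mulVecLin) {i : ℕ} (hi : i + 1 < d)
    (c : S) : Kills c i (MatCoker A₁) ↔ Kills c (i + 1) (MatCoker A₂) := by
  obtain ⟨δ, h1, h2, h3, h4⟩ := exists_extConnecting (syzMap_injective h) (syzMap_exact h)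
    (Submodule.mkQ_surjective _) i
  have hsub : ∀ t, ∀ j < d, Subsingleton (ExtM S (S ⧸ maximalIdeal S ^ t) (Fin p → S) j) :=
    fun t j hj => by
      have := hS.subsingleton_ext_ne (isFiniteLength_quotient_pow t) (show j ≠ d by omega)
      exact subsingleton_ext_pi
  constructor
  · intro H t x
    obtain ⟨y, rfl⟩ := h3 _ x (by
      have := hsub t (i + 1) hi
      exact Subsingleton.elim
        (α := ExtM S (S ⧸ maximalIdeal S ^ t) (Fin p → S) (i + 1)) _ _)
    obtain ⟨t', ht, h0⟩ := H t y
    exact ⟨t', ht, by rw [h1, ← map_smul, h0, map_zero]⟩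
  · intro H t x
    obtain ⟨t', ht, h0⟩ := H t (δ _ x)
    refine ⟨t', ht, ?_⟩
    rw [h1, ← map_smul] at h0
    obtain ⟨y, hy⟩ := h2 _ _ h0
    have := hsub t' i (by omega)
    rw [← hy, Subsingleton.elim (α := ExtM S (S ⧸ maximalIdeal S ^ t') (Fin p → S) i) y 0, map_zero]

lemma Good.kills_pred_iff (hS : Good S (d + 1))
    (h : LinearMap.ker A₁.mulVecLin = LinearMap.range A₂.mulVecLin) (c : S) :
    Kills c d (MatCoker A₁) ↔ DualKills A₁ A₂ c := by
  rw [← modKills_iff_dualKills hS.injective_E.injective fun _ _ _ x hx => hS.exists_ne_zero x hx,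
    hS.modKills_iff]
  obtain ⟨δ, h1, h2, h3, h4⟩ := exists_extConnecting (syzMap_injective h) (syzMap_exact h)
    (Submodule.mkQ_surjective _) d
  have hcomp : ∀ t (X : ExtM S (S ⧸ maximalIdeal S ^ t) (Fin r → S) (d + 1)),
      extPush (syzMap h) (extPush (LinearMap.range A₂.mulVecLin).mkQ X) =
        extPush A₁.mulVecLin X := fun t X => by
    rw [extPush_extPush]
    rfl
  constructor
  · intro H t X hX
    obtain ⟨w, hw⟩ := h3 _ _ ((hcomp t X).trans hX)
    obtain ⟨t', ht, h0⟩ := H t w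
    exact ⟨t', ht, by rw [← hw, h1, ← map_smul, h0, map_zero]⟩
  · intro H t w
    obtain ⟨X, hX⟩ := hS.extPush_surjective (isFiniteLength_quotient_pow t)
      (LinearMap.range A₂.mulVecLin).mkQ (Submodule.mkQ_surjective _) (δ _ w)
    obtain ⟨t', ht, h0⟩ := H t X (by rw [← hcomp, hX, h4])
    refine ⟨t', ht, ?_⟩
    rw [hX, h1, ← map_smul] at h0
    obtain ⟨y, hy⟩ := h2 _ _ h0
    have := hS.subsingleton_ext_ne (isFiniteLength_quotient_pow t') (show d ≠ d + 1 by omega)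
    have : Subsingleton (ExtM S (S ⧸ maximalIdeal S ^ t') (Fin p → S) d) := subsingleton_ext_pi
    rw [← hy, Subsingleton.elim (α := ExtM S (S ⧸ maximalIdeal S ^ t') (Fin p → S) d) y 0, map_zero]

end Syzygy

end MatrixDuality

section PolynomialLocalizations

open IsLocalRing RingTheory.Sequence Ideal

lemma IsWeaklyRegular.map_ringEquiv {S T : Type} [CommRing S] [CommRing T] (e : S ≃+* T)
    {rs : List S} (h : IsWeaklyRegular S rs) : IsWeaklyRegular T (rs.map e) := by
  let : Algebra S T := (e : S →+* T).toAlgebra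
  have : Module.Flat S T := Module.Flat.of_linearEquiv
    ({ e with map_smul' := fun a x => map_mul e a x } : S ≃ₗ[S] T).symm
  exact h.of_flat

lemma Good.of_ringEquiv {S T : Type} [CommRing S] [CommRing T] [IsLocalRing S] [IsLocalRing T]
    {d : ℕ} (h : Good S d) (e : S ≃+* T) : Good T d := by
  obtain ⟨rs, hl, hr, hm⟩ := h
  refine ⟨rs.map e, by simpa, IsWeaklyRegular.map_ringEquiv e hr, ?_⟩
  have h1 := Ideal.map_ofList (e : S →+* T) rs
  have h2 : (rs.map (e : S →+* T)) = rs.map e := rfl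
  rw [← h2, ← h1, hm]
  have h3 : (maximalIdeal S).map (e : S →+* T) = (maximalIdeal S).comap (e.symm : T →+* S) :=
    Ideal.map_comap_of_equiv e
  rw [h3]
  ext x
  simp

/-- The localization at every prime is `Good`. -/
def LocallyGood (R : Type) [CommRing R] : Prop :=
  ∀ (p : Ideal R) [p.IsPrime], ∃ d, Good (Localization.AtPrime p) d

lemma Good.polynomial {R : Type} [CommRing R] [IsLocalRing R] {d : ℕ}
    (h : Good R d) (p : Ideal (Polynomial R)) [p.IsPrime]
    (hp : p.comap Polynomial.C = maximalIdeal R) : ∃ d, Good (Localization.AtPrime p) d := by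
  obtain ⟨rs, -, hr, hm⟩ := h
  let q := (maximalIdeal R).map (Polynomial.C : R →+* Polynomial R)
  have qle : q ≤ p := by simpa [q, ← hp] using map_comap_le
  have hq : Ideal.ofList (rs.map (algebraMap R (Polynomial R))) = q := by
    rw [← Ideal.map_ofList, hm]; rfl
  suffices H : ∃ ts : List (Polynomial R),
      IsWeaklyRegular (Polynomial R) ts ∧ Ideal.ofList ts = p by
    obtain ⟨ts, h1, h2⟩ := H
    refine ⟨_, ts.map (algebraMap _ (Localization.AtPrime p)), rfl,
      h1.of_isLocalization _ p.primeCompl, ?_⟩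
    rw [← Ideal.map_ofList, h2, Localization.AtPrime.map_eq_maximalIdeal]
  have hr1 : IsWeaklyRegular (Polynomial R) (rs.map (algebraMap R (Polynomial R))) := hr.of_flat
  by_cases eq : p = q
  · exact ⟨_, hr1, hq.trans eq.symm⟩
  · have lt : q < p := lt_of_le_of_ne qle (Ne.symm eq)
    have hmax : (comap Polynomial.C p).IsMaximal := by simpa [hp] using maximalIdeal.isMaximal R
    obtain ⟨y, _, hy⟩ := Polynomial.exists_monic_span_sup_map_eq R p hmax (by simpa [hp])
    rw [hp] at hy
    have hqp : q.IsPrime := Ideal.isPrime_map_C_of_isPrime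
    have hyq : y ∉ q := fun hyq => by
      apply eq
      rw [hy]
      exact sup_eq_left.2 ((Ideal.span_singleton_le_iff_mem _).2 hyq)
    refine ⟨rs.map (algebraMap R (Polynomial R)) ++ [y],
      (isWeaklyRegular_append_iff _ _ _).2 ⟨hr1, ?_⟩, ?_⟩
    · rw [isWeaklyRegular_singleton_iff, isSMulRegular_iff_right_eq_zero_of_smul]
      intro x hx
      obtain ⟨f, rfl⟩ := Submodule.mkQ_surjective _ x
      rw [hq] at hx ⊢
      have h1 : y • f ∈ q • (⊤ : Submodule (Polynomial R) (Polynomial R)) :=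
        (Submodule.Quotient.mk_eq_zero _).1 hx
      refine (Submodule.Quotient.mk_eq_zero _).2 ?_
      rw [smul_eq_mul, Ideal.mul_top] at h1 ⊢
      exact (hqp.mem_or_mem h1).resolve_left hyq
    · rw [Ideal.ofList_append, hq, Ideal.ofList_singleton]
      exact hy.symm

lemma LocallyGood.polynomial {R : Type} [CommRing R] (h : LocallyGood R) :
    LocallyGood (Polynomial R) := by
  intro p hp
  let q := p.comap Polynomial.C
  let S := Polynomial (Localization.AtPrime q)
  let pc := Submonoid.map Polynomial.C.toMonoidHom q.primeCompl
  let : Algebra (Polynomial R) S := Polynomial.algebra R (Localization.AtPrime q)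
  have : IsLocalization pc S := Polynomial.isLocalization _ _
  let pS := p.map (algebraMap (Polynomial R) S)
  have disj : Disjoint (pc : Set (Polynomial R)) (p : Set (Polynomial R)) := by
    simpa [pc, q] using! Set.disjoint_image_left.mpr
      (Set.disjoint_compl_left_iff_subset.mpr (fun _ a ↦ a))
  have : pS.IsPrime := IsLocalization.isPrime_of_isPrime_disjoint pc _ _ ‹_› disj
  have : IsLocalization.AtPrime (Localization.AtPrime pS) p := by
    convert IsLocalization.isLocalization_isLocalization_atPrime_isLocalization pc
      (Localization.AtPrime pS) pS
    exact (IsLocalization.under_map_of_isPrime_disjoint pc _ ‹_› disj).symm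
  obtain ⟨d, hd⟩ := h q
  have eq : comap Polynomial.C pS = maximalIdeal (Localization.AtPrime q) := by
    rw [← IsLocalization.map_under q.primeCompl _ (comap Polynomial.C pS),
      ← IsLocalization.map_under q.primeCompl _ (maximalIdeal (Localization.AtPrime q))]
    simp only [comap_comap, S, pS]
    rw [← Polynomial.algebraMap_eq (R := Localization.AtPrime q),
      ← IsScalarTower.algebraMap_eq R (Localization.AtPrime q)
        (Polynomial (Localization.AtPrime q)),
      IsScalarTower.algebraMap_eq R (Polynomial R) (Polynomial (Localization.AtPrime q)),
      ← comap_comap, ← Ideal.under_def (Polynomial R),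
      IsLocalization.under_map_of_isPrime_disjoint pc _ ‹_› disj]
    simp [q, IsLocalization.AtPrime.under_maximalIdeal (Localization.AtPrime q) q]
  obtain ⟨d', hd'⟩ := hd.polynomial pS eq
  exact ⟨d', hd'.of_ringEquiv (IsLocalization.algEquiv p.primeCompl
    (Localization.AtPrime pS) (Localization.AtPrime p)).toRingEquiv⟩

lemma LocallyGood.of_ringEquiv {R R' : Type} [CommRing R] [CommRing R'] (h : LocallyGood R)
    (e : R ≃+* R') : LocallyGood R' := by
  intro p hp
  obtain ⟨d, hd⟩ := h (p.comap e)
  refine ⟨d, hd.of_ringEquiv (IsLocalization.ringEquivOfRingEquiv (M := (p.comap e).primeCompl)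
    (T := p.primeCompl) _ _ e ?_)⟩
  ext x
  constructor
  · rintro ⟨y, hy, rfl⟩
    exact hy
  · intro hx
    exact ⟨e.symm x, by simpa [Ideal.primeCompl] using hx, by simp⟩

lemma LocallyGood.field (F : Type) [Field F] : LocallyGood F := by
  intro p hp
  have hbot : p = ⊥ := (Ideal.eq_bot_or_top p).resolve_right hp.ne_top
  refine ⟨0, [], rfl, IsWeaklyRegular.nil _ _, ?_⟩
  have h1 : p.map (algebraMap F (Localization.AtPrime p)) = ⊥ :=
    (congrArg (Ideal.map _) hbot).trans Ideal.map_bot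
  rw [Ideal.ofList_nil, ← Localization.AtPrime.map_eq_maximalIdeal, h1]

lemma LocallyGood.mvPolynomial (F : Type) [Field F] (n : ℕ) :
    LocallyGood (MvPolynomial (Fin n) F) := by
  induction n with
  | zero => exact (LocallyGood.field F).of_ringEquiv (MvPolynomial.isEmptyRingEquiv F (Fin 0)).symm
  | succ n ih => exact ih.polynomial.of_ringEquiv (MvPolynomial.finSuccEquiv F n).symm.toRingEquiv

lemma LocallyGood.exists_good {R : Type} [CommRing R] (h : LocallyGood R) (p : Ideal R) [p.IsPrime]
    (S : Type) [CommRing S] [Algebra R S] [IsLocalization.AtPrime S p] [IsLocalRing S] :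
    ∃ d, Good S d := by
  obtain ⟨d, hd⟩ := h p
  exact ⟨d, hd.of_ringEquiv
    (IsLocalization.algEquiv p.primeCompl (Localization.AtPrime p) S).toRingEquiv⟩

end PolynomialLocalizations

section Families

open IsLocalRing RingTheory.Sequence Filter

/-- A family of local rings `T x` under `B`, indexed by a filtered set, which generically
behaves like the localization of `B` at the prime `𝔭`. -/
structure SpecFamily (B : Type) [CommRing B] (𝔭 : Ideal B) (X : Type 1) where
  filter : Filter X
  T : X → Type
  [ring : ∀ x, CommRing (T x)]
  [isLocal : ∀ x, IsLocalRing (T x)]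
  [noetherian : ∀ x, IsNoetherianRing (T x)]
  σ : ∀ x, B →+* T x
  exact : ∀ {ι₁ ι₂ ι₃ : Type} [Fintype ι₁] [Fintype ι₂] [Fintype ι₃] [DecidableEq ι₁]
    [DecidableEq ι₂] [DecidableEq ι₃] (U : Matrix ι₁ ι₂ B) (W : Matrix ι₂ ι₃ B),
    LinearMap.ker U.mulVecLin = LinearMap.range W.mulVecLin →
    ∀ᶠ x in filter, LinearMap.ker (U.map (σ x)).mulVecLin = LinearMap.range (W.map (σ x)).mulVecLin
  isUnit : ∀ g ∉ 𝔭, ∀ᶠ x in filter, IsUnit (σ x g)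
  good : ∀ x, ∃ d, Good (T x) d
  socle : ∀ x, ∃ y, y ∉ 𝔭.map (σ x) ∧ ∀ r ∈ maximalIdeal (T x), r * y ∈ 𝔭.map (σ x)

attribute [instance] SpecFamily.ring SpecFamily.isLocal SpecFamily.noetherian

variable {B : Type} [CommRing B] {𝔭 : Ideal B} {X : Type 1}
  (F : SpecFamily B 𝔭 X) {S : Type} [CommRing S] [Algebra B S]

/-- `b` is the image at `x` of `a`: writing `a = p / g` one has `b = σ(p) / σ(g)`. -/
def SpecFamily.Spec (x : X) (a : S) (b : F.T x) : Prop :=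
  ∃ p g : B, g ∉ 𝔭 ∧ IsUnit (F.σ x g) ∧ a * algebraMap B S g = algebraMap B S p ∧
    b * F.σ x g = F.σ x p

/-- Entrywise specialization of matrices. -/
def SpecFamily.MSpec {ι κ : Type} (x : X) (A : Matrix ι κ S) (A' : Matrix ι κ (F.T x)) : Prop :=
  ∀ i j, F.Spec x (A i j) (A' i j)

variable {F} {x : X}

lemma SpecFamily.Spec.of [𝔭.IsPrime] (p : B) : F.Spec x (algebraMap B S p) (F.σ x p) :=
  ⟨p, 1, fun h => (inferInstance : 𝔭.IsPrime).ne_top ((Ideal.eq_top_iff_one _).2 h), by simp,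
    by simp, by simp⟩

lemma SpecFamily.Spec.zero [𝔭.IsPrime] : F.Spec x (0 : S) 0 := by
  simpa using SpecFamily.Spec.of (F := F) (S := S) (x := x) 0

lemma SpecFamily.Spec.one [𝔭.IsPrime] : F.Spec x (1 : S) 1 := by
  simpa using SpecFamily.Spec.of (F := F) (S := S) (x := x) 1

lemma SpecFamily.Spec.neg {a : S} {b : F.T x} (h : F.Spec x a b) : F.Spec x (-a) (-b) := by
  obtain ⟨p, g, hg, hu, h1, h2⟩ := h
  exact ⟨-p, g, hg, hu, by simp [h1], by simp [h2]⟩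

lemma SpecFamily.Spec.mul [𝔭.IsPrime] {a c : S} {b e : F.T x} (h : F.Spec x a b)
    (h' : F.Spec x c e) : F.Spec x (a * c) (b * e) := by
  obtain ⟨p, g, hg, hu, h1, h2⟩ := h
  obtain ⟨p', g', hg', hu', h1', h2'⟩ := h'
  refine ⟨p * p', g * g',
    fun h => ((inferInstance : 𝔭.IsPrime).mem_or_mem h).elim hg hg', ?_, ?_, ?_⟩
  · rw [map_mul]; exact hu.mul hu'
  · rw [map_mul, map_mul, ← h1, ← h1']; ring
  · rw [map_mul, map_mul, ← h2, ← h2']; ring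

lemma SpecFamily.Spec.add [𝔭.IsPrime] {a c : S} {b e : F.T x} (h : F.Spec x a b)
    (h' : F.Spec x c e) : F.Spec x (a + c) (b + e) := by
  obtain ⟨p, g, hg, hu, h1, h2⟩ := h
  obtain ⟨p', g', hg', hu', h1', h2'⟩ := h'
  refine ⟨p * g' + p' * g, g * g',
    fun h => ((inferInstance : 𝔭.IsPrime).mem_or_mem h).elim hg hg', ?_, ?_, ?_⟩
  · rw [map_mul]; exact hu.mul hu'
  · rw [map_mul, map_add, map_mul, map_mul, ← h1, ← h1']; ring
  · rw [map_mul, map_add, map_mul, map_mul, ← h2, ← h2']; ring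

lemma SpecFamily.Spec.sum [𝔭.IsPrime] {ι : Type} (s : Finset ι) {a : ι → S} {b : ι → F.T x}
    (h : ∀ i, F.Spec x (a i) (b i)) : F.Spec x (∑ i ∈ s, a i) (∑ i ∈ s, b i) := by
  classical
  induction s using Finset.induction_on with
  | empty => simpa using SpecFamily.Spec.zero
  | insert i s hi ih =>
    rw [Finset.sum_insert hi, Finset.sum_insert hi]
    exact (h i).add ih

variable [IsDomain B] [𝔭.IsPrime] [IsLocalization.AtPrime S 𝔭]

include 𝔭 in
lemma algebraMap_injective_of_atPrime : Function.Injective (algebraMap B S) :=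
  IsLocalization.injective S (M := 𝔭.primeCompl) (by
    intro g hg
    exact mem_nonZeroDivisors_of_ne_zero fun h => hg (h ▸ 𝔭.zero_mem))

lemma SpecFamily.Spec.mul_eq {a : S} {b : F.T x} (h : F.Spec x a b) {p g : B}
    (hp : a * algebraMap B S g = algebraMap B S p) : b * F.σ x g = F.σ x p := by
  obtain ⟨p', g', hg, hu, h1, h2⟩ := h
  have h3 : p * g' = p' * g := by
    apply algebraMap_injective_of_atPrime (𝔭 := 𝔭) (S := S)
    rw [map_mul, map_mul, ← hp, ← h1]; ring
  apply hu.mul_right_cancel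
  rw [← map_mul, h3, map_mul, ← h2]; ring

lemma SpecFamily.Spec.unique {a : S} {b b' : F.T x} (h : F.Spec x a b) (h' : F.Spec x a b') :
    b = b' := by
  obtain ⟨p, g, hg, hu, h1, h2⟩ := h
  exact hu.mul_right_cancel (h2.trans (h'.mul_eq h1).symm)

omit [IsDomain B] in
lemma SpecFamily.eventually_exists_spec (F : SpecFamily B 𝔭 X) (a : S) :
    ∀ᶠ x in F.filter, ∃ b, F.Spec x a b := by
  obtain ⟨⟨p, g, hg⟩, h⟩ := IsLocalization.surj 𝔭.primeCompl a
  filter_upwards [F.isUnit g hg] with x hx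
  exact ⟨F.σ x p * ↑hx.unit⁻¹, p, g, hg, hx, h, by rw [mul_assoc, IsUnit.val_inv_mul, mul_one]⟩

omit [IsDomain B] in
lemma SpecFamily.eventually_exists_mspec (F : SpecFamily B 𝔭 X) {ι κ : Type} [Finite ι] [Finite κ]
    (A : Matrix ι κ S) : ∀ᶠ x in F.filter, ∃ A', F.MSpec x A A' := by
  have : ∀ᶠ x in F.filter, ∀ i j, ∃ b, F.Spec x (A i j) b :=
    eventually_all.2 fun i => eventually_all.2 fun j => F.eventually_exists_spec _
  filter_upwards [this] with x hx
  choose b hb using hx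
  exact ⟨b, hb⟩

lemma exists_mulVecLin_range_eq {R ι : Type} [CommRing R] [IsNoetherianRing R] [Finite ι]
    (N : Submodule R (ι → R)) : ∃ (t : ℕ) (W : Matrix ι (Fin t) R),
      N = LinearMap.range W.mulVecLin := by
  obtain ⟨t, s, hs⟩ := Submodule.fg_iff_exists_fin_generating_family.1
    (IsNoetherian.noetherian N)
  refine ⟨t, (Matrix.of s).transpose, ?_⟩
  rw [Matrix.range_mulVecLin, ← hs]
  rfl

omit [IsDomain B] in
include 𝔭 in
lemma exists_common_denominator {ι κ : Type} [Finite ι] [Finite κ] (A : Matrix ι κ S) :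
    ∃ (g : B) (A₀ : Matrix ι κ B), g ∉ 𝔭 ∧
      ∀ i j, A i j * algebraMap B S g = algebraMap B S (A₀ i j) := by
  classical
  obtain ⟨g, hg⟩ := IsLocalization.exist_integer_multiples_of_finite 𝔭.primeCompl
    (fun z : ι × κ => A z.1 z.2)
  choose A₀ hA₀ using hg
  exact ⟨g, fun i j => A₀ (i, j), g.2, fun i j => by
    rw [hA₀, Algebra.smul_def, mul_comm]⟩

lemma ker_mulVecLin_of_smul {R ι κ : Type} [CommRing R] [Fintype κ] {A A₀ : Matrix ι κ R} {g : R}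
    (hg : IsUnit g) (h : ∀ i j, A i j * g = A₀ i j) :
    LinearMap.ker A.mulVecLin = LinearMap.ker A₀.mulVecLin := by
  have h1 : A₀ = g • A := by ext i j; simp [← h, mul_comm]
  ext y
  rw [h1, LinearMap.mem_ker, LinearMap.mem_ker, Matrix.mulVecLin_apply, Matrix.mulVecLin_apply,
    Matrix.smul_mulVec, hg.smul_eq_zero]

lemma range_mulVecLin_of_smul {R ι κ : Type} [CommRing R] [Fintype κ] {A A₀ : Matrix ι κ R} {g : R}
    (hg : IsUnit g) (h : ∀ i j, A i j * g = A₀ i j) :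
    LinearMap.range A.mulVecLin = LinearMap.range A₀.mulVecLin := by
  have h1 : A₀ = g • A := by ext i j; simp [← h, mul_comm]
  ext y
  constructor
  · rintro ⟨z, rfl⟩
    refine ⟨(↑hg.unit⁻¹ : R) • z, ?_⟩
    rw [h1, Matrix.mulVecLin_apply, Matrix.mulVec_smul, Matrix.smul_mulVec, smul_smul,
      IsUnit.val_inv_mul, one_smul]
    rfl
  · rintro ⟨z, rfl⟩
    refine ⟨g • z, ?_⟩
    rw [h1, Matrix.mulVecLin_apply, Matrix.mulVec_smul, Matrix.mulVecLin_apply, Matrix.smul_mulVec]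

variable [IsNoetherianRing B]

lemma SpecFamily.eventually_exact (F : SpecFamily B 𝔭 X) {ι₁ ι₂ ι₃ : Type} [Fintype ι₁] [Fintype ι₂]
    [Fintype ι₃] (U : Matrix ι₁ ι₂ S) (V : Matrix ι₂ ι₃ S)
    (h : LinearMap.ker U.mulVecLin = LinearMap.range V.mulVecLin) :
    ∀ᶠ x in F.filter, ∀ U' V', F.MSpec x U U' → F.MSpec x V V' →
      LinearMap.ker U'.mulVecLin = LinearMap.range V'.mulVecLin := by
  classical
  obtain ⟨gU, U₀, hgU, hU⟩ := exists_common_denominator (𝔭 := 𝔭) U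
  obtain ⟨gV, V₀, hgV, hV⟩ := exists_common_denominator (𝔭 := 𝔭) V
  have hunit : ∀ g ∉ 𝔭, IsUnit (algebraMap B S g) := fun g hg =>
    IsLocalization.map_units S (⟨g, hg⟩ : 𝔭.primeCompl)
  have hinj := algebraMap_injective_of_atPrime (𝔭 := 𝔭) (S := S)
  have hS : LinearMap.ker (U₀.map (algebraMap B S)).mulVecLin =
      LinearMap.range (V₀.map (algebraMap B S)).mulVecLin := by
    rw [← ker_mulVecLin_of_smul (A := U) (A₀ := U₀.map (algebraMap B S)) (hunit gU hgU) hU,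
      ← range_mulVecLin_of_smul (A := V) (A₀ := V₀.map (algebraMap B S)) (hunit gV hgV) hV, h]
  have hUV : U₀ * V₀ = 0 := by
    apply Matrix.map_injective hinj
    have h0 : U₀.map (algebraMap B S) * V₀.map (algebraMap B S) = 0 := by
      ext i j
      have h1 : (V₀.map (algebraMap B S)).mulVec (Pi.single j 1) ∈
          LinearMap.ker (U₀.map (algebraMap B S)).mulVecLin := hS ▸ ⟨_, rfl⟩
      rw [LinearMap.mem_ker, Matrix.mulVecLin_apply, Matrix.mulVec_mulVec,
        Matrix.mulVec_single_one] at h1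
      exact congrFun h1 i
    dsimp only
    rw [Matrix.map_mul, h0]
    ext; simp
  obtain ⟨t, W, hW⟩ := exists_mulVecLin_range_eq (LinearMap.ker U₀.mulVecLin)
  have hcol : ∃ Z : Matrix ι₃ (Fin t) S,
      W.map (algebraMap B S) = V₀.map (algebraMap B S) * Z := by
    have h1 : ∀ j, ∃ z, (V₀.map (algebraMap B S)).mulVec z = fun i => algebraMap B S (W i j) := by
      intro j
      have h2 : (fun i => algebraMap B S (W i j)) ∈
          LinearMap.ker (U₀.map (algebraMap B S)).mulVecLin := by
        have h3 : W.mulVec (Pi.single j 1) ∈ LinearMap.ker U₀.mulVecLin := hW ▸ ⟨_, rfl⟩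
        rw [LinearMap.mem_ker, Matrix.mulVecLin_apply, Matrix.mulVec_single_one] at h3
        rw [LinearMap.mem_ker, Matrix.mulVecLin_apply]
        ext i
        have h4 := congrArg (algebraMap B S) (congrFun h3 i)
        rw [Pi.zero_apply, map_zero] at h4
        rw [Pi.zero_apply, ← h4]
        simp [Matrix.mulVec, dotProduct]
      rw [hS] at h2
      exact h2
    choose z hz using h1
    refine ⟨fun i j => z j i, ?_⟩
    ext i j
    exact (congrFun (hz j) i).symm
  obtain ⟨Z, hZ⟩ := hcol
  obtain ⟨gZ, Z₀, hgZ, hZ₀⟩ := exists_common_denominator (𝔭 := 𝔭) Z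
  have hWZ : ∀ i j, (W i j) * gZ = ∑ l, V₀ i l * Z₀ l j := by
    intro i j
    apply hinj
    have h1 : algebraMap B S (W i j) = ∑ l, algebraMap B S (V₀ i l) * Z l j :=
      congrFun (congrFun hZ i) j
    rw [map_mul, h1, map_sum, Finset.sum_mul]
    refine Finset.sum_congr rfl fun l _ => ?_
    rw [map_mul, ← hZ₀, mul_assoc]
  filter_upwards [F.exact U₀ W hW, F.isUnit gU hgU, F.isUnit gV hgV, F.isUnit gZ hgZ]
    with x hx hxU hxV hxZ U' V' hU' hV'
  rw [ker_mulVecLin_of_smul (A := U') (A₀ := U₀.map (F.σ x)) hxU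
      fun i j => (hU' i j).mul_eq (hU i j),
    range_mulVecLin_of_smul (A := V') (A₀ := V₀.map (F.σ x)) hxV
      fun i j => (hV' i j).mul_eq (hV i j)]
  apply le_antisymm
  · rw [hx, range_mulVecLin_of_smul (A := W.map (F.σ x))
      (A₀ := V₀.map (F.σ x) * Z₀.map (F.σ x)) hxZ fun i j => ?_]
    · rw [Matrix.mulVecLin_mul]
      exact LinearMap.range_comp_le_range _ _
    · rw [Matrix.map_apply, ← map_mul, hWZ]
      simp [Matrix.mul_apply]
  · rintro _ ⟨z, rfl⟩
    rw [LinearMap.mem_ker, Matrix.mulVecLin_apply, Matrix.mulVecLin_apply, Matrix.mulVec_mulVec,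
      ← Matrix.map_mul, hUV]
    simp

end Families

section DualKillsSyzygies

variable {R : Type} [CommRing R] {p r q v : ℕ}

/-- The matrix whose kernel encodes the pairs `(c, z)` with `c • Y_l = A₁ᵀ z_l` for every column
`Y_l` of `Y`. -/
def annMatrix (A₁ : Matrix (Fin p) (Fin r) R) (Y : Matrix (Fin r) (Fin v) R) :
    Matrix (Fin v × Fin r) (Unit ⊕ (Fin v × Fin p)) R :=
  fun lj => Sum.elim (fun _ => Y lj.2 lj.1) fun lk => if lj.1 = lk.1 then -A₁ lk.2 lj.2 else 0

lemma annMatrix_mulVec (A₁ : Matrix (Fin p) (Fin r) R) (Y : Matrix (Fin r) (Fin v) R)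
    (z : Unit ⊕ (Fin v × Fin p) → R) (l : Fin v) (j : Fin r) :
    (annMatrix A₁ Y).mulVec z (l, j) =
      Y j l * z (Sum.inl ()) - ∑ k, A₁ k j * z (Sum.inr (l, k)) := by
  simp [annMatrix, Matrix.mulVec, dotProduct, Fintype.sum_prod_type, ite_mul, sub_eq_add_neg]

lemma dualKills_iff_mem_span {t : ℕ} {A₁ : Matrix (Fin p) (Fin r) R} {A₂ : Matrix (Fin r) (Fin q) R}
    {Y : Matrix (Fin r) (Fin v) R} {Ψ : Matrix (Unit ⊕ (Fin v × Fin p)) (Fin t) R}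
    (hY : LinearMap.ker A₂.transpose.mulVecLin = LinearMap.range Y.mulVecLin)
    (hΨ : LinearMap.ker (annMatrix A₁ Y).mulVecLin = LinearMap.range Ψ.mulVecLin) (c : R) :
    DualKills A₁ A₂ c ↔ c ∈ Ideal.span (Set.range (Ψ (Sum.inl ()))) := by
  have key : c ∈ Ideal.span (Set.range (Ψ (Sum.inl ()))) ↔
      ∃ z, (annMatrix A₁ Y).mulVec z = 0 ∧ z (Sum.inl ()) = c := by
    rw [Ideal.mem_span_range_iff_exists_fun]
    constructor
    · rintro ⟨w, rfl⟩
      refine ⟨Ψ.mulVec w, ?_, ?_⟩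
      · have : Ψ.mulVecLin w ∈ LinearMap.ker (annMatrix A₁ Y).mulVecLin := hΨ ▸ ⟨w, rfl⟩
        exact this
      · rw [Matrix.mulVec, dotProduct]
        exact Finset.sum_congr rfl fun i _ => mul_comm (Ψ (Sum.inl ()) i) (w i)
    · rintro ⟨z, hz, rfl⟩
      have : z ∈ LinearMap.ker (annMatrix A₁ Y).mulVecLin := hz
      rw [hΨ] at this
      obtain ⟨w, rfl⟩ := this
      exact ⟨w, Finset.sum_congr rfl fun i _ => mul_comm (w i) (Ψ (Sum.inl ()) i)⟩
  rw [key]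
  constructor
  · intro h
    have h1 : ∀ l, ∃ z, c • Y.col l = A₁.transpose.mulVec z := by
      intro l
      apply h
      have : Y.mulVecLin (Pi.single l 1) ∈ LinearMap.ker A₂.transpose.mulVecLin := hY ▸ ⟨_, rfl⟩
      rw [LinearMap.mem_ker, Matrix.mulVecLin_apply, Matrix.mulVecLin_apply,
        Matrix.mulVec_single_one] at this
      exact this
    choose z hz using h1
    refine ⟨Sum.elim (fun _ => c) fun lk => z lk.1 lk.2, ?_, rfl⟩
    ext ⟨l, j⟩
    rw [annMatrix_mulVec, Pi.zero_apply, sub_eq_zero]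
    have := congrFun (hz l) j
    simp only [Sum.elim_inl, Sum.elim_inr]
    rw [mul_comm]
    exact this
  · rintro ⟨z, hz, rfl⟩ y hy
    have hy' : y ∈ LinearMap.ker A₂.transpose.mulVecLin := hy
    rw [hY] at hy'
    obtain ⟨u, rfl⟩ := hy'
    refine ⟨fun k => ∑ l, u l * z (Sum.inr (l, k)), ?_⟩
    ext j
    have h1 : ∀ l, Y j l * z (Sum.inl ()) = ∑ k, A₁ k j * z (Sum.inr (l, k)) := fun l => by
      rw [← sub_eq_zero, ← annMatrix_mulVec, hz, Pi.zero_apply]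
    simp only [Pi.smul_apply, Matrix.mulVecLin_apply, Matrix.mulVec, dotProduct, smul_eq_mul,
      Matrix.transpose_apply, Finset.mul_sum]
    rw [Finset.sum_comm]
    refine Finset.sum_congr rfl fun l _ => ?_
    rw [show z (Sum.inl ()) * (Y j l * u l) = u l * (Y j l * z (Sum.inl ())) by ring, h1,
      Finset.mul_sum]
    exact Finset.sum_congr rfl fun k _ => by ring

end DualKillsSyzygies

section FamilyIdeals

open IsLocalRing RingTheory.Sequence Filter

variable {B : Type} [CommRing B] [IsDomain B] {𝔭 : Ideal B} [𝔭.IsPrime] {X : Type 1}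
  (F : SpecFamily B 𝔭 X) {S : Type} [CommRing S] [Algebra B S] [IsLocalization.AtPrime S 𝔭]

lemma SpecFamily.eventually_span_le {ι κ : Type} [Fintype ι] [Fintype κ] {w : ι → S} {a : κ → S}
    (h : Ideal.span (Set.range w) ≤ Ideal.span (Set.range a)) :
    ∀ᶠ x in F.filter, ∀ w' a', (∀ i, F.Spec x (w i) (w' i)) → (∀ j, F.Spec x (a j) (a' j)) →
      Ideal.span (Set.range w') ≤ Ideal.span (Set.range a') := by
  have h1 : ∀ i, ∃ c : κ → S, ∑ j, c j * a j = w i := fun i =>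
    Ideal.mem_span_range_iff_exists_fun.1 (h (Ideal.subset_span ⟨i, rfl⟩))
  choose C hC using h1
  filter_upwards [F.eventually_exists_mspec (Matrix.of C)] with x ⟨C', hC'⟩ w' a' hw ha
  rw [Ideal.span_le]
  rintro _ ⟨i, rfl⟩
  have h2 : w' i = ∑ j, C' i j * a' j := by
    refine (hw i).unique (S := S) ?_
    rw [← hC]
    exact SpecFamily.Spec.sum _ fun j => (hC' i j).mul (ha j)
  rw [h2]
  exact Ideal.sum_mem _ fun j _ => Ideal.mul_mem_left _ _ (Ideal.subset_span ⟨j, rfl⟩)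

lemma SpecFamily.eventually_span_eq {ι κ : Type} [Fintype ι] [Fintype κ] {w : ι → S} {a : κ → S}
    (h : Ideal.span (Set.range w) = Ideal.span (Set.range a)) :
    ∀ᶠ x in F.filter, ∀ w' a', (∀ i, F.Spec x (w i) (w' i)) → (∀ j, F.Spec x (a j) (a' j)) →
      Ideal.span (Set.range w') = Ideal.span (Set.range a') := by
  filter_upwards [F.eventually_span_le h.le, F.eventually_span_le h.ge] with x h1 h2 w' a' hw ha
  exact le_antisymm (h1 w' a' hw ha) (h2 a' w' ha hw)

variable [IsNoetherianRing B] [IsNoetherianRing S]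

lemma SpecFamily.eventually_dualKills {p r q t : ℕ} (A₁ : Matrix (Fin p) (Fin r) S)
    (A₂ : Matrix (Fin r) (Fin q) S) (a : Fin t → S)
    (h : ∀ c, DualKills A₁ A₂ c ↔ c ∈ Ideal.span (Set.range a)) :
    ∀ᶠ x in F.filter, ∀ A₁' A₂' b, F.MSpec x A₁ A₁' → F.MSpec x A₂ A₂' →
      (∀ j, F.Spec x (a j) (b j)) →
      ∀ c, DualKills A₁' A₂' c ↔ c ∈ Ideal.span (Set.range b) := by
  obtain ⟨v, Y, hY⟩ := exists_mulVecLin_range_eq (LinearMap.ker A₂.transpose.mulVecLin)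
  obtain ⟨s, Ψ, hΨ⟩ := exists_mulVecLin_range_eq (LinearMap.ker (annMatrix A₁ Y).mulVecLin)
  have hspan : Ideal.span (Set.range (Ψ (Sum.inl ()))) = Ideal.span (Set.range a) := by
    ext c
    rw [← h, dualKills_iff_mem_span hY hΨ]
  filter_upwards [F.eventually_exists_mspec Y, F.eventually_exists_mspec Ψ,
    F.eventually_exact _ _ hY, F.eventually_exact _ _ hΨ, F.eventually_span_eq hspan]
    with x ⟨Y', hY'⟩ ⟨Ψ', hΨ'⟩ h1 h2 h3 A₁' A₂' b hA₁ hA₂ hb c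
  rw [← h3 _ _ (fun i => hΨ' (Sum.inl ()) i) hb]
  refine dualKills_iff_mem_span (h1 _ _ (fun i j => hA₂ j i) hY') (h2 _ _ ?_ hΨ') c
  rintro ⟨l, j⟩ (u | ⟨l', k⟩)
  · exact hY' j l
  · show F.Spec x (if l = l' then -A₁ k j else 0) (if l = l' then -A₁' k j else 0)
    split_ifs
    · exact (hA₁ k j).neg
    · exact SpecFamily.Spec.zero

end FamilyIdeals

section Colon

variable {R : Type} [CommRing R]

/-- The one-row matrix with entries `r, f₁, …, f_s`. -/
def rowMatrix {κ : Type} (r : R) (f : κ → R) : Matrix Unit (Unit ⊕ κ) R :=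
  fun _ => Sum.elim (fun _ => r) f

lemma mul_mem_span_iff {κ τ : Type} [Fintype κ] [Fintype τ] {r : R} {f : κ → R}
    {W : Matrix (Unit ⊕ κ) τ R}
    (hW : LinearMap.ker (rowMatrix r f).mulVecLin = LinearMap.range W.mulVecLin) (y : R) :
    r * y ∈ Ideal.span (Set.range f) ↔ y ∈ Ideal.span (Set.range (W (Sum.inl ()))) := by
  have hker : ∀ z, z ∈ LinearMap.ker (rowMatrix r f).mulVecLin ↔
      r * z (Sum.inl ()) + ∑ j, f j * z (Sum.inr j) = 0 := by
    intro z
    rw [LinearMap.mem_ker, Matrix.mulVecLin_apply]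
    constructor
    · intro h
      simpa [rowMatrix, Matrix.mulVec, dotProduct] using congrFun h ()
    · intro h
      ext
      simpa [rowMatrix, Matrix.mulVec, dotProduct] using h
  rw [Ideal.mem_span_range_iff_exists_fun, Ideal.mem_span_range_iff_exists_fun]
  constructor
  · rintro ⟨c, hc⟩
    have h1 : Sum.elim (fun _ => y) (fun j => -c j) ∈ LinearMap.ker (rowMatrix r f).mulVecLin := by
      rw [hker]
      simp [← hc, mul_comm]
    rw [hW] at h1
    obtain ⟨u, hu⟩ := h1
    refine ⟨u, ?_⟩
    have h2 := congrFun hu (Sum.inl ())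
    rw [Matrix.mulVecLin_apply, Matrix.mulVec, dotProduct, Sum.elim_inl] at h2
    rw [← h2]
    exact Finset.sum_congr rfl fun i _ => mul_comm (u i) (W (Sum.inl ()) i)
  · rintro ⟨u, rfl⟩
    have h1 : W.mulVecLin u ∈ LinearMap.ker (rowMatrix r f).mulVecLin := hW ▸ ⟨u, rfl⟩
    rw [hker] at h1
    refine ⟨fun j => -(W.mulVec u (Sum.inr j)), ?_⟩
    have h2 : W.mulVecLin u (Sum.inl ()) = ∑ i, u i * W (Sum.inl ()) i :=
      Finset.sum_congr rfl fun i _ => mul_comm (W (Sum.inl ()) i) (u i)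
    rw [h2] at h1
    rw [eq_neg_of_add_eq_zero_left h1, ← Finset.sum_neg_distrib]
    exact Finset.sum_congr rfl fun j _ => by rw [Matrix.mulVecLin_apply]; ring

lemma ofList_take_ofFn {d : ℕ} (g : Fin d → R) (i : Fin d) :
    Ideal.ofList ((List.ofFn g).take i) =
      Ideal.span (Set.range fun j : Fin i => g (Fin.castLE i.2.le j)) := by
  rw [← Fin.ofFn_take_eq_take_ofFn i.2.le]
  refine congrArg Ideal.span (Set.ext fun y => ?_)
  simp only [Set.mem_ofPred_eq, List.mem_ofFn, Fin.take_apply, Set.mem_range]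

lemma isWeaklyRegular_ofFn_iff {d : ℕ} (g : Fin d → R) :
    RingTheory.Sequence.IsWeaklyRegular R (List.ofFn g) ↔ ∀ i : Fin d, ∀ y,
      g i * y ∈ Ideal.span (Set.range fun j : Fin i => g (Fin.castLE i.2.le j)) →
        y ∈ Ideal.span (Set.range fun j : Fin i => g (Fin.castLE i.2.le j)) := by
  rw [RingTheory.Sequence.isWeaklyRegular_iff]
  constructor
  · intro h i y hy
    have := (isSMulRegular_quotient_iff_mem_of_smul_mem _ _).1 (h i (by simp)) y
    simp only [List.getElem_ofFn, smul_eq_mul, Ideal.mul_top, ofList_take_ofFn] at this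
    exact this hy
  · intro h i hi
    rw [List.length_ofFn] at hi
    rw [isSMulRegular_quotient_iff_mem_of_smul_mem]
    intro y hy
    have h1 := ofList_take_ofFn g ⟨i, hi⟩
    simp only at h1
    simp only [List.getElem_ofFn, smul_eq_mul, Ideal.mul_top, h1] at hy ⊢
    exact h ⟨i, hi⟩ y hy

end Colon

section FamilyKills

open IsLocalRing RingTheory.Sequence Filter

variable {B : Type} [CommRing B] [IsDomain B] {𝔭 : Ideal B} [𝔭.IsPrime] {X : Type 1}
  (F : SpecFamily B 𝔭 X) {S : Type} [CommRing S] [Algebra B S] [IsLocalization.AtPrime S 𝔭]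
  [IsNoetherianRing B] [IsNoetherianRing S]

lemma SpecFamily.eventually_colon {κ : Type} [Fintype κ] (r : S) (f : κ → S)
    (h : ∀ y, r * y ∈ Ideal.span (Set.range f) → y ∈ Ideal.span (Set.range f)) :
    ∀ᶠ x in F.filter, ∀ r' f', F.Spec x r r' → (∀ j, F.Spec x (f j) (f' j)) →
      ∀ y, r' * y ∈ Ideal.span (Set.range f') → y ∈ Ideal.span (Set.range f') := by
  obtain ⟨t, W, hW⟩ := exists_mulVecLin_range_eq (LinearMap.ker (rowMatrix r f).mulVecLin)
  have hle : Ideal.span (Set.range (W (Sum.inl ()))) ≤ Ideal.span (Set.range f) :=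
    fun y hy => h y ((mul_mem_span_iff hW y).2 hy)
  filter_upwards [F.eventually_exists_mspec W, F.eventually_exact _ _ hW, F.eventually_span_le hle]
    with x ⟨W', hW'⟩ h1 h2 r' f' hr hf y hy
  refine h2 _ _ (fun i => hW' (Sum.inl ()) i) hf ((mul_mem_span_iff (h1 _ _ ?_ hW') y).1 hy)
  rintro _ (_ | j)
  · exact hr
  · exact hf j

lemma SpecFamily.eventually_good [IsLocalRing S] {d : ℕ} (hS : Good S d) :
    ∀ᶠ x in F.filter, Good (F.T x) d := by
  obtain ⟨g, hreg, hmax⟩ : ∃ g : Fin d → S, IsWeaklyRegular S (List.ofFn g) ∧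
      Ideal.ofList (List.ofFn g) = maximalIdeal S := by
    obtain ⟨rs, rfl, hreg, hmax⟩ := hS
    exact ⟨rs.get, by rwa [List.ofFn_get], by rwa [List.ofFn_get]⟩
  obtain ⟨s, p, hp⟩ := Submodule.fg_iff_exists_fin_generating_family.1
    (IsNoetherian.noetherian 𝔭)
  have hof : ∀ {R : Type} [CommRing R] (g : Fin d → R),
      Ideal.ofList (List.ofFn g) = Ideal.span (Set.range g) := by
    intro R _ g
    refine congrArg Ideal.span (Set.ext fun y => ?_)
    simp only [Set.mem_ofPred_eq, List.mem_ofFn, Set.mem_range]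
  have hmap : ∀ {R : Type} [CommRing R] (f : B →+* R),
      Ideal.span (Set.range fun j => f (p j)) = 𝔭.map f := by
    intro R _ f
    refine (Eq.trans (Ideal.map_span _ _) (by rw [← Set.range_comp]; rfl)).symm.trans
      (congrArg (Ideal.map f) hp)
  have hspan : Ideal.span (Set.range g) = Ideal.span (Set.range fun j => algebraMap B S (p j)) := by
    rw [← hof, hmax, ← IsLocalization.AtPrime.map_eq_maximalIdeal 𝔭 S, hmap]
  have hcol : ∀ᶠ x in F.filter, ∀ i : Fin d, _ := eventually_all.2 fun i => F.eventually_colon (g i)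
    (fun j : Fin i => g (Fin.castLE i.2.le j)) ((isWeaklyRegular_ofFn_iff g).1 hreg i)
  have hex : ∀ᶠ x in F.filter, ∀ i : Fin d, ∃ b, F.Spec x (g i) b :=
    eventually_all.2 fun i => F.eventually_exists_spec _
  filter_upwards [hcol, hex, F.eventually_span_eq hspan] with x h1 h2 h3
  choose g' hg' using h2
  have h4 : Ideal.span (Set.range g') = 𝔭.map (F.σ x) := by
    rw [h3 g' (fun j => F.σ x (p j)) hg' fun j => SpecFamily.Spec.of _, hmap]
  obtain ⟨d', hd'⟩ := F.good x
  obtain ⟨y, hy, hy'⟩ := F.socle x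
  have h5 : (List.ofFn g').length = d' := by
    refine hd'.length_eq (List.ofFn g') ?_ ?_ y ?_ ?_
    · rw [isWeaklyRegular_ofFn_iff]
      exact fun i => h1 i _ _ (hg' i) fun j => hg' _
    · intro r hr
      refine le_maximalIdeal (J := 𝔭.map (F.σ x)) (fun h => hy (h ▸ trivial)) ?_
      rw [← h4, ← hof]
      exact Ideal.subset_span hr
    · rwa [hof, h4]
    · rwa [hof, h4]
  rw [List.length_ofFn] at h5
  exact h5 ▸ hd'

lemma SpecFamily.eventually_kills_of_eventually_good [IsLocalRing S] {d : ℕ} (hS : Good S d)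
    (hT : ∀ᶠ x in F.filter, Good (F.T x) d) (e : ℕ) :
    ∀ {i r s t : ℕ} (A : Matrix (Fin r) (Fin s) S) (a : Fin t → S), d ≤ i + e →
      (∀ c, Kills c i (MatCoker A) ↔ c ∈ Ideal.span (Set.range a)) →
      ∀ᶠ x in F.filter, ∀ A' b, F.MSpec x A A' → (∀ j, F.Spec x (a j) (b j)) →
        ∀ c, Kills c i (MatCoker A') ↔ c ∈ Ideal.span (Set.range b) := by
  induction e with
  | zero =>
    intro i r s t A a hi h
    rcases (show d ≤ i from hi).eq_or_lt with rfl | hi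
    · filter_upwards [hT, F.eventually_dualKills (0 : Matrix (Fin 0) (Fin r) S) A a
        fun c => by rw [← h, hS.kills_top_iff]] with x hx h1 A' b hA hb c
      rw [hx.kills_top_iff]
      exact h1 0 A' b (fun i => i.elim0) hA hb c
    · have hspan : Ideal.span (Set.range fun _ : Unit => (1 : S)) ≤ Ideal.span (Set.range a) :=
        fun c _ => (h c).1 (hS.kills_of_gt hi c _)
      filter_upwards [hT, F.eventually_span_le hspan] with x hx h1 A' b hA hb c
      refine ⟨fun _ => ?_, fun _ => hx.kills_of_gt hi c _⟩
      have h2 := h1 (fun _ => 1) b (fun _ => SpecFamily.Spec.one) hb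
      simpa using Ideal.mul_mem_left _ c (h2 (Ideal.subset_span ⟨(), rfl⟩))
  | succ e ih =>
    intro i r s t A a hi h
    by_cases h0 : d ≤ i + e
    · exact ih A a h0 h
    obtain ⟨q, A₂, hA₂⟩ := exists_mulVecLin_range_eq (LinearMap.ker A.mulVecLin)
    by_cases h2 : i + 1 < d
    · filter_upwards [hT, F.eventually_exists_mspec A₂, F.eventually_exact _ _ hA₂,
        ih (i := i + 1) A₂ a (by omega) fun c => by rw [← h, hS.kills_succ_iff hA₂ h2]]
        with x hx ⟨A₂', hA₂'⟩ h3 h4 A' b hA hb c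
      rw [hx.kills_succ_iff (h3 _ _ hA hA₂') h2]
      exact h4 A₂' b hA₂' hb c
    · obtain rfl : d = i + 1 := by omega
      filter_upwards [hT, F.eventually_exists_mspec A₂, F.eventually_exact _ _ hA₂,
        F.eventually_dualKills A A₂ a fun c => by rw [← h, hS.kills_pred_iff hA₂]]
        with x hx ⟨A₂', hA₂'⟩ h3 h4 A' b hA hb c
      rw [hx.kills_pred_iff (h3 _ _ hA hA₂')]
      exact h4 A' A₂' b hA hA₂' hb c

/-- The annihilators of the local cohomology modules of a finitely presented module specialize. -/
theorem SpecFamily.eventually_kills [IsLocalRing S] {d : ℕ} (hS : Good S d) {i r s t : ℕ}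
    (A : Matrix (Fin r) (Fin s) S) (a : Fin t → S)
    (h : ∀ c, Kills c i (MatCoker A) ↔ c ∈ Ideal.span (Set.range a)) :
    ∀ᶠ x in F.filter, ∀ A' b, F.MSpec x A A' → (∀ j, F.Spec x (a j) (b j)) →
      ∀ c, Kills c i (MatCoker A') ↔ c ∈ Ideal.span (Set.range b) :=
  F.eventually_kills_of_eventually_good hS (F.eventually_good hS) d A a (by omega) h

end FamilyKills

section GenericTorVanishing

open Function

/-- Every short exact sequence ending in `M` stays injective on the left after `- ⊗ κ`,
i.e. `Tor₁(M, κ) = 0`. -/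
def TorZero (A : Type) [CommRing A] (κ : Type) [AddCommGroup κ] [Module A κ]
    (M : Type) [AddCommGroup M] [Module A M] : Prop :=
  ∀ (N' N : Type) [AddCommGroup N'] [AddCommGroup N] [Module A N'] [Module A N]
    (f : N' →ₗ[A] N) (g : N →ₗ[A] M), Injective f → Surjective g → Exact f g →
      Injective (f.rTensor κ)

variable {A : Type} [CommRing A] {κ : Type} [AddCommGroup κ] [Module A κ]

lemma TorZero.of_equiv {M M' : Type} [AddCommGroup M] [Module A M] [AddCommGroup M'] [Module A M']
    (h : TorZero A κ M) (e : M ≃ₗ[A] M') : TorZero A κ M' := by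
  intro N' N _ _ _ _ f g hf hg hfg
  refine h N' N f (e.symm.toLinearMap ∘ₗ g) hf (e.symm.surjective.comp hg) fun y => ?_
  simpa using hfg y

lemma TorZero.of_exact {M' M M'' : Type} [AddCommGroup M] [Module A M] [AddCommGroup M']
    [Module A M'] [AddCommGroup M''] [Module A M''] (h' : TorZero A κ M') (h'' : TorZero A κ M'')
    (i : M' →ₗ[A] M) (p : M →ₗ[A] M'') (hi : Injective i) (hp : Surjective p) (hip : Exact i p) :
    TorZero A κ M := by
  intro N' N _ _ _ _ f g hf hg hfg
  let N₁ : Submodule A N := LinearMap.ker (p ∘ₗ g)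
  have hf₁ : ∀ x, f x ∈ N₁ := fun x => by simp [N₁, hfg.apply_apply_eq_zero]
  let f₁ : N' →ₗ[A] N₁ := f.codRestrict N₁ hf₁
  have hfac : f = N₁.subtype ∘ₗ f₁ := rfl
  have hg₁ : ∀ x : N₁, g x ∈ LinearMap.range i := fun x => by
    have : p (g x) = 0 := x.2
    exact (hip _).1 this
  let g₁ : N₁ →ₗ[A] M' := (LinearEquiv.ofInjective i hi).symm.toLinearMap ∘ₗ
    (g ∘ₗ N₁.subtype).codRestrict (LinearMap.range i) hg₁
  have hig : ∀ x : N₁, i (g₁ x) = g x := fun x => by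
    have := LinearEquiv.apply_symm_apply (LinearEquiv.ofInjective i hi)
      ((g ∘ₗ N₁.subtype).codRestrict (LinearMap.range i) hg₁ x)
    exact congrArg Subtype.val this
  rw [hfac, LinearMap.rTensor_comp, LinearMap.coe_comp]
  refine Injective.comp (h'' N₁ N N₁.subtype (p ∘ₗ g) N₁.injective_subtype (hp.comp hg)
    fun y => ?_) (h' N' N₁ f₁ g₁ (fun x y h => hf (congrArg Subtype.val h)) ?_ fun y => ?_)
  · simp [N₁]
  · intro m
    obtain ⟨y, hy⟩ := hg (i m)
    have hy1 : y ∈ N₁ := by simp [N₁, hy, hip.apply_apply_eq_zero]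
    exact ⟨⟨y, hy1⟩, hi ((hig _).trans hy)⟩
  · rw [← (map_eq_zero_iff i hi), hig, hfg (y : N)]
    constructor
    · rintro ⟨x, hx⟩
      exact ⟨x, Subtype.ext hx⟩
    · rintro ⟨x, hx⟩
      exact ⟨x, congrArg Subtype.val hx⟩

lemma TorZero.of_projective (M : Type) [AddCommGroup M] [Module A M] [Module.Projective A M] :
    TorZero A κ M := by
  intro N' N _ _ _ _ f g hf hg hfg
  obtain ⟨σ, hσ⟩ := Module.projective_lifting_property g LinearMap.id hg
  obtain ⟨ρ, hρ⟩ := ((hfg.split_tfae hf hg).out 0 1 :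
    (∃ l, g ∘ₗ l = LinearMap.id) ↔ ∃ l, l ∘ₗ f = LinearMap.id).1 ⟨σ, hσ⟩
  refine LeftInverse.injective (g := ρ.rTensor κ) fun x => ?_
  rw [← LinearMap.comp_apply, ← LinearMap.rTensor_comp, hρ, LinearMap.rTensor_id,
    LinearMap.id_apply]

lemma TorZero.of_smul_eq {M F : Type} [AddCommGroup M] [Module A M] [AddCommGroup F] [Module A F]
    (hF : TorZero A κ F) (s : M →ₗ[A] F) (r : F →ₗ[A] M) (q : A) (hrs : ∀ x, r (s x) = q • x)
    (hq : Bijective fun x : κ => q • x) : TorZero A κ M := by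
  intro N' N _ _ _ _ f g hf hg hfg
  let Q : Submodule A (N × F) :=
    LinearMap.eqLocus (g ∘ₗ LinearMap.fst A N F) (r ∘ₗ LinearMap.snd A N F)
  let j : N' →ₗ[A] Q := (LinearMap.inl A N F ∘ₗ f).codRestrict Q fun x => by
    simp [Q, hfg.apply_apply_eq_zero]
  let φ : N →ₗ[A] Q := ((q • LinearMap.id).prod (s ∘ₗ g)).codRestrict Q fun x => by
    simp [Q, hrs]
  have hj : Injective (j.rTensor κ) := by
    refine hF N' Q j (LinearMap.snd A N F ∘ₗ Q.subtype)
      (fun x y h => hf ?_) (fun z => ?_) fun y => ?_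
    · exact congrArg (fun z : Q => z.1.1) h
    · obtain ⟨y, hy⟩ := hg (r z)
      exact ⟨⟨(y, z), hy⟩, rfl⟩
    · constructor
      · intro h
        have h2 : y.1.2 = 0 := h
        have h1 : g y.1.1 = 0 := by
          have : g y.1.1 = r y.1.2 := y.2
          rw [this, h2, map_zero]
        obtain ⟨x, hx⟩ := (hfg _).1 h1
        exact ⟨x, Subtype.ext (Prod.ext hx h2.symm)⟩
      · rintro ⟨x, rfl⟩
        rfl
  have hφ : φ ∘ₗ f = q • j := by
    refine LinearMap.ext fun x => Subtype.ext (Prod.ext rfl ?_)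
    change s (g (f x)) = q • (0 : F)
    rw [hfg.apply_apply_eq_zero, map_zero, smul_zero]
  rw [injective_iff_map_eq_zero]
  intro x hx
  have h1 : (φ.rTensor κ) (f.rTensor κ x) = 0 := by rw [hx, map_zero]
  rw [← LinearMap.comp_apply, ← LinearMap.rTensor_comp, hφ, LinearMap.rTensor_smul,
    LinearMap.smul_apply, ← map_smul] at h1
  have h2 : q • x = 0 := hj (h1.trans (map_zero _).symm)
  let e : κ ≃ₗ[A] κ := LinearEquiv.ofBijective (LinearMap.lsmul A κ q) hq
  have h3 : e.lTensor N' x = q • x := by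
    have : e.toLinearMap = q • LinearMap.id := rfl
    rw [← LinearEquiv.coe_coe, LinearEquiv.coe_lTensor, this, LinearMap.lTensor_smul]
    simp
  exact (e.lTensor N').injective ((h3.trans h2).trans (map_zero _).symm)

lemma TorZero.of_iSup {M : Type} [AddCommGroup M] [Module A M] (F : ℕ → Submodule A M)
    (hF : Monotone F) (hM : ∀ x, ∃ l, x ∈ F l) (h : ∀ l, TorZero A κ (F l)) : TorZero A κ M := by
  intro N' N _ _ _ _ f g hf hg hfg
  rw [injective_iff_map_eq_zero]
  intro x hx
  obtain ⟨Q₁, hQ₁, y, rfl⟩ : ∃ Q : Submodule A N', Q.FG ∧ ∃ y, Q.subtype.rTensor κ y = x := by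
    obtain ⟨Q, h1, h2⟩ := Submodule.exists_fg_le_subset_range_rTensor_subtype {x} (by simp)
    exact ⟨Q, h1, h2 rfl⟩
  let Q₂ : Submodule A N := Q₁.map f
  have hQ₂ : Q₂.FG := hQ₁.map f
  let f₁ : Q₁ →ₗ[A] Q₂ := f.restrict fun z hz => ⟨z, hz, rfl⟩
  have e1 : f ∘ₗ Q₁.subtype = Q₂.subtype ∘ₗ f₁ := rfl
  rw [← LinearMap.comp_apply, ← LinearMap.rTensor_comp, e1, LinearMap.rTensor_comp,
    LinearMap.comp_apply] at hx
  obtain ⟨Q₃, hQ₃, hle, h3⟩ := hQ₂.exists_rTensor_fg_inclusion_eq (x := f₁.rTensor κ y) (y := 0)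
    (by rw [hx, map_zero])
  rw [map_zero] at h3
  obtain ⟨l, hl⟩ : ∃ l, Q₃.map g ≤ F l := by
    obtain ⟨s, hs⟩ := hQ₃.map g
    choose L hL using hM
    refine ⟨s.sup L, ?_⟩
    rw [← hs, Submodule.span_le]
    exact fun z hz => hF (Finset.le_sup hz) (hL z)
  let N₁ := (F l).comap g
  have hQN : Q₃ ≤ N₁ := fun z hz => hl ⟨z, hz, rfl⟩
  let f₂ : N' →ₗ[A] N₁ := f.codRestrict N₁ fun z => by simp [N₁, hfg.apply_apply_eq_zero]
  have h4 : Injective (f₂.rTensor κ) := by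
    refine h l N' N₁ f₂ (g.restrict fun z hz => hz) (fun a b hab => hf (congrArg Subtype.val hab))
      (fun z => ?_) fun z => ?_
    · obtain ⟨w, hw⟩ := hg z
      exact ⟨⟨w, by simp [N₁, hw]⟩, Subtype.ext hw⟩
    · constructor
      · intro hz
        obtain ⟨w, hw⟩ := (hfg z).1 (congrArg Subtype.val hz)
        exact ⟨w, Subtype.ext hw⟩
      · rintro ⟨w, rfl⟩
        exact Subtype.ext (hfg.apply_apply_eq_zero w)
  have e2 : f₂ ∘ₗ Q₁.subtype = Submodule.inclusion hQN ∘ₗ Submodule.inclusion hle ∘ₗ f₁ := rfl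
  apply h4
  rw [map_zero, ← LinearMap.comp_apply, ← LinearMap.rTensor_comp, e2, LinearMap.rTensor_comp,
    LinearMap.rTensor_comp, LinearMap.comp_apply, LinearMap.comp_apply, h3, map_zero]

end GenericTorVanishing

section GenericFlatness

open Function

/-- Finitely generated `B`-modules are generically flat over `A`, in the sense that
`TorZero` holds for all coefficients on which a suitable nonzero `q` is invertible. -/
def GenericallyFlat (A B : Type) [CommRing A] [CommRing B] [Algebra A B] : Prop :=
  ∀ (M : Type) [AddCommGroup M] [Module A M] [Module B M] [IsScalarTower A B M]
    [Module.Finite B M], ∃ q : A, q ≠ 0 ∧ ∀ (κ : Type) [AddCommGroup κ] [Module A κ],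
      Bijective (fun x : κ => q • x) → TorZero A κ M

lemma TorZero.of_subsingleton {A : Type} [CommRing A] {κ : Type} [AddCommGroup κ] [Module A κ]
    (M : Type) [AddCommGroup M] [Module A M] [Subsingleton M] : TorZero A κ M := by
  have : Module.Projective A M :=
    Module.Projective.of_equiv (LinearEquiv.ofSubsingleton PUnit.{1} M)
  exact TorZero.of_projective M

lemma bijective_smul_of_mul {A κ : Type} [CommRing A] [AddCommGroup κ] [Module A κ] {q r : A}
    (h : Bijective fun x : κ => (q * r) • x) : Bijective (fun x : κ => q • x) := by
  constructor
  · intro x y hxy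
    apply h.1
    change (q * r) • x = (q * r) • y
    rw [mul_comm, mul_smul, mul_smul]
    exact congrArg (r • ·) hxy
  · intro y
    obtain ⟨x, hx⟩ := h.2 y
    exact ⟨r • x, (mul_smul _ _ _).symm.trans hx⟩

lemma GenericallyFlat.self (A : Type) [CommRing A] [IsDomain A] [IsNoetherianRing A] :
    GenericallyFlat A A := by
  intro M _ iA iA' hs hfin
  have heq : iA = iA' := by
    refine Module.ext' _ _ fun a x => ?_
    have h1 := @IsScalarTower.smul_assoc A A M _ _ _ hs a 1 x
    have h2 : iA'.toSMul.smul 1 x = x := iA'.one_smul x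
    rw [smul_eq_mul, mul_one] at h1
    exact (h1.trans (congrArg _ h2)).symm
  subst heq
  induction hfin using IsNoetherianRing.induction_on_isQuotientEquivQuotientPrime A with
  | subsingleton N => exact ⟨1, one_ne_zero, fun κ _ _ _ => TorZero.of_subsingleton N⟩
  | quotient N p e =>
    by_cases hp : p.1 = ⊥
    · refine ⟨1, one_ne_zero, fun κ _ _ _ => ?_⟩
      have e' : A ≃ₗ[A] N := (Submodule.quotEquivOfEqBot _ hp).symm.trans e.symm
      exact (TorZero.of_projective A).of_equiv e'
    · obtain ⟨q, hq, hq0⟩ := Submodule.exists_mem_ne_zero_of_ne_bot hp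
      refine ⟨q, hq0, fun κ _ _ hκ => ?_⟩
      refine (TorZero.of_subsingleton PUnit).of_smul_eq 0 0 q (fun x => ?_) hκ
      apply e.injective
      obtain ⟨y, hy⟩ := Submodule.mkQ_surjective _ (e x)
      rw [LinearMap.zero_apply, map_zero, map_smul, ← hy, ← map_smul]
      exact ((Submodule.Quotient.mk_eq_zero _).2 (Ideal.mul_mem_right y _ hq)).symm
  | exact N₁ N₂ N₃ f g hf hg hfg h1 h3 =>
    obtain ⟨q, hq, H⟩ := h1
    obtain ⟨r, hr, H'⟩ := h3
    exact ⟨q * r, mul_ne_zero hq hr, fun κ _ _ hκ => (H κ (bijective_smul_of_mul hκ)).of_exact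
      (H' κ (bijective_smul_of_mul (mul_comm q r ▸ hκ))) f g hf hg hfg⟩

lemma GenericallyFlat.of_equiv {A B B' : Type} [CommRing A] [CommRing B] [CommRing B'] [Algebra A B]
    [Algebra A B'] (h : GenericallyFlat A B) (e : B ≃ₐ[A] B') : GenericallyFlat A B' := by
  intro M _ _ _ _ _
  let : Module B M := Module.compHom M (e : B →+* B')
  have hsmul : ∀ (b : B) (x : M), b • x = e b • x := fun _ _ => rfl
  have : IsScalarTower A B M := ⟨fun a b x => by
    rw [hsmul, hsmul, map_smul, smul_assoc]⟩
  have : Module.Finite B M := by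
    obtain ⟨s, hs⟩ := (Module.Finite.fg_top : (⊤ : Submodule B' M).FG)
    refine ⟨⟨s, eq_top_iff.2 fun x _ => ?_⟩⟩
    have hx : x ∈ Submodule.span B' (s : Set M) := hs ▸ Submodule.mem_top
    induction hx using Submodule.span_induction with
    | mem x h => exact Submodule.subset_span h
    | zero => exact Submodule.zero_mem _
    | add x y _ _ hx hy => exact Submodule.add_mem _ (hx trivial) (hy trivial)
    | smul b x _ hx =>
      have : b • x = e.symm b • x := by rw [hsmul, AlgEquiv.apply_symm_apply]
      rw [this]
      exact Submodule.smul_mem _ _ (hx trivial)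
  exact h M

/-- The submodule `∑_{i < l} Xⁱ D`. -/
def powFiltration {B M : Type} [CommRing B] [AddCommGroup M] [Module B M] (T : M →ₗ[B] M)
    (D : Submodule B M) (l : ℕ) : Submodule B M :=
  ⨆ i ∈ Set.Iio l, D.map (T ^ i)

lemma powFiltration_succ {B M : Type} [CommRing B] [AddCommGroup M] [Module B M] (T : M →ₗ[B] M)
    (D : Submodule B M) (l : ℕ) :
    powFiltration T D (l + 1) = powFiltration T D l ⊔ D.map (T ^ l) := by
  have : Set.Iio (l + 1) = insert l (Set.Iio l) := by ext; simp
  rw [powFiltration, this, iSup_insert, sup_comm]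
  rfl

lemma powFiltration_mono {B M : Type} [CommRing B] [AddCommGroup M] [Module B M] (T : M →ₗ[B] M)
    (D : Submodule B M) : Monotone (powFiltration T D) :=
  monotone_nat_of_le_succ fun l => powFiltration_succ T D l ▸ le_sup_left

lemma map_powFiltration_le {B M : Type} [CommRing B] [AddCommGroup M] [Module B M] (T : M →ₗ[B] M)
    (D : Submodule B M) (l : ℕ) : (powFiltration T D l).map T ≤ powFiltration T D (l + 1) := by
  simp only [powFiltration, Submodule.map_iSup, ← Submodule.map_comp]
  refine iSup₂_le fun i hi => ?_
  have : T ∘ₗ (T ^ i) = T ^ (i + 1) := by rw [pow_succ']; rfl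
  rw [this]
  exact le_iSup₂_of_le (i + 1) (Nat.succ_lt_succ hi) le_rfl

lemma TorZero.of_sup_map {A B κ M : Type} [CommRing A] [AddCommGroup κ] [Module A κ] [CommRing B]
    [Algebra A B] [AddCommGroup M] [Module A M] [Module B M] [IsScalarTower A B M]
    (T : M →ₗ[B] M) (D F F' : Submodule B M) (hF' : F' = F ⊔ D.map T) (hF : TorZero A κ F)
    (hK : TorZero A κ (D ⧸ F.comap (T ∘ₗ D.subtype))) : TorZero A κ F' := by
  have hle : F ≤ F' := hF' ▸ le_sup_left
  have hT : D.map T ≤ F' := hF' ▸ le_sup_right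
  let N : Submodule B F' := F.comap F'.subtype
  let ψ : D →ₗ[B] (F' ⧸ N) := N.mkQ ∘ₗ
    (T ∘ₗ D.subtype).codRestrict F' fun x => hT ⟨x, x.2, rfl⟩
  have hψ : Surjective ψ := by
    intro y
    obtain ⟨⟨y, hy⟩, rfl⟩ := N.mkQ_surjective y
    have hy' := hy
    rw [hF'] at hy'
    obtain ⟨y1, hy1, _, ⟨x, hx, rfl⟩, rfl⟩ := Submodule.mem_sup.1 hy'
    refine ⟨⟨x, hx⟩, ?_⟩
    refine (Submodule.Quotient.eq N).2 ?_
    change T x - (y1 + T x) ∈ F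
    rw [sub_add_cancel_right]
    exact neg_mem hy1
  have hkerψ : LinearMap.ker ψ = F.comap (T ∘ₗ D.subtype) := by
    ext x
    exact Submodule.Quotient.mk_eq_zero N
  have e : (D ⧸ F.comap (T ∘ₗ D.subtype)) ≃ₗ[B] (F' ⧸ N) :=
    (Submodule.quotEquivOfEq _ _ hkerψ.symm).trans (ψ.quotKerEquivOfSurjective hψ)
  refine hF.of_exact (hK.of_equiv (e.restrictScalars A))
    ((Submodule.inclusion hle).restrictScalars A)
    (N.mkQ.restrictScalars A) (Submodule.inclusion_injective hle) N.mkQ_surjective fun y => ?_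
  constructor
  · intro hy
    have hy' : (y : M) ∈ F := (Submodule.Quotient.mk_eq_zero N).1 hy
    exact ⟨⟨y, hy'⟩, rfl⟩
  · rintro ⟨x, rfl⟩
    exact (Submodule.Quotient.mk_eq_zero N).2 x.2

lemma GenericallyFlat.exists_torZero {A B M : Type} [CommRing A] [IsDomain A] [CommRing B]
    [Algebra A B] [IsNoetherianRing B] [AddCommGroup M] [Module A M] [Module B M]
    [IsScalarTower A B M] (h : GenericallyFlat A B) (T : M →ₗ[B] M) (D : Submodule B M)
    (hD : D.FG) (hDM : ∀ x, ∃ l, x ∈ powFiltration T D l) :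
    ∃ q : A, q ≠ 0 ∧ ∀ (κ : Type) [AddCommGroup κ] [Module A κ],
      Bijective (fun x : κ => q • x) → TorZero A κ M := by
  let F := powFiltration T D
  have hF0 : F 0 = ⊥ := by simp [F, powFiltration]
  have hT : ∀ l, D.map (T ^ l) ≤ F (l + 1) := fun l => by
    simp only [F, powFiltration_succ]; exact le_sup_right
  let κer : ℕ → Submodule B D := fun l => (F l).comap ((T ^ l) ∘ₗ D.subtype)
  have hκer : Monotone κer := monotone_nat_of_le_succ fun l x hx => by
    have h1 : (T ^ l) x ∈ F l := hx
    have h2 : (T ^ (l + 1)) x = T ((T ^ l) x) := by rw [pow_succ']; rfl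
    change (T ^ (l + 1)) x ∈ F (l + 1)
    rw [h2]
    exact map_powFiltration_le T D l ⟨_, h1, rfl⟩
  have : Module.Finite B D := ⟨(Submodule.fg_top _).2 hD⟩
  have : IsNoetherian B D := isNoetherian_of_isNoetherianRing_of_finite B D
  obtain ⟨l₀, hl₀⟩ := monotone_stabilizes_iff_noetherian.2 ‹IsNoetherian B D› ⟨κer, hκer⟩
  have hl₀' : ∀ l, κer l = κer (min l l₀) := fun l => by
    rcases le_total l l₀ with h | h
    · rw [min_eq_left h]
    · rw [min_eq_right h]; exact (hl₀ l h).symm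
  choose q hq Hq using fun l => h (D ⧸ κer l)
  refine ⟨∏ l ∈ Finset.range (l₀ + 1), q l, Finset.prod_ne_zero_iff.2 fun l _ => hq l,
    fun κ _ _ hκ => ?_⟩
  have hK : ∀ l, TorZero A κ (D ⧸ κer l) := fun l => by
    rw [hl₀' l]
    refine Hq _ κ ?_
    have hmem : min l l₀ ∈ Finset.range (l₀ + 1) := by simp
    rw [← Finset.mul_prod_erase _ _ hmem] at hκ
    exact bijective_smul_of_mul hκ
  have hFl : ∀ l, TorZero A κ (F l) := fun l => by
    induction l with
    | zero =>
      have : Subsingleton (F 0) := by rw [hF0]; infer_instance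
      exact TorZero.of_subsingleton _
    | succ l ih => exact ih.of_sup_map (T ^ l) D (F l) (F (l + 1)) (powFiltration_succ T D l) (hK l)
  exact TorZero.of_iSup (fun l => (F l).restrictScalars A)
    (fun a b hab => powFiltration_mono T D hab) hDM hFl

lemma GenericallyFlat.polynomial {A B : Type} [CommRing A] [IsDomain A] [CommRing B] [Algebra A B]
    [IsNoetherianRing B] (h : GenericallyFlat A B) : GenericallyFlat A (Polynomial B) := by
  intro M _ _ _ _ _
  let : Module B M := Module.compHom M (Polynomial.C : B →+* Polynomial B)
  have hsmul : ∀ (b : B) (x : M), b • x = (Polynomial.C b) • x := fun _ _ => rfl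
  have : IsScalarTower B (Polynomial B) M := ⟨fun b p x => by
    rw [hsmul, ← mul_smul, Polynomial.smul_eq_C_mul]⟩
  have : IsScalarTower A B M := ⟨fun a b x => by
    rw [hsmul, hsmul, ← Polynomial.smul_C, smul_assoc]⟩
  let T : M →ₗ[B] M := (LinearMap.lsmul (Polynomial B) M Polynomial.X).restrictScalars B
  obtain ⟨s, hs⟩ := (Module.Finite.fg_top : (⊤ : Submodule (Polynomial B) M).FG)
  let D : Submodule B M := Submodule.span B (s : Set M)
  refine h.exists_torZero T D ⟨s, rfl⟩ fun x => ?_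
  let F := powFiltration T D
  have hT : ∀ l, D.map (T ^ l) ≤ F (l + 1) := fun l => by
    simp only [F, powFiltration_succ]; exact le_sup_right
  change ∃ l, x ∈ F l
  have hx : x ∈ Submodule.span (Polynomial B) (s : Set M) := hs ▸ Submodule.mem_top
  have hXn : ∀ n l, ∀ x ∈ F l, (T ^ n) x ∈ F (l + n) := fun n l x hx => by
    induction n with
    | zero => exact hx
    | succ n ih =>
      rw [pow_succ']
      exact map_powFiltration_le T D (l + n) ⟨_, ih, rfl⟩
  induction hx using Submodule.span_induction with
  | mem x h => exact ⟨1, hT 0 ⟨x, Submodule.subset_span h, rfl⟩⟩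
  | zero => exact ⟨0, Submodule.zero_mem _⟩
  | add x y _ _ hx hy =>
    obtain ⟨a, ha⟩ := hx
    obtain ⟨b, hb⟩ := hy
    exact ⟨max a b, Submodule.add_mem _ (powFiltration_mono T D (le_max_left a b) ha)
      (powFiltration_mono T D (le_max_right a b) hb)⟩
  | smul p x _ hx =>
    obtain ⟨l, hl⟩ := hx
    induction p using Polynomial.induction_on' with
    | add p r hp hr =>
      obtain ⟨a, ha⟩ := hp
      obtain ⟨b, hb⟩ := hr
      rw [add_smul]
      exact ⟨max a b, Submodule.add_mem _ (powFiltration_mono T D (le_max_left a b) ha)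
        (powFiltration_mono T D (le_max_right a b) hb)⟩
    | monomial n b =>
      refine ⟨l + n, ?_⟩
      have hTn : ∀ n (y : M), (Polynomial.X ^ n : Polynomial B) • y = (T ^ n) y := fun n => by
        induction n with
        | zero => intro y; simp
        | succ n ih => intro y; rw [pow_succ', mul_smul, ih, pow_succ']; rfl
      rw [← Polynomial.C_mul_X_pow_eq_monomial, mul_smul, ← hsmul, hTn]
      exact (F (l + n)).smul_mem b (hXn n l x hl)

lemma GenericallyFlat.mvPolynomial (A : Type) [CommRing A] [IsDomain A] [IsNoetherianRing A]
    (n : ℕ) : GenericallyFlat A (MvPolynomial (Fin n) A) := by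
  induction n with
  | zero => exact (GenericallyFlat.self A).of_equiv (MvPolynomial.isEmptyAlgEquiv A (Fin 0)).symm
  | succ n ih => exact ih.polynomial.of_equiv (MvPolynomial.finSuccEquiv A n).symm

end GenericFlatness

section GenericExactness

open Function TensorProduct

variable {A : Type} [CommRing A] {n : ℕ}

/-- Base change of a finite free `A[X]`-module along `A → κ`. -/
def tensorPiEquiv (A : Type) [CommRing A] (κ : Type) [CommRing κ] [Algebra A κ] (n : ℕ)
    (ι : Type) [Fintype ι] [DecidableEq ι] :
    (ι → MvPolynomial (Fin n) A) ⊗[A] κ ≃ₗ[A] (ι → MvPolynomial (Fin n) κ) :=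
  TensorProduct.comm A (ι → MvPolynomial (Fin n) A) κ ≪≫ₗ
    (TensorProduct.piRight A A κ fun _ : ι => MvPolynomial (Fin n) A) ≪≫ₗ
    LinearEquiv.piCongrRight fun _ =>
      ((MvPolynomial.algebraTensorAlgEquiv (σ := Fin n) A κ).toLinearEquiv.restrictScalars A)

lemma tensorPiEquiv_tmul (κ : Type) [CommRing κ] [Algebra A κ] (ι : Type) [Fintype ι]
    [DecidableEq ι] (f : ι → MvPolynomial (Fin n) A) (c : κ) (i : ι) :
    tensorPiEquiv A κ n ι (f ⊗ₜ c) i = c • MvPolynomial.map (algebraMap A κ) (f i) :=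
  MvPolynomial.algebraTensorAlgEquiv_tmul (R := A) (A := κ) c (f i)

lemma tensorPiEquiv_mulVec (κ : Type) [CommRing κ] [Algebra A κ] {ι ι' : Type} [Fintype ι]
    [DecidableEq ι] [Fintype ι'] [DecidableEq ι'] (U : Matrix ι' ι (MvPolynomial (Fin n) A))
    (x : (ι → MvPolynomial (Fin n) A) ⊗[A] κ) :
    tensorPiEquiv A κ n ι' ((U.mulVecLin.restrictScalars A).rTensor κ x) =
      (U.map (MvPolynomial.map (algebraMap A κ))).mulVec (tensorPiEquiv A κ n ι x) := by
  induction x using TensorProduct.induction_on with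
  | zero => simp
  | add x y hx hy => rw [map_add, map_add, hx, hy, map_add, Matrix.mulVec_add]
  | tmul f c =>
    ext1 i
    rw [LinearMap.rTensor_tmul, tensorPiEquiv_tmul, LinearMap.restrictScalars_apply,
      Matrix.mulVecLin_apply, Matrix.mulVec, dotProduct, map_sum, Finset.smul_sum, Matrix.mulVec,
      dotProduct]
    refine Finset.sum_congr rfl fun j _ => ?_
    rw [tensorPiEquiv_tmul, map_mul, Matrix.map_apply, mul_smul_comm]

lemma TorZero.exact_rTensor {κ : Type} [AddCommGroup κ] [Module A κ] {X₁ X₂ X₃ M : Type}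
    [AddCommGroup X₁] [Module A X₁] [AddCommGroup X₂] [Module A X₂] [AddCommGroup X₃] [Module A X₃]
    [AddCommGroup M] [Module A M] (hM : TorZero A κ M) {w : X₃ →ₗ[A] X₂} {u : X₂ →ₗ[A] X₁}
    {p : X₁ →ₗ[A] M} (hwu : Exact w u) (hup : Exact u p) (hp : Surjective p) :
    Exact (w.rTensor κ) (u.rTensor κ) := by
  have hinj := hM _ _ (LinearMap.range u).subtype p Subtype.val_injective hp fun y =>
    (hup y).trans (by simp)
  have hex : Exact (w.rTensor κ) (u.rangeRestrict.rTensor κ) :=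
    rTensor_exact κ (fun y => Subtype.ext_iff.trans (hwu y)) u.surjective_rangeRestrict
  intro y
  rw [← hex y]
  have h1 : u.rTensor κ y =
      (LinearMap.range u).subtype.rTensor κ (u.rangeRestrict.rTensor κ y) := by
    rw [← LinearMap.comp_apply, ← LinearMap.rTensor_comp]
    rfl
  rw [h1, map_eq_zero_iff _ hinj]

lemma exact_map_of_exact_rTensor (κ : Type) [CommRing κ] [Algebra A κ]
    {ι₁ ι₂ ι₃ : Type} [Fintype ι₁] [Fintype ι₂] [Fintype ι₃] [DecidableEq ι₁] [DecidableEq ι₂]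
    [DecidableEq ι₃] (U : Matrix ι₁ ι₂ (MvPolynomial (Fin n) A))
    (W : Matrix ι₂ ι₃ (MvPolynomial (Fin n) A))
    (hex : Exact ((W.mulVecLin.restrictScalars A).rTensor κ)
      ((U.mulVecLin.restrictScalars A).rTensor κ)) :
    LinearMap.ker (U.map (MvPolynomial.map (algebraMap A κ))).mulVecLin =
      LinearMap.range (W.map (MvPolynomial.map (algebraMap A κ))).mulVecLin := by
  ext y
  obtain ⟨y, rfl⟩ := (tensorPiEquiv A κ n ι₂).surjective y
  rw [LinearMap.mem_ker, Matrix.mulVecLin_apply, ← tensorPiEquiv_mulVec,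
    LinearEquiv.map_eq_zero_iff, hex y]
  constructor
  · rintro ⟨z, rfl⟩
    exact ⟨_, (tensorPiEquiv_mulVec κ W z).symm⟩
  · rintro ⟨z, hz⟩
    obtain ⟨z, rfl⟩ := (tensorPiEquiv A κ n ι₃).surjective z
    exact ⟨z, (tensorPiEquiv A κ n ι₂).injective ((tensorPiEquiv_mulVec κ W z).trans hz)⟩

lemma exact_rTensor_mulVecLin {B κ : Type} [CommRing B] [Algebra A B] [AddCommGroup κ] [Module A κ]
    {ι₁ ι₂ ι₃ : Type} [Fintype ι₂] [Fintype ι₃] (U : Matrix ι₁ ι₂ B) (W : Matrix ι₂ ι₃ B)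
    (h : LinearMap.ker U.mulVecLin = LinearMap.range W.mulVecLin)
    (H : TorZero A κ ((ι₁ → B) ⧸ LinearMap.range U.mulVecLin)) :
    Exact ((W.mulVecLin.restrictScalars A).rTensor κ)
      ((U.mulVecLin.restrictScalars A).rTensor κ) := by
  have h1 : Exact (W.mulVecLin.restrictScalars A) (U.mulVecLin.restrictScalars A) := fun y =>
    (show y ∈ LinearMap.ker U.mulVecLin ↔ y ∈ LinearMap.range W.mulVecLin by rw [h])
  have h2 : Exact (U.mulVecLin.restrictScalars A)
      ((LinearMap.range U.mulVecLin).mkQ.restrictScalars A) :=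
    LinearMap.exact_map_mkQ_range U.mulVecLin
  have h3 : Surjective ((LinearMap.range U.mulVecLin).mkQ.restrictScalars A) :=
    Submodule.mkQ_surjective (LinearMap.range U.mulVecLin)
  exact H.exact_rTensor h1 h2 h3

/-- Exactness of a complex of finite free `A[X]`-modules is preserved under generic
base change. -/
lemma GenericallyFlat.exists_exact_map (hA : GenericallyFlat A (MvPolynomial (Fin n) A))
    {ι₁ ι₂ ι₃ : Type} [Fintype ι₁] [Fintype ι₂] [Fintype ι₃] [DecidableEq ι₁] [DecidableEq ι₂]
    [DecidableEq ι₃] (U : Matrix ι₁ ι₂ (MvPolynomial (Fin n) A))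
    (W : Matrix ι₂ ι₃ (MvPolynomial (Fin n) A))
    (h : LinearMap.ker U.mulVecLin = LinearMap.range W.mulVecLin) :
    ∃ q : A, q ≠ 0 ∧ ∀ (κ : Type) [Field κ] (φ : A →+* κ), φ q ≠ 0 →
      LinearMap.ker (U.map (MvPolynomial.map φ)).mulVecLin =
        LinearMap.range (W.map (MvPolynomial.map φ)).mulVecLin := by
  obtain ⟨q, hq, H⟩ := hA ((ι₁ → MvPolynomial (Fin n) A) ⧸ LinearMap.range U.mulVecLin)
  refine ⟨q, hq, fun κ _ φ hφ => ?_⟩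
  let _ : Algebra A κ := φ.toAlgebra
  have hbij : Bijective fun x : κ => q • x :=
    ⟨fun x y hxy => mul_left_cancel₀ hφ hxy, fun y => ⟨(φ q)⁻¹ * y, mul_inv_cancel_left₀ hφ y⟩⟩
  exact exact_map_of_exact_rTensor κ U W (exact_rTensor_mulVecLin U W h (H κ hbij))

end GenericExactness

section LocalizationLemmas

lemma ker_map_eq_range_map_of_isLocalization {R : Type} [CommRing R] (M : Submonoid R) {S : Type}
    [CommRing S] [Algebra R S] [IsLocalization M S] {ι₁ ι₂ ι₃ : Type} [Finite ι₁] [Fintype ι₂]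
    [Fintype ι₃] (U : Matrix ι₁ ι₂ R) (W : Matrix ι₂ ι₃ R)
    (h : LinearMap.ker U.mulVecLin = LinearMap.range W.mulVecLin) :
    LinearMap.ker (U.map (algebraMap R S)).mulVecLin =
      LinearMap.range (W.map (algebraMap R S)).mulVecLin := by
  have hmap : ∀ {ι κ : Type} [Fintype κ] (V : Matrix ι κ R) (z : κ → R),
      (V.map (algebraMap R S)).mulVec (algebraMap R S ∘ z) = algebraMap R S ∘ V.mulVec z := by
    intro ι κ _ V z
    ext i
    simp [Matrix.mulVec, dotProduct]
  ext y
  rw [LinearMap.mem_ker, Matrix.mulVecLin_apply]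
  constructor
  · intro hy
    obtain ⟨g, hg⟩ := IsLocalization.exist_integer_multiples_of_finite M y
    choose y₀ hy₀ using hg
    have hy₀' : algebraMap R S ∘ y₀ = algebraMap R S g • y := by
      ext i
      simp [hy₀, Algebra.smul_def]
    have h1 : algebraMap R S ∘ U.mulVec y₀ = 0 := by
      rw [← hmap, hy₀', Matrix.mulVec_smul, hy, smul_zero]
    have h2 : ∀ i, ∃ s : M, (s : R) * U.mulVec y₀ i = 0 := fun i =>
      (IsLocalization.map_eq_zero_iff M S _).1 (congrFun h1 i)
    choose s hs using h2
    have := Fintype.ofFinite ι₁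
    have h3 : (∏ i, (s i : R)) • y₀ ∈ LinearMap.ker U.mulVecLin := by
      rw [LinearMap.mem_ker, Matrix.mulVecLin_apply, Matrix.mulVec_smul]
      ext i
      rw [Pi.smul_apply, smul_eq_mul, Pi.zero_apply]
      obtain ⟨c, hc⟩ := Finset.dvd_prod_of_mem (fun i => (s i : R)) (Finset.mem_univ i)
      rw [hc, mul_right_comm, hs, zero_mul]
    rw [h] at h3
    obtain ⟨z, hz⟩ := h3
    have hu : IsUnit (algebraMap R S ((∏ i, s i : M) * g : M)) := IsLocalization.map_units S _
    have h4 : (W.map (algebraMap R S)).mulVec (algebraMap R S ∘ z) =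
        algebraMap R S ((∏ i, s i : M) * g : M) • y := by
      rw [hmap, ← Matrix.mulVecLin_apply, hz]
      ext i
      have h5 := congrFun hy₀' i
      simp only [Function.comp_apply, Pi.smul_apply, smul_eq_mul] at h5 ⊢
      rw [map_mul, h5, ← mul_assoc, ← map_mul]
      simp
    refine ⟨(↑hu.unit⁻¹ : S) • (algebraMap R S ∘ z), ?_⟩
    rw [Matrix.mulVecLin_apply, Matrix.mulVec_smul, h4, smul_smul, IsUnit.val_inv_mul, one_smul]
  · rintro ⟨z, rfl⟩
    rw [Matrix.mulVecLin_apply, Matrix.mulVec_mulVec]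
    have hUW : U * W = 0 := by
      classical
      ext i j
      have h1 : W.mulVecLin (Pi.single j 1) ∈ LinearMap.ker U.mulVecLin := h ▸ ⟨_, rfl⟩
      rw [LinearMap.mem_ker, Matrix.mulVecLin_apply, Matrix.mulVecLin_apply, Matrix.mulVec_mulVec,
        Matrix.mulVec_single_one] at h1
      exact congrFun h1 i
    rw [← Matrix.map_mul, hUW]
    simp

lemma exists_mul_mem_iff_of_isAssociatedPrime {R : Type} [CommRing R] [IsNoetherianRing R]
    {℘ I : Ideal R} (h : IsAssociatedPrime ℘ (R ⧸ I)) : ∃ y, ∀ r, r * y ∈ I ↔ r ∈ ℘ := by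
  obtain ⟨_, f, hf⟩ := (isAssociatedPrime_iff_exists_injective_linearMap _ _).1 h
  obtain ⟨y, hy⟩ := Ideal.Quotient.mk_surjective (f 1)
  refine ⟨y, fun r => ?_⟩
  rw [← Ideal.Quotient.eq_zero_iff_mem, map_mul, hy, ← Ideal.Quotient.eq_zero_iff_mem,
    ← map_eq_zero_iff f hf]
  have : f (Ideal.Quotient.mk ℘ r) = r • f 1 := by
    rw [← map_smul]
    congr 1
    rw [Algebra.smul_def, mul_one]
    rfl
  rw [this, Algebra.smul_def]
  rfl

lemma exists_socle_localization {R : Type} [CommRing R] {℘ I : Ideal R} [℘.IsPrime] {y : R}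
    (hy : ∀ r, r * y ∈ I ↔ r ∈ ℘) (T : Type) [CommRing T] [Algebra R T]
    [IsLocalization.AtPrime T ℘] [IsLocalRing T] :
    ∃ z, z ∉ I.map (algebraMap R T) ∧
      ∀ r ∈ IsLocalRing.maximalIdeal T, r * z ∈ I.map (algebraMap R T) := by
  refine ⟨algebraMap R T y, fun h => ?_, fun r hr => ?_⟩
  · obtain ⟨s, hs, h⟩ := (IsLocalization.algebraMap_mem_map_algebraMap_iff ℘.primeCompl T I y).1 h
    exact hs ((hy s).1 h)
  · rw [← IsLocalization.AtPrime.map_eq_maximalIdeal ℘ T] at hr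
    have h1 : ℘.map (algebraMap R T) ≤
        Submodule.comap (LinearMap.mulRight T (algebraMap R T y)) (I.map (algebraMap R T)) := by
      rw [Ideal.map_le_iff_le_comap]
      intro r hr
      have := Ideal.mem_map_of_mem (algebraMap R T) ((hy r).2 hr)
      rw [map_mul] at this
      exact this
    exact h1 hr

end LocalizationLemmas

section GenericFibre

variable {m n : ℕ}

/-- The local ring `S = R_P` is also a localization of `k[u, X]`. -/
lemma isLocalization_comap_toR (P : Ideal (Rg k m n)) [P.IsPrime] (S : Type) [CommRing S]
    [Algebra (Rg k m n) S] [IsLocalization.AtPrime S P]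
    [Algebra (MvPolynomial (Fin n) (MvPolynomial (Fin m) k)) S]
    (h : algebraMap (MvPolynomial (Fin n) (MvPolynomial (Fin m) k)) S =
      (algebraMap (Rg k m n) S).comp (toR k m n)) :
    IsLocalization.AtPrime S (P.comap (toR k m n)) := by
  let _ : Algebra (MvPolynomial (Fin n) (MvPolynomial (Fin m) k)) (Rg k m n) :=
    MvPolynomial.algebraMvPolynomial
  have : IsLocalization ((nonZeroDivisors (MvPolynomial (Fin m) k)).map (C (σ := Fin n)))
      (Rg k m n) := MvPolynomial.isLocalization (nonZeroDivisors (MvPolynomial (Fin m) k)) (kU k m)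
  have : IsScalarTower (MvPolynomial (Fin n) (MvPolynomial (Fin m) k)) (Rg k m n) S :=
    IsScalarTower.of_algebraMap_eq' h
  exact IsLocalization.isLocalization_isLocalization_atPrime_isLocalization
    ((nonZeroDivisors (MvPolynomial (Fin m) k)).map (C (σ := Fin n))) S P

/-- A point of the generic fibre: a parameter `α`, an associated prime `℘` of `P_α` and a
localization of `R_α` at `℘`. -/
structure SpecPoint (K : Type) [Field K] [Algebra k K] (P : Ideal (Rg k m n)) : Type 1 where
  α : Fin m → K
  ℘ : Ideal (Ra k K n α)
  [prime : ℘.IsPrime]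
  assoc : IsAssociatedPrime ℘ (Ra k K n α ⧸ idealSpec k K n α P)
  T : Type
  [ring : CommRing T]
  [algebra : Algebra (Ra k K n α) T]
  [isLocalization : IsLocalization.AtPrime T ℘]

attribute [instance] SpecPoint.prime SpecPoint.ring SpecPoint.algebra SpecPoint.isLocalization

/-- The filter of generic sets of points. -/
def genericFilter (K : Type) [Field K] [Algebra k K] (P : Ideal (Rg k m n)) :
    Filter (SpecPoint K P) where
  sets := {s | ∃ c : MvPolynomial (Fin m) k, c ≠ 0 ∧ ∀ x : SpecPoint K P,
    evalα k K x.α c ≠ 0 → x ∈ s}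
  univ_sets := ⟨1, one_ne_zero, fun _ _ => trivial⟩
  sets_of_superset := by
    rintro s t ⟨c, hc, h⟩ hst
    exact ⟨c, hc, fun x hx => hst (h x hx)⟩
  inter_sets := by
    rintro s t ⟨c, hc, h⟩ ⟨c', hc', h'⟩
    refine ⟨c * c', mul_ne_zero hc hc', fun x hx => ?_⟩
    rw [map_mul] at hx
    exact ⟨h x (left_ne_zero_of_mul hx), h' x (right_ne_zero_of_mul hx)⟩

lemma eventually_genericFilter {P : Ideal (Rg k m n)} {p : SpecPoint K P → Prop} :
    (∀ᶠ x in genericFilter K P, p x) ↔ ∃ c : MvPolynomial (Fin m) k, c ≠ 0 ∧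
      ∀ x : SpecPoint K P, evalα k K x.α c ≠ 0 → p x := Iff.rfl

lemma idealSpec_eq_map (α : Fin m → K) (P : Ideal (Rg k m n)) :
    idealSpec k K n α P = (P.comap (toR k m n)).map (toRa k K n α) := rfl

lemma eventually_toRa_notMem {P : Ideal (Rg k m n)} [P.IsPrime]
    {g : MvPolynomial (Fin n) (MvPolynomial (Fin m) k)} (hg : g ∉ P.comap (toR k m n)) :
    ∀ᶠ x in genericFilter K P, toRa k K n x.α g ∉ x.℘ := by
  set 𝔭 := P.comap (toR k m n) with h𝔭
  obtain ⟨s, f, hf⟩ := Submodule.fg_iff_exists_fin_generating_family.1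
    (IsNoetherian.noetherian 𝔭)
  obtain ⟨t, W, hW⟩ := exists_mulVecLin_range_eq (LinearMap.ker (rowMatrix g f).mulVecLin)
  obtain ⟨q, hq, H⟩ := (GenericallyFlat.mvPolynomial (MvPolynomial (Fin m) k) n).exists_exact_map
    _ _ hW
  have hprime : 𝔭.IsPrime := Ideal.comap_isPrime _ _
  have hW𝔭 : ∀ j, W (Sum.inl ()) j ∈ 𝔭 := fun j => by
    have h1 := (mul_mem_span_iff hW (W (Sum.inl ()) j)).2 (Ideal.subset_span ⟨j, rfl⟩)
    have h2 : g * W (Sum.inl ()) j ∈ 𝔭 := hf.le h1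
    exact (hprime.mem_or_mem h2).resolve_left hg
  refine eventually_genericFilter.2 ⟨q, hq, fun x hx hgx => ?_⟩
  obtain ⟨y, hy⟩ := exists_mul_mem_iff_of_isAssociatedPrime x.assoc
  have hrow : (rowMatrix g f).map (toRa k K n x.α) =
      rowMatrix (toRa k K n x.α g) fun j => toRa k K n x.α (f j) := by
    ext i j
    rcases j with j | j <;> rfl
  have hex := H _ (evalα k K x.α) hx
  have h1 : Ideal.span (Set.range fun j => toRa k K n x.α (f j)) = idealSpec k K n x.α P := by
    rw [idealSpec_eq_map, ← h𝔭]
    refine (Eq.trans (Ideal.map_span _ _) (by rw [← Set.range_comp]; rfl)).symm.trans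
      (congrArg (Ideal.map (toRa k K n x.α)) hf)
  have h2 := (hy _).2 hgx
  rw [← h1, mul_mem_span_iff (W := W.map (toRa k K n x.α)) (by rw [← hrow]; exact hex)] at h2
  have h3 : y ∈ idealSpec k K n x.α P := by
    rw [idealSpec_eq_map]
    refine Ideal.span_le.2 ?_ h2
    rintro _ ⟨j, rfl⟩
    exact Ideal.mem_map_of_mem _ (hW𝔭 j)
  exact x.prime.ne_top ((Ideal.eq_top_iff_one _).2 ((hy 1).1 (by rwa [one_mul])))

/-- The specializations of `R_P` form a family of local rings under `k[u, X]`. -/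
def specFamily (K : Type) [Field K] [Algebra k K] (P : Ideal (Rg k m n)) [P.IsPrime] :
    SpecFamily (MvPolynomial (Fin n) (MvPolynomial (Fin m) k)) (P.comap (toR k m n))
      (SpecPoint K P) where
  filter := genericFilter K P
  T := SpecPoint.T
  isLocal x := IsLocalization.AtPrime.isLocalRing x.T x.℘
  noetherian x := IsLocalization.isNoetherianRing x.℘.primeCompl x.T inferInstance
  σ x := (algebraMap (Ra k K n x.α) x.T).comp (toRa k K n x.α)
  exact U W h := by
    obtain ⟨q, hq, H⟩ :=
      (GenericallyFlat.mvPolynomial (MvPolynomial (Fin m) k) n).exists_exact_map _ _ h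
    refine eventually_genericFilter.2 ⟨q, hq, fun x hx => ?_⟩
    have := ker_map_eq_range_map_of_isLocalization x.℘.primeCompl (S := x.T) _ _
      (H _ (evalα k K x.α) hx)
    exact this
  isUnit g hg := (eventually_toRa_notMem hg).mono fun x hx =>
    IsLocalization.map_units x.T (⟨_, hx⟩ : x.℘.primeCompl)
  good x := by
    let _ : IsLocalRing x.T := IsLocalization.AtPrime.isLocalRing x.T x.℘
    exact (LocallyGood.mvPolynomial (kA k K x.α) n).exists_good x.℘ x.T
  socle x := by
    let _ : IsLocalRing x.T := IsLocalization.AtPrime.isLocalRing x.T x.℘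
    obtain ⟨y, hy⟩ := exists_mul_mem_iff_of_isAssociatedPrime x.assoc
    have := exists_socle_localization hy x.T
    rw [idealSpec_eq_map, Ideal.map_map] at this
    exact this

end GenericFibre

section Assembly

open IsLocalRing

lemma kills_iff_mem_annihilator {S : Type} [CommRing S] [IsLocalRing S] (i : ℕ) (M : Type)
    [AddCommGroup M] [Module S M] (c : S) :
    Kills c i M ↔ c ∈ Module.annihilator S (localCoh (maximalIdeal S) i M) :=
  (mem_annihilator_localCoh_iff (maximalIdeal S) i M c).symm

lemma annihilator_localCoh_congr {S : Type} [CommRing S] (J : Ideal S) (i : ℕ) {M N : Type}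
    [AddCommGroup M] [Module S M] [AddCommGroup N] [Module S N] (e : M ≃ₗ[S] N) :
    Module.annihilator S (localCoh J i M) = Module.annihilator S (localCoh J i N) :=
  LinearEquiv.annihilator_eq
    ((localCohomology J i).mapIso e.toModuleIso).toLinearEquiv

/-- The isomorphism of a presented module with the cokernel of its presentation matrix. -/
def Present.equiv {S : Type} [CommRing S] {r s : ℕ} {L : Type} [AddCommGroup L] [Module S L]
    (p : Present S r s L) : MatCoker p.A ≃ₗ[S] L :=
  (Submodule.quotEquivOfEq _ _ p.ker_eq.symm).trans (p.π.quotKerEquivOfSurjective p.surj)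

variable {m n : ℕ}

lemma evalα_ne_zero_iff {α : Fin m → K} (c : MvPolynomial (Fin m) k) :
    evalα k K α c ≠ 0 ↔ MvPolynomial.eval α (MvPolynomial.map (algebraMap k K) c) ≠ 0 := by
  have h : (algebraMap (kA k K α) K).comp (evalα k K α) =
      (MvPolynomial.eval α).comp (MvPolynomial.map (algebraMap k K)) := by
    apply MvPolynomial.ringHom_ext
    · intro r
      simp [evalα]
    · intro i
      simp [evalα]
  have h1 := RingHom.congr_fun h c
  rw [RingHom.comp_apply, RingHom.comp_apply] at h1
  rw [← h1]
  exact (map_ne_zero (algebraMap (kA k K α) K)).symm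

lemma isUnit_C_algebraMap {α : Fin m → K} {q : MvPolynomial (Fin m) k} (h : evalα k K α q ≠ 0) :
    IsUnit (C (algebraMap (MvPolynomial (Fin m) k) (kU k m) q) : Rg k m n) := by
  refine IsUnit.map _ (IsUnit.mk0 _ fun h0 => h ?_)
  rw [(map_eq_zero_iff _ (IsFractionRing.injective _ _)).1 h0, map_zero]

lemma spec_of_locElemSpec (P : Ideal (Rg k m n)) [P.IsPrime] {S : Type} [CommRing S]
    [Algebra (Rg k m n) S] [IsLocalization.AtPrime S P]
    [Algebra (MvPolynomial (Fin n) (MvPolynomial (Fin m) k)) S]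
    (h : algebraMap (MvPolynomial (Fin n) (MvPolynomial (Fin m) k)) S =
      (algebraMap (Rg k m n) S).comp (toR k m n)) (x : SpecPoint K P) {a : S} {b : x.T}
    (hab : LocElemSpec P x.℘ a b) : (specFamily K P).Spec x a b := by
  obtain ⟨f, g, fα, gα, hg, hgα, ⟨p, q, hq, hp, hpα⟩, ⟨p', q', hq', hp', hpα'⟩, ha, hb⟩ := hab
  have hu : IsUnit (C (algebraMap (MvPolynomial (Fin m) k) (kU k m) q) : Rg k m n) :=
    isUnit_C_algebraMap hq
  have hu' : IsUnit (C (algebraMap (MvPolynomial (Fin m) k) (kU k m) q') : Rg k m n) :=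
    isUnit_C_algebraMap hq'
  have hC : ∀ q, toR k m n (C q) = C (algebraMap (MvPolynomial (Fin m) k) (kU k m) q) :=
    fun q => MvPolynomial.map_C _ _
  have hCα : ∀ q, toRa k K n x.α (C q) = C (evalα k K x.α q) :=
    fun q => MvPolynomial.map_C _ _
  have e1 : toR k m n (p' * C q) = C (algebraMap _ _ q') * C (algebraMap _ _ q) * g := by
    rw [map_mul, hC, ← hp']; ring
  have e2 : toR k m n (p * C q') = C (algebraMap _ _ q') * C (algebraMap _ _ q) * f := by
    rw [map_mul, hC, ← hp]; ring
  have e3 : toRa k K n x.α (p' * C q) = C (evalα k K x.α q') * C (evalα k K x.α q) * gα := by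
    rw [map_mul, hCα, ← hpα']; ring
  have e4 : toRa k K n x.α (p * C q') = C (evalα k K x.α q') * C (evalα k K x.α q) * fα := by
    rw [map_mul, hCα, ← hpα]; ring
  have ha' : a * algebraMap (Rg k m n) S g = algebraMap (Rg k m n) S f := by
    rw [ha]; exact IsLocalization.mk'_spec S f (⟨g, hg⟩ : P.primeCompl)
  have hb' : b * algebraMap (Ra k K n x.α) x.T gα = algebraMap (Ra k K n x.α) x.T fα := by
    rw [hb]; exact IsLocalization.mk'_spec x.T fα (⟨gα, hgα⟩ : x.℘.primeCompl)
  have hσ : ∀ r, (specFamily K P).σ x r = algebraMap (Ra k K n x.α) x.T (toRa k K n x.α r) :=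
    fun _ => rfl
  refine ⟨p * C q', p' * C q, ?_, ?_, ?_, ?_⟩
  · rw [Ideal.mem_comap, e1, Ideal.unit_mul_mem_iff_mem _ (hu'.mul hu)]
    exact hg
  · rw [hσ, e3, map_mul]
    have hgu : IsUnit (algebraMap (Ra k K n x.α) x.T gα) :=
      IsLocalization.map_units x.T (⟨gα, hgα⟩ : x.℘.primeCompl)
    have hqu : IsUnit (C (evalα k K x.α q') * C (evalα k K x.α q) : Ra k K n x.α) :=
      ((IsUnit.mk0 _ hq').map C).mul ((IsUnit.mk0 _ hq).map C)
    exact (hqu.map _).mul hgu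
  · rw [h, RingHom.comp_apply, RingHom.comp_apply, e1, e2, map_mul, map_mul _ _ f, ← ha']
    ring
  · rw [hσ, hσ, e3, e4, map_mul, map_mul _ _ fα, ← hb']
    exact mul_left_comm _ _ _

lemma eventually_kills_specFamily (P : Ideal (Rg k m n)) [P.IsPrime] (S : Type) [CommRing S]
    [Algebra (Rg k m n) S] [IsLocalization.AtPrime S P] [IsLocalRing S] {i r s t : ℕ}
    (A : Matrix (Fin r) (Fin s) S) (a : Fin t → S)
    (ha : ∀ c, Kills c i (MatCoker A) ↔ c ∈ Ideal.span (Set.range a)) :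
    ∀ᶠ x in genericFilter K P, ∀ (B : Matrix (Fin r) (Fin s) ((specFamily K P).T x))
      (b : Fin t → (specFamily K P).T x),
      MatSpec (LocElemSpec P x.℘ (Sα := x.T)) A B →
        (∀ j, LocElemSpec P x.℘ (Sα := x.T) (a j) (b j)) →
        ∀ c, Kills c i (MatCoker B) ↔ c ∈ Ideal.span (Set.range b) := by
  let _ : Algebra (MvPolynomial (Fin n) (MvPolynomial (Fin m) k)) S :=
    ((algebraMap (Rg k m n) S).comp (toR k m n)).toAlgebra
  have := isLocalization_comap_toR P S rfl
  have : (P.comap (toR k m n)).IsPrime := Ideal.comap_isPrime _ _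
  have : IsNoetherianRing S := IsLocalization.isNoetherianRing P.primeCompl S inferInstance
  obtain ⟨d, hd⟩ := (LocallyGood.mvPolynomial (kU k m) n).exists_good P S
  refine ((specFamily K P).eventually_kills hd A a ha).mono fun x hx B b hB hb =>
    hx B b (fun i j => ?_) fun j => ?_
  · exact spec_of_locElemSpec P rfl x (hB i j)
  · exact spec_of_locElemSpec P rfl x (hb j)

end Assembly

/-- the annihilators of local cohomology specialize: for a finitely
generated `S`-module `L` and each `i ≥ 0`, for almost all `α`,
`Ann H^i_𝔫(L_α) = (Ann H^i_𝔪(L))_α`, the ideal of `S_α` generated by the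
specializations of a fixed system of generators of `Ann H^i_𝔪(L)`. -/
theorem specialization_of_annihilators_of_local_cohomology
    (k K : Type) [Field k] [Field K] [Algebra k K] [Infinite K] {m n : ℕ}
    (P : Ideal (Rg k m n)) [P.IsPrime]
    (S : Type) [CommRing S] [Algebra (Rg k m n) S] [IsLocalization.AtPrime S P]
    (L : Type) [AddCommGroup L] [Module S L] [Module.Finite S L]
    {rL sL : ℕ} (pL : Present S rL sL L) (i : ℕ) {t : ℕ} (a : Fin t → S)
    (ha : letI : IsLocalRing S := IsLocalization.AtPrime.isLocalRing S P
      Ideal.span (Set.range a) =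
        Module.annihilator S (localCoh (IsLocalRing.maximalIdeal S) i L)) :
    AlmostAll K m fun α =>
      ∀ (℘ : Ideal (Ra k K n α))
        (h℘ : IsAssociatedPrime ℘ ((Ra k K n α) ⧸ idealSpec k K n α P)),
        haveI := h℘.isPrime
        ∀ (Sα : Type) [CommRing Sα] [Algebra (Ra k K n α) Sα]
          [IsLocalization.AtPrime Sα ℘],
          haveI : IsLocalRing Sα := IsLocalization.AtPrime.isLocalRing Sα ℘
          ∀ (B : Matrix (Fin rL) (Fin sL) Sα) (b : Fin t → Sα),
          MatSpec (LocElemSpec P ℘) pL.A B →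
          (∀ j, LocElemSpec P ℘ (a j) (b j)) →
          Module.annihilator Sα
              (localCoh (IsLocalRing.maximalIdeal Sα) i (MatCoker B)) =
            Ideal.span (Set.range b) := by
  let _ : IsLocalRing S := IsLocalization.AtPrime.isLocalRing S P
  have ha' : ∀ c, Kills c i (MatCoker pL.A) ↔ c ∈ Ideal.span (Set.range a) := fun c => by
    rw [kills_iff_mem_annihilator, annihilator_localCoh_congr _ _ pL.equiv, ← ha]
  obtain ⟨c, hc, H⟩ := eventually_genericFilter.1
    (eventually_kills_specFamily (K := K) P S pL.A a ha')
  refine ⟨MvPolynomial.map (algebraMap k K) c, ?_, fun α hα ℘ h℘ => ?_⟩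
  · rwa [Ne, map_eq_zero_iff _ (MvPolynomial.map_injective _ (algebraMap k K).injective)]
  · intro Sα _ _ _ B b hB hb
    have := h℘.isPrime
    let _ : IsLocalRing Sα := IsLocalization.AtPrime.isLocalRing Sα ℘
    ext e
    rw [← kills_iff_mem_annihilator]
    exact H ⟨α, ℘, h℘, Sα⟩ ((evalα_ne_zero_iff c).2 hα) B b hB hb e

end Spl
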